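/- The number of codewords of the Reed–Muller code R(4,9) of Hamming weight exactly 64 is 89163020044002040. -/

import Mathlib

open Finset Polynomial

/-- A Boolean function in `m` variables. -/
abbrev BF (m : ℕ) := (Fin m → ZMod 2) → ZMod 2

/-- The coefficient of the monomial `∏_{i ∈ S} x i` in the algebraic normal form of `f`:
by Möbius inversion over `𝔽₂`, it equals the sum of `f x` over all inputs `x`
whose support is contained in `S`. -/
def anf {m : ℕ} (f : BF m) (S : Finset (Fin m)) : ZMod 2 :=
  ∑ x ∈ Finset.univ.filter (fun x : Fin m → ZMod 2 => ∀ i, x i = 1 → i ∈ S), f x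

/-- The Reed–Muller code `R(r,m)`: Boolean functions in `m` variables of
algebraic degree at most `r`. -/
def RM (r m : ℕ) : Finset (BF m) :=
  Finset.univ.filter (fun f => ∀ S : Finset (Fin m), r < S.card → anf f S = 0)

/-- `H^{(r)}(m)`: Boolean functions in `m` variables whose algebraic normal form is
homogeneous of degree `r`, together with the zero function. -/
def Hom (r m : ℕ) : Finset (BF m) :=
  Finset.univ.filter (fun f => ∀ S : Finset (Fin m), anf f S ≠ 0 → S.card = r)

/-- The Hamming weight of a Boolean function. -/
def wt {m : ℕ} (f : BF m) : ℕ := (Finset.univ.filter (fun x => f x = 1)).card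

/-- The coset `p + C`. -/
def coset {m : ℕ} (p : BF m) (C : Finset (BF m)) : Finset (BF m) :=
  C.image (fun g => p + g)

/-- The weight enumerator `W[z; C] = ∑_{f ∈ C} z^{wt f}` of a finite set `C` of
Boolean functions. -/
noncomputable def WE {m : ℕ} (C : Finset (BF m)) : Polynomial ℕ :=
  ∑ f ∈ C, X ^ wt f

/-- The space `𝔽₂ⁿ`. -/
abbrev Pt (n : ℕ) := Fin n → ZMod 2

namespace BoolFun

theorem zmod2_cases (a : ZMod 2) : a = 0 ∨ a = 1 := by
  revert a; decide

theorem zmod2_ne_zero {a : ZMod 2} : a ≠ 0 ↔ a = 1 := by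
  revert a; decide

theorem zmod2_ne_one {a : ZMod 2} : a ≠ 1 ↔ a = 0 := by
  revert a; decide

theorem pi_add_self {ι : Type*} (f : ι → ZMod 2) : f + f = 0 :=
  funext fun _ => CharTwo.add_self_eq_zero _

theorem pi_add_add_cancel {ι : Type*} (f g : ι → ZMod 2) : f + (f + g) = g := by
  rw [← add_assoc, pi_add_self, zero_add]

theorem pi_add_eq_zero {ι : Type*} {f g : ι → ZMod 2} : f + g = 0 ↔ f = g := by
  constructor
  · intro h
    calc f = f + (f + g) := by rw [h, add_zero]
      _ = g := pi_add_add_cancel f g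
  · rintro rfl
    exact pi_add_self f

/-- The derivative of `f` in direction `e`. -/
def der {n : ℕ} (e : Pt n) (f : BF n) : BF n := fun x => f (x + e) + f x

/-- `Deg k f`: the Boolean function `f` has degree less than `k`. -/
def Deg {n : ℕ} : ℕ → BF n → Prop
  | 0, f => f = 0
  | k + 1, f => ∀ e, Deg k (der e f)

variable {n m k j : ℕ} {f g h : BF n}

theorem der_zero (e : Pt n) : der e (0 : BF n) = 0 := by
  funext x; simp [der]

theorem der_add (e : Pt n) (f g : BF n) : der e (f + g) = der e f + der e g := by
  funext x; simp only [der, Pi.add_apply]; ring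

theorem Deg.zero (k : ℕ) : Deg k (0 : BF n) := by
  induction k with
  | zero => rfl
  | succ k ih => intro e; rw [der_zero]; exact ih

theorem Deg.add (hf : Deg k f) (hg : Deg k g) : Deg k (f + g) := by
  induction k generalizing f g with
  | zero => rw [Deg] at *; rw [hf, hg, add_zero]
  | succ k ih => intro e; rw [der_add]; exact ih (hf e) (hg e)

theorem Deg.add_iff_right (hf : Deg k f) : Deg k (f + g) ↔ Deg k g :=
  ⟨fun h => by simpa [pi_add_add_cancel] using hf.add h, fun h => hf.add h⟩

theorem Deg.add_iff_left (hg : Deg k g) : Deg k (f + g) ↔ Deg k f := by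
  rw [add_comm]; exact hg.add_iff_right

theorem Deg.succ (hf : Deg k f) : Deg (k + 1) f := by
  induction k generalizing f with
  | zero => rw [Deg] at hf; subst hf; exact Deg.zero _
  | succ k ih => intro e; exact ih (hf e)

theorem Deg.mono (hf : Deg k f) (hkj : k ≤ j) : Deg j f := by
  induction hkj with
  | refl => exact hf
  | step _ ih => exact ih.succ

theorem Deg.comp (hf : Deg k f) (φ L : Pt m → Pt n) (hφ : ∀ x e, φ (x + e) = φ x + L e) :
    Deg k (f ∘ φ) := by
  induction k generalizing f with
  | zero => rw [Deg] at *; subst hf; rfl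
  | succ k ih =>
    intro e
    have : der e (f ∘ φ) = der (L e) f ∘ φ := by
      funext x; simp [der, hφ]
    rw [this]; exact ih (hf _)

theorem deg_one_iff : Deg 1 f ↔ ∃ c, f = fun _ => c := by
  constructor
  · intro h
    refine ⟨f 0, funext fun x => ?_⟩
    have := congrFun (show der x f = 0 from h x) 0
    simp only [der, zero_add, Pi.zero_apply] at this
    exact CharTwo.add_eq_zero.mp this
  · rintro ⟨c, rfl⟩ e
    funext x
    exact CharTwo.add_self_eq_zero c

theorem deg_const (c : ZMod 2) : Deg (k + 1) (fun _ : Pt n => c) :=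
  (deg_one_iff.2 ⟨c, rfl⟩).mono (by omega)

theorem der_mul (e : Pt n) (f g : BF n) :
    der e (f * g) = der e f * g + (f * der e g + der e f * der e g) := by
  funext x
  simp only [der, Pi.add_apply, Pi.mul_apply]
  generalize f (x + e) = a
  generalize f x = b
  generalize g (x + e) = c
  generalize g x = d
  revert a b c d; decide

theorem Deg.mul : ∀ {j k : ℕ} {f g : BF n}, Deg (j + 1) f → Deg (k + 1) g →
    Deg (j + k + 1) (f * g)
  | 0, k, f, g, hf, hg => by
    obtain ⟨c, rfl⟩ := deg_one_iff.1 hf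
    rw [zero_add]
    rcases zmod2_cases c with rfl | rfl
    · convert Deg.zero (n := n) (k + 1); funext x; simp
    · convert hg; funext x; simp
  | j + 1, 0, f, g, hf, hg => by
    obtain ⟨c, rfl⟩ := deg_one_iff.1 hg
    rcases zmod2_cases c with rfl | rfl
    · convert Deg.zero (n := n) _; funext x; simp
    · convert hf; funext x; simp
  | j + 1, k + 1, f, g, hf, hg => by
    intro e
    rw [der_mul]
    refine Deg.add ?_ (Deg.add ?_ ?_)
    · exact (Deg.mul (hf e) hg).mono (by omega)
    · exact (Deg.mul hf (hg e)).mono (by omega)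
    · exact (Deg.mul (hf e) (hg e)).mono (by omega)
termination_by j k => j + k

/-- Prepend a coordinate. -/
abbrev pcons (t : ZMod 2) (x : Pt n) : Pt (n + 1) := Fin.cons t x

/-- Drop the first coordinate. -/
abbrev ptail (x : Pt (n + 1)) : Pt n := Fin.tail x

theorem pcons_add (s t : ZMod 2) (x y : Pt n) : pcons s x + pcons t y = pcons (s + t) (x + y) := by
  funext i
  refine Fin.cases ?_ (fun i => ?_) i <;> simp

theorem pcons_zero : pcons (0 : ZMod 2) (0 : Pt n) = 0 := by
  funext i
  refine Fin.cases ?_ (fun i => ?_) i <;> simp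

theorem pcons_ptail (x : Pt (n + 1)) : pcons (x 0) (ptail x) = x := Fin.cons_self_tail x

theorem forall_pcons {p : Pt (n + 1) → Prop} : (∀ x, p x) ↔
    (∀ x, p (pcons 0 x)) ∧ ∀ x, p (pcons 1 x) := by
  refine ⟨fun h => ⟨fun x => h _, fun x => h _⟩, fun h x => ?_⟩
  rw [← pcons_ptail x]
  rcases zmod2_cases (x 0) with h0 | h0 <;> rw [h0]
  exacts [h.1 _, h.2 _]

/-- Restriction to the hyperplane `x₀ = 0`. -/
def lo (f : BF (n + 1)) : BF n := fun x => f (pcons 0 x)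

/-- Restriction to the hyperplane `x₀ = 1`. -/
def hi (f : BF (n + 1)) : BF n := fun x => f (pcons 1 x)

/-- The function with given restrictions to the hyperplanes `x₀ = 0` and `x₀ = 1`. -/
def glue (f g : BF n) : BF (n + 1) := fun x => if x 0 = 0 then f (ptail x) else g (ptail x)

@[simp] theorem lo_glue (f g : BF n) : lo (glue f g) = f := by
  funext x; simp [lo, glue, pcons, ptail]

@[simp] theorem hi_glue (f g : BF n) : hi (glue f g) = g := by
  funext x; simp [hi, glue, pcons, ptail]

@[simp] theorem glue_lo_hi (f : BF (n + 1)) : glue (lo f) (hi f) = f := by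
  funext x
  conv_rhs => rw [← pcons_ptail x]
  rcases zmod2_cases (x 0) with h | h <;> simp [lo, hi, glue, h]

@[simp] theorem lo_add (f g : BF (n + 1)) : lo (f + g) = lo f + lo g := rfl
@[simp] theorem hi_add (f g : BF (n + 1)) : hi (f + g) = hi f + hi g := rfl
@[simp] theorem lo_zero : lo (0 : BF (n + 1)) = 0 := rfl
@[simp] theorem hi_zero : hi (0 : BF (n + 1)) = 0 := rfl

/-- A function on `𝔽₂ⁿ⁺¹` is the same as a pair of functions on `𝔽₂ⁿ`. -/
def splitEquiv (n : ℕ) : BF (n + 1) ≃ BF n × BF n where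
  toFun f := (lo f, hi f)
  invFun p := glue p.1 p.2
  left_inv f := glue_lo_hi f
  right_inv p := by simp

theorem ext_halves {f g : BF (n + 1)} : f = g ↔ lo f = lo g ∧ hi f = hi g := by
  rw [← (splitEquiv n).injective.eq_iff]
  simp [splitEquiv]

theorem glue_add (f g f' g' : BF n) : glue f g + glue f' g' = glue (f + f') (g + g') := by
  rw [ext_halves]; simp

theorem Deg.lo {f : BF (n + 1)} (hf : Deg k f) : Deg k (lo f) :=
  hf.comp (fun x => pcons 0 x) (fun x => pcons 0 x) (fun x e => by rw [pcons_add, add_zero])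

theorem Deg.hi {f : BF (n + 1)} (hf : Deg k f) : Deg k (hi f) :=
  hf.comp (fun x => pcons 1 x) (fun x => pcons 0 x) (fun x e => by rw [pcons_add, add_zero])

theorem Deg.lo_add_hi {f : BF (n + 1)} (hf : Deg (k + 1) f) :
    Deg k (BoolFun.lo f + BoolFun.hi f) := by
  have h := Deg.lo (hf (pcons 1 0))
  convert h using 1
  funext x
  simp only [Pi.add_apply, BoolFun.lo, BoolFun.hi, der]
  rw [pcons_add, add_zero, zero_add, add_comm]

/-- A linear functional `x ↦ a ⬝ᵥ x` as a Boolean function. -/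
def lin (a : Pt n) : BF n := fun x => a ⬝ᵥ x

theorem deg_lin (a : Pt n) : Deg 2 (lin a) := by
  intro e
  refine deg_one_iff.2 ⟨a ⬝ᵥ e, funext fun x => ?_⟩
  simp only [der, lin, dotProduct_add]
  rw [add_right_comm, CharTwo.add_self_eq_zero, zero_add]

theorem deg_coord (i : Fin n) : Deg 2 (fun x : Pt n => x i) := by
  intro e
  refine deg_one_iff.2 ⟨e i, funext fun x => ?_⟩
  simp only [der, Pi.add_apply]
  rw [add_right_comm, CharTwo.add_self_eq_zero, zero_add]

theorem deg_succ_iff {f : BF (n + 1)} :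
    Deg (k + 1) f ↔ Deg (k + 1) (lo f) ∧ Deg k (lo f + hi f) := by
  refine ⟨fun h => ⟨h.lo, h.lo_add_hi⟩, fun ⟨h0, h1⟩ => ?_⟩
  have key : f = lo f ∘ ptail + (fun x : Pt (n + 1) => x 0) * ((lo f + hi f) ∘ ptail) := by
    rw [ext_halves]
    constructor
    · funext x
      simp [lo, pcons, ptail]
    · funext x
      simp only [lo, hi, pcons, ptail, Pi.add_apply, Pi.mul_apply, Function.comp, Fin.tail_cons,
        Fin.cons_zero, one_mul]
      rw [← add_assoc, CharTwo.add_self_eq_zero, zero_add]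
  have ht : ∀ x e : Pt (n + 1), ptail (x + e) = ptail x + ptail e := fun _ _ => rfl
  rw [key]
  refine (h0.comp _ _ ht).add ?_
  have h1' := h1.comp _ _ ht
  cases k with
  | zero =>
    rw [Deg] at h1'
    rw [h1', mul_zero]; exact Deg.zero _
  | succ k =>
    have := Deg.mul (deg_coord (0 : Fin (n + 1))) h1'
    exact this.mono (by omega)

theorem deg_zero_halves {f : BF (n + 1)} : Deg 0 f ↔ Deg 0 (lo f) ∧ Deg 0 (hi f) := by
  simp only [Deg]; rw [ext_halves]; simp

theorem deg_glue {f g : BF n} : Deg (k + 1) (glue f g) ↔ Deg (k + 1) f ∧ Deg k (f + g) := by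
  rw [deg_succ_iff, lo_glue, hi_glue]

/-! ### Comparison with the algebraic normal form -/

theorem sum_halves {M : Type*} [AddCommMonoid M] (F : Pt (n + 1) → M) :
    ∑ x, F x = ∑ x, F (pcons 0 x) + ∑ x, F (pcons 1 x) := by
  rw [← (Fin.consEquiv fun _ => ZMod 2).sum_comp, Fintype.sum_prod_type,
    show (univ : Finset (ZMod 2)) = {0, 1} from rfl, Finset.sum_pair (by decide)]
  rfl

theorem anf_pcons (f : BF (n + 1)) (S : Finset (Fin n)) :
    anf f (S.map (Fin.succEmb n)) = anf (lo f) S ∧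
    anf f (insert 0 (S.map (Fin.succEmb n))) = anf (lo f + hi f) S := by
  constructor
  · unfold anf
    rw [Finset.sum_filter, Finset.sum_filter, sum_halves]
    have : ∀ x : Pt n, ¬ (∀ i, pcons 1 x i = 1 → i ∈ S.map (Fin.succEmb n)) := by
      intro x hx
      have := hx 0 (by simp)
      simp at this
    simp only [this, if_false, Finset.sum_const_zero, add_zero]
    refine Finset.sum_congr rfl fun x _ => ?_
    have : (∀ i, pcons 0 x i = 1 → i ∈ S.map (Fin.succEmb n)) ↔ ∀ i, x i = 1 → i ∈ S := by
      rw [Fin.forall_fin_succ]; simp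
    simp only [this]; rfl
  · unfold anf
    rw [Finset.sum_filter, Finset.sum_filter, sum_halves]
    have : ∀ t, ∀ x : Pt n, (∀ i, pcons t x i = 1 → i ∈ insert 0 (S.map (Fin.succEmb n))) ↔
        ∀ i, x i = 1 → i ∈ S := by
      intro t x
      rw [Fin.forall_fin_succ]; simp
    simp only [this, ← Finset.sum_add_distrib]
    refine Finset.sum_congr rfl fun x _ => ?_
    split_ifs
    · rfl
    · simp

theorem forall_finset_fin_succ {p : Finset (Fin (n + 1)) → Prop} :
    (∀ S, p S) ↔ (∀ S : Finset (Fin n), p (S.map (Fin.succEmb n))) ∧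
      ∀ S : Finset (Fin n), p (insert 0 (S.map (Fin.succEmb n))) := by
  refine ⟨fun h => ⟨fun S => h _, fun S => h _⟩, fun h S => ?_⟩
  have hS : ∀ T : Finset (Fin (n + 1)), 0 ∉ T →
      ∃ R : Finset (Fin n), R.map (Fin.succEmb n) = T := by
    intro T hT
    refine ⟨T.preimage Fin.succ (Fin.succ_injective n).injOn, ?_⟩
    ext i
    refine Fin.cases ?_ (fun i => ?_) i
    · simp [hT]
    · simp
  by_cases h0 : 0 ∈ S
  · obtain ⟨R, hR⟩ := hS (S.erase 0) (by simp)
    rw [← Finset.insert_erase h0, ← hR]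
    exact h.2 R
  · obtain ⟨R, hR⟩ := hS S h0
    rw [← hR]
    exact h.1 R

theorem deg_iff_anf : ∀ {n k : ℕ} {f : BF n},
    Deg k f ↔ ∀ S : Finset (Fin n), k ≤ S.card → anf f S = 0
  | 0, 0, f => by
    have : ∀ S, anf f S = f default := by
      intro S
      unfold anf
      rw [Finset.filter_true_of_mem (fun x _ i => i.elim0), Finset.univ_unique,
        Finset.sum_singleton]
      exact congrArg f (Subsingleton.elim _ _)
    simp only [this, Deg]
    constructor
    · rintro rfl; simp
    · intro h; funext x
      rw [Subsingleton.elim x default]; exact h ∅ (by simp)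
  | 0, k + 1, f => by
    refine ⟨fun _ S hS => ?_, fun _ => ?_⟩
    · have : S.card = 0 := by rw [Finset.card_eq_zero]; exact Finset.eq_empty_of_isEmpty S
      omega
    · refine (deg_one_iff.2 ⟨f default, funext fun x => ?_⟩).mono (by omega)
      rw [Subsingleton.elim x default]
  | n + 1, 0, f => by
    rw [deg_zero_halves, forall_finset_fin_succ]
    have h : (Deg 0 (lo f) ∧ Deg 0 (hi f)) ↔ (Deg 0 (lo f) ∧ Deg 0 (lo f + hi f)) := by
      refine and_congr_right fun h => ?_
      rw [h.add_iff_right]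
    rw [h, deg_iff_anf, deg_iff_anf]
    simp [anf_pcons]
  | n + 1, k + 1, f => by
    rw [deg_succ_iff, forall_finset_fin_succ, deg_iff_anf, deg_iff_anf]
    have : ∀ S : Finset (Fin n), (insert 0 (S.map (Fin.succEmb n))).card = S.card + 1 := by
      intro S
      rw [Finset.card_insert_of_notMem (by simp), Finset.card_map]
    simp [anf_pcons, this]

theorem mem_RM {r : ℕ} : f ∈ RM r n ↔ Deg (r + 1) f := by
  rw [deg_iff_anf]; simp [RM]

/-! ### Weights -/

theorem wt_eq_sum (f : BF n) : wt f = ∑ x, if f x = 1 then 1 else 0 := by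
  rw [wt, Finset.card_filter]

theorem wt_halves (f : BF (n + 1)) : wt f = wt (lo f) + wt (hi f) := by
  simp only [wt_eq_sum]; exact sum_halves _

@[simp] theorem wt_glue (f g : BF n) : wt (glue f g) = wt f + wt g := by
  rw [wt_halves, lo_glue, hi_glue]

@[simp] theorem wt_zero : wt (0 : BF n) = 0 := by simp [wt]

theorem wt_eq_zero : wt f = 0 ↔ f = 0 := by
  refine ⟨fun h => funext fun x => ?_, fun h => by rw [h, wt_zero]⟩
  rw [wt, Finset.card_eq_zero, Finset.filter_eq_empty_iff] at h
  exact zmod2_ne_one.1 (h (Finset.mem_univ x))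

theorem wt_pos : 0 < wt f ↔ f ≠ 0 := by
  rw [Nat.pos_iff_ne_zero, Ne, wt_eq_zero]

theorem wt_add (f g : BF n) : wt (f + g) + 2 * wt (f * g) = wt f + wt g := by
  simp only [wt_eq_sum, Finset.mul_sum, ← Finset.sum_add_distrib]
  refine Finset.sum_congr rfl fun x _ => ?_
  change ((if f x + g x = 1 then 1 else 0) + 2 * if f x * g x = 1 then 1 else 0) =
    (if f x = 1 then 1 else 0) + if g x = 1 then 1 else 0
  generalize f x = a
  generalize g x = b
  revert a b; decide

theorem card_Pt : Fintype.card (Pt n) = 2 ^ n := by simp [ZMod.card]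

theorem wt_add_one (f : BF n) : wt (f + 1) + wt f = 2 ^ n := by
  simp only [wt_eq_sum, ← Finset.sum_add_distrib]
  rw [← card_Pt (n := n), ← Finset.card_univ, Finset.card_eq_sum_ones]
  refine Finset.sum_congr rfl fun x _ => ?_
  change ((if f x + 1 = 1 then 1 else 0) + if f x = 1 then 1 else 0) = 1
  generalize f x = a
  revert a; decide

theorem wt_one : wt (1 : BF n) = 2 ^ n := by simpa using wt_add_one (0 : BF n)

theorem wt_le (f : BF n) : wt f ≤ 2 ^ n := by have := wt_add_one f; omega

theorem wt_comp (f : BF n) (E : Pt m ≃ Pt n) : wt (f ∘ E) = wt f := by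
  simp only [wt_eq_sum]
  exact E.sum_comp (fun x => if f x = 1 then 1 else 0)

theorem dvd_wt_lo_add (f : BF (n + 1)) :
    wt f + 2 * wt (lo f * (lo f + hi f)) = 2 * wt (lo f) + wt (lo f + hi f) := by
  have h1 := wt_add (lo f) (lo f + hi f)
  rw [pi_add_add_cancel] at h1
  have h2 := wt_halves f
  omega

/-! ### Fourier transform -/

/-- The nontrivial additive character of `𝔽₂`. -/
def chi (a : ZMod 2) : ℤ := if a = 0 then 1 else -1

/-- The indicator of `1`. -/
def ind (a : ZMod 2) : ℤ := if a = 1 then 1 else 0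

@[simp] theorem chi_zero : chi 0 = 1 := rfl
@[simp] theorem chi_one : chi 1 = -1 := rfl

theorem chi_add (a b : ZMod 2) : chi (a + b) = chi a * chi b := by
  revert a b; decide

theorem chi_sq (a : ZMod 2) : chi a * chi a = 1 := by revert a; decide

theorem chi_eq (a : ZMod 2) : chi a = 1 - 2 * ind a := by revert a; decide

/-- The Fourier transform of an integer-valued function on `𝔽₂ⁿ`. -/
def hat (F : Pt n → ℤ) (a : Pt n) : ℤ := ∑ x, F x * chi (a ⬝ᵥ x)

theorem dot_pcons (s t : ZMod 2) (x y : Pt n) : pcons s x ⬝ᵥ pcons t y = s * t + x ⬝ᵥ y := by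
  simp [dotProduct, Fin.sum_univ_succ]

theorem hat_pcons (F : Pt (n + 1) → ℤ) (s : ZMod 2) (a : Pt n) :
    hat F (pcons s a) =
      hat (fun x => F (pcons 0 x)) a + chi s * hat (fun x => F (pcons 1 x)) a := by
  unfold hat
  rw [sum_halves, Finset.mul_sum]
  simp only [dot_pcons, mul_zero, zero_add, mul_one, chi_add]
  congr 1
  refine Finset.sum_congr rfl fun x _ => ?_
  ring

theorem parseval_inner : ∀ {n : ℕ} (F G : Pt n → ℤ),
    ∑ a, hat F a * hat G a = 2 ^ n * ∑ x, F x * G x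
  | 0, F, G => by
    have h : ∀ F : Pt 0 → ℤ, hat F default = F default := by
      intro F
      rw [hat, Fintype.sum_subsingleton _ default]
      simp [dotProduct]
    rw [Fintype.sum_subsingleton _ default, Fintype.sum_subsingleton _ default, h, h]
    simp
  | n + 1, F, G => by
    rw [sum_halves, sum_halves (fun x => F x * G x)]
    simp only [hat_pcons, chi_zero, chi_one, one_mul]
    rw [← Finset.sum_add_distrib, mul_add, pow_succ, mul_assoc, mul_assoc,
      mul_left_comm, mul_left_comm (2 ^ n), ← parseval_inner, ← parseval_inner, Finset.mul_sum,
      Finset.mul_sum, ← Finset.sum_add_distrib]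
    refine Finset.sum_congr rfl fun x _ => ?_
    ring

/-- The signed sum of a linear character over the support of `f`. -/
def S (f : BF n) (a : Pt n) : ℤ := hat (fun x => ind (f x)) a

/-- The Walsh transform. -/
def W (f : BF n) (a : Pt n) : ℤ := hat (fun x => chi (f x)) a

theorem sum_ind (f : BF n) : ∑ x, ind (f x) = wt f := by
  rw [wt_eq_sum]; push_cast; rfl

theorem S_zero (f : BF n) : S f 0 = wt f := by
  simp [S, hat, sum_ind]

theorem W_zero (f : BF n) : W f 0 = 2 ^ n - 2 * wt f := by
  simp only [W, hat, zero_dotProduct, chi_zero, mul_one]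
  simp only [chi_eq, Finset.sum_sub_distrib, ← Finset.mul_sum, sum_ind]
  simp [ZMod.card]

theorem W_eq (f : BF n) (a : Pt n) : W f a = W (f + lin a) 0 := by
  simp [W, hat, lin, chi_add]

theorem sum_S_mul (f g : BF n) : ∑ a, S f a * S g a = 2 ^ n * wt (f * g) := by
  unfold S
  rw [parseval_inner, ← sum_ind]
  congr 1
  refine Finset.sum_congr rfl fun x _ => ?_
  simp only [Pi.mul_apply]
  generalize f x = a
  generalize g x = b
  revert a b; decide

theorem mul_self_BF (f : BF n) : f * f = f := by
  funext x
  simp only [Pi.mul_apply]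
  generalize f x = a
  revert a; decide

theorem sum_S_sq (f : BF n) : ∑ a, S f a ^ 2 = 2 ^ n * wt f := by
  simp only [pow_two, sum_S_mul, mul_self_BF]

theorem sum_W_sq (f : BF n) : ∑ a, W f a ^ 2 = 4 ^ n := by
  simp only [pow_two, W, parseval_inner, chi_sq]
  simp only [Finset.sum_const, Finset.card_univ, card_Pt]
  rw [nsmul_eq_mul, mul_one]
  push_cast
  rw [← mul_pow]; norm_num

theorem sum_S_sq_ne (f : BF n) :
    ∑ a ∈ univ.filter (fun a : Pt n => a ≠ 0), S f a ^ 2 = 2 ^ n * wt f - (wt f : ℤ) ^ 2 := by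
  rw [← sum_S_sq, ← S_zero, Finset.filter_ne' univ, ← Finset.add_sum_erase univ _
    (Finset.mem_univ 0)]
  ring

/-! ### Linear changes of variables -/

/-- Linear automorphisms of `𝔽₂ⁿ`. -/
abbrev GLn (n : ℕ) := Pt n ≃ₗ[ZMod 2] Pt n

theorem deg_comp_linear (f : BF n) (E : GLn n) : Deg k (f ∘ E) ↔ Deg k f := by
  refine ⟨fun h => ?_, fun h => h.comp _ _ (map_add E)⟩
  have := h.comp E.symm E.symm (map_add E.symm)
  convert this
  funext x; simp

theorem wt_comp_linear (f : BF n) (E : GLn n) : wt (f ∘ E) = wt f := wt_comp f E.toEquiv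

/-- Composition with a linear automorphism, as a permutation of the set of Boolean functions. -/
def act (E : GLn n) : BF n ≃ BF n where
  toFun f := f ∘ E
  invFun f := f ∘ E.symm
  left_inv f := by funext x; simp
  right_inv f := by funext x; simp

theorem act_apply (E : GLn n) (f : BF n) : act E f = f ∘ E := rfl
@[simp] theorem act_add (E : GLn n) (f g : BF n) : act E (f + g) = act E f + act E g := rfl
@[simp] theorem act_zero (E : GLn n) : act E (0 : BF n) = 0 := rfl
@[simp] theorem deg_act (E : GLn n) (f : BF n) : Deg k (act E f) ↔ Deg k f := deg_comp_linear f E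
@[simp] theorem wt_act (E : GLn n) (f : BF n) : wt (act E f) = wt f := wt_comp_linear f E

/-- The adjoint of a linear automorphism. -/
def adj (E : GLn n) (a : Pt n) : Pt n := fun i => a ⬝ᵥ E (Pi.single i 1)

theorem adj_dot (E : GLn n) (a x : Pt n) : adj E a ⬝ᵥ x = a ⬝ᵥ E x := by
  have h : E x = ∑ i, x i • E (Pi.single i 1) := by
    conv_lhs => rw [← Finset.univ_sum_single x, map_sum]
    refine Finset.sum_congr rfl fun i _ => ?_
    rw [← map_smul]; congr 1
    funext j; simp [Pi.single_apply]
  rw [h, dotProduct_sum]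
  exact Finset.sum_congr rfl fun i _ => by rw [dotProduct_smul, smul_eq_mul, mul_comm]; rfl

theorem dot_ext {a b : Pt n} (h : ∀ x, a ⬝ᵥ x = b ⬝ᵥ x) : a = b := by
  funext i; simpa using h (Pi.single i 1)

/-- The adjoint as a permutation. -/
def adjEquiv (E : GLn n) : Pt n ≃ Pt n where
  toFun := adj E
  invFun := adj E.symm
  left_inv a := dot_ext fun x => by rw [adj_dot, adj_dot]; simp
  right_inv a := dot_ext fun x => by rw [adj_dot, adj_dot]; simp

theorem adj_zero (E : GLn n) : adj E 0 = 0 := by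
  funext i; simp [adj]

theorem adj_eq_zero (E : GLn n) {a : Pt n} : adj E a = 0 ↔ a = 0 := by
  refine ⟨fun h => (adjEquiv E).injective (h.trans (adj_zero E).symm), ?_⟩
  rintro rfl
  exact adj_zero E

/-- A self-inverse linear map as an automorphism. -/
def ofInvol (L : Pt n →ₗ[ZMod 2] Pt n) (h : ∀ x, L (L x) = x) : GLn n :=
  LinearEquiv.ofLinearMap L L (LinearMap.ext h) (LinearMap.ext h)

theorem exists_ne_zero_coord {a : Pt n} (ha : a ≠ 0) : ∃ i, a i = 1 := by
  by_contra h
  exact ha (funext fun i => zmod2_ne_one.1 fun hi => h ⟨i, hi⟩)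

theorem exists_first_coord {a : Pt (n + 1)} (ha : a ≠ 0) :
    ∃ E : GLn (n + 1), ∀ x, a ⬝ᵥ E x = x 0 := by
  obtain ⟨i, hi⟩ := exists_ne_zero_coord ha
  let L : Pt (n + 1) →ₗ[ZMod 2] Pt (n + 1) :=
    { toFun := fun x => x + (a ⬝ᵥ x + x i) • Pi.single i 1
      map_add' := fun x y => by
        simp only [dotProduct_add, Pi.add_apply, add_smul]; abel
      map_smul' := fun c x => by
        simp only [dotProduct_smul, Pi.smul_apply, smul_eq_mul, RingHom.id_apply, smul_add,
          smul_smul, mul_add] }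
  have hL : ∀ x, L x = x + (a ⬝ᵥ x + x i) • Pi.single i 1 := fun _ => rfl
  have hL1 : ∀ x, a ⬝ᵥ L x = x i := by
    intro x
    rw [hL, dotProduct_add, dotProduct_smul, dotProduct_single, hi, smul_eq_mul, mul_one, mul_one,
      ← add_assoc, CharTwo.add_self_eq_zero, zero_add]
  have hL2 : ∀ x, L x i = a ⬝ᵥ x := by
    intro x
    rw [hL, Pi.add_apply, Pi.smul_apply, Pi.single_eq_same, smul_eq_mul, mul_one, add_comm,
      add_assoc, CharTwo.add_self_eq_zero, add_zero]
  refine ⟨(LinearEquiv.funCongrLeft (ZMod 2) (ZMod 2) (Equiv.swap 0 i)).trans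
    (ofInvol L fun x => ?_), fun x => ?_⟩
  · rw [hL (L x), hL1, hL2, hL x, add_assoc, ← add_smul, add_comm (x i), CharTwo.add_self_eq_zero,
      zero_smul, add_zero]
  · change a ⬝ᵥ L _ = _
    rw [hL1]
    simp [LinearEquiv.funCongrLeft]

theorem exists_first_vector {e : Pt (n + 1)} (he : e ≠ 0) :
    ∃ E : GLn (n + 1), E (pcons 1 0) = e := by
  obtain ⟨i, hi⟩ := exists_ne_zero_coord he
  let L : Pt (n + 1) →ₗ[ZMod 2] Pt (n + 1) :=
    { toFun := fun x => x + x i • (e + Pi.single i 1)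
      map_add' := fun x y => by
        simp only [Pi.add_apply, add_smul]; abel
      map_smul' := fun c x => by
        simp only [Pi.smul_apply, smul_eq_mul, RingHom.id_apply, smul_add, smul_smul] }
  have hL : ∀ x, L x = x + x i • (e + Pi.single i 1) := fun _ => rfl
  have hL2 : ∀ x, L x i = x i := by
    intro x
    rw [hL]; simp [hi, CharTwo.add_self_eq_zero]
  refine ⟨(LinearEquiv.funCongrLeft (ZMod 2) (ZMod 2) (Equiv.swap 0 i)).trans
    (ofInvol L fun x => ?_), ?_⟩
  · rw [hL (L x), hL2, hL x, add_assoc, ← add_smul, CharTwo.add_self_eq_zero, zero_smul, add_zero]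
  · have : (LinearEquiv.funCongrLeft (ZMod 2) (ZMod 2) (Equiv.swap 0 i))
      (pcons (1 : ZMod 2) (0 : Pt n))
        = Pi.single i 1 := by
      funext j
      have h0 : (pcons (1 : ZMod 2) (0 : Pt n)) = Pi.single 0 1 := by
        funext j; refine Fin.cases ?_ (fun j => ?_) j <;> simp
      rw [h0]
      simp [LinearEquiv.funCongrLeft, Pi.single_apply, Equiv.swap_apply_eq_iff]
    rw [LinearEquiv.trans_apply, this]
    change L _ = _
    rw [hL, Pi.single_eq_same, one_smul, add_comm e, ← add_assoc, pi_add_self, zero_add]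

open scoped Classical in
/-- The set of nonzero vectors. -/
noncomputable def nz (n : ℕ) : Finset (Pt n) := univ.filter (fun a => a ≠ 0)

theorem mem_nz {a : Pt n} : a ∈ nz n ↔ a ≠ 0 := by simp [nz]

theorem card_nz (n : ℕ) : (nz n).card + 1 = 2 ^ n := by
  classical
  have : nz n = univ.erase 0 := by ext a; simp [nz]
  rw [this, Finset.card_erase_add_one (Finset.mem_univ _), Finset.card_univ, card_Pt]

/-- The functional `a` is constant on the support of `f`. -/
def Cst (f : BF n) (a : Pt n) : Prop := ∃ c, ∀ x, f x = 1 → a ⬝ᵥ x = c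

theorem Cst.zero (f : BF n) : Cst f 0 := ⟨0, fun x _ => zero_dotProduct x⟩

theorem S_eq (f : BF n) (a : Pt n) : S f a = wt f - 2 * wt (f * lin a) := by
  rw [S, hat, ← sum_ind, ← sum_ind, Finset.mul_sum, ← Finset.sum_sub_distrib]
  refine Finset.sum_congr rfl fun x _ => ?_
  simp only [Pi.mul_apply, lin]
  generalize f x = b
  generalize a ⬝ᵥ x = c
  revert b c; decide

theorem wt_mul_add_wt_mul (f g : BF n) : wt (f * g) + wt (f * (g + 1)) = wt f := by
  have := wt_add (f * g) (f * (g + 1))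
  have h0 : f * g * (f * (g + 1)) = 0 := by
    funext x
    simp only [Pi.mul_apply, Pi.add_apply, Pi.one_apply, Pi.zero_apply]
    generalize f x = b
    generalize g x = c
    revert b c; decide
  have h1 : f * g + f * (g + 1) = f := by
    rw [mul_add, mul_one, pi_add_add_cancel]
  rw [h0, h1, wt_zero] at this
  omega

theorem cst_iff_mul {a : Pt n} : Cst f a ↔ f * lin a = 0 ∨ f * (lin a + 1) = 0 := by
  constructor
  · rintro ⟨c, hc⟩
    rcases zmod2_cases c with rfl | rfl
    · left; funext x
      rcases zmod2_cases (f x) with h | h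
      · simp [h]
      · simp [lin, hc x h]
    · right; funext x
      rcases zmod2_cases (f x) with h | h
      · simp [h]
      · simp [lin, hc x h, CharTwo.add_self_eq_zero]
  · rintro (h | h)
    · refine ⟨0, fun x hx => ?_⟩
      have := congrFun h x
      simpa [hx, lin] using this
    · refine ⟨1, fun x hx => ?_⟩
      have := congrFun h x
      simp only [Pi.mul_apply, hx, one_mul, Pi.add_apply, Pi.one_apply, Pi.zero_apply, lin] at this
      exact CharTwo.add_eq_zero.mp this

theorem cst_iff_sq {a : Pt n} : Cst f a ↔ S f a ^ 2 = (wt f : ℤ) ^ 2 := by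
  rw [cst_iff_mul, ← wt_eq_zero, ← wt_eq_zero, sq_eq_sq_iff_eq_or_eq_neg, S_eq]
  have := wt_mul_add_wt_mul f (lin a)
  omega

open scoped Classical in
/-- The number of nonzero functionals that are constant on the support of `f`. -/
noncomputable def zc (f : BF n) : ℕ := ((nz n).filter (Cst f)).card

open scoped Classical in
/-- The number of nonzero functionals that are constant on the supports of `f` and of `g`. -/
noncomputable def zc₂ (f g : BF n) : ℕ := ((nz n).filter (fun a => Cst f a ∧ Cst g a)).card

theorem zc₂_self (f : BF n) : zc₂ f f = zc f := by
  unfold zc₂ zc; congr 1; ext; simp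

theorem zc_eq_zero : zc f = 0 ↔ ∀ a, a ≠ 0 → ¬ Cst f a := by
  simp [zc, mem_nz, Finset.filter_eq_empty_iff]

theorem zc₂_eq_zero : zc₂ f g = 0 ↔ ∀ a, a ≠ 0 → ¬ (Cst f a ∧ Cst g a) := by
  simp [zc₂, mem_nz, Finset.filter_eq_empty_iff]

theorem zc_pos : 0 < zc f ↔ ∃ a, a ≠ 0 ∧ Cst f a := by
  rw [Nat.pos_iff_ne_zero, Ne, zc_eq_zero]; push Not; rfl

/-! ### Transfer -/

/-- The first coordinate functional. -/
abbrev e0 (n : ℕ) : Pt (n + 1) := pcons 1 0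

theorem e0_dot (x : Pt (n + 1)) : e0 n ⬝ᵥ x = x 0 := by
  rw [← pcons_ptail x, dot_pcons]; simp

theorem S_act (E : GLn n) (f : BF n) (a : Pt n) : S (act E f) (adj E a) = S f a := by
  simp only [S, hat, adj_dot, act_apply, Function.comp]
  exact E.toEquiv.sum_comp (fun x => ind (f x) * chi (a ⬝ᵥ x))

theorem S_e0 (f : BF (n + 1)) : S f (e0 n) = wt (lo f) - wt (hi f) := by
  rw [S, hat_pcons, ← S_zero, ← S_zero]
  simp only [chi_one]
  rw [neg_one_mul, ← sub_eq_add_neg]; rfl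

theorem cst_act (E : GLn n) (f : BF n) (a : Pt n) : Cst (act E f) (adj E a) ↔ Cst f a := by
  rw [cst_iff_sq, cst_iff_sq, S_act, wt_act]

theorem cst_e0 (f : BF (n + 1)) : Cst f (e0 n) ↔ lo f = 0 ∨ hi f = 0 := by
  rw [cst_iff_sq, S_e0, ← wt_eq_zero, ← wt_eq_zero, sq_eq_sq_iff_eq_or_eq_neg, wt_halves f]
  omega

/-- A linear change of variables taking the functional `a` to the first coordinate. -/
noncomputable def tr (a : Pt (n + 1)) : GLn (n + 1) :=
  if ha : a ≠ 0 then (exists_first_coord ha).choose else LinearEquiv.refl _ _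

theorem adj_tr {a : Pt (n + 1)} (ha : a ≠ 0) : adj (tr a) a = e0 n := by
  refine dot_ext fun x => ?_
  rw [adj_dot, e0_dot, tr, dif_pos ha]
  exact (exists_first_coord ha).choose_spec x

theorem cst_tr {a : Pt (n + 1)} (ha : a ≠ 0) (f : BF (n + 1)) :
    Cst f a ↔ lo (act (tr a) f) = 0 ∨ hi (act (tr a) f) = 0 := by
  rw [← cst_act (tr a), adj_tr ha, cst_e0]

theorem S_tr {a : Pt (n + 1)} (ha : a ≠ 0) (f : BF (n + 1)) :
    S f a = wt (lo (act (tr a) f)) - wt (hi (act (tr a) f)) := by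
  rw [← S_act (tr a), adj_tr ha, S_e0]

theorem zc_act (E : GLn n) (f : BF n) : zc (act E f) = zc f := by
  classical
  unfold zc
  symm
  refine Finset.card_equiv (adjEquiv E) fun a => ?_
  simp only [Finset.mem_filter, mem_nz]
  exact and_congr (not_congr (adj_eq_zero E).symm) (cst_act E f a).symm

theorem zc₂_act (E : GLn n) (f g : BF n) : zc₂ (act E f) (act E g) = zc₂ f g := by
  classical
  unfold zc₂
  symm
  refine Finset.card_equiv (adjEquiv E) fun a => ?_
  simp only [Finset.mem_filter, mem_nz]
  exact and_congr (not_congr (adj_eq_zero E).symm)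
    (and_congr (cst_act E f a).symm (cst_act E g a).symm)

theorem cst_glue_zero_left (c : BF n) (t : ZMod 2) (b : Pt n) :
    Cst (glue 0 c) (pcons t b) ↔ Cst c b := by
  constructor
  · rintro ⟨s, hs⟩
    refine ⟨s + t, fun x hx => ?_⟩
    have := hs (pcons 1 x) (by simpa [glue, pcons, ptail] using hx)
    rw [dot_pcons, mul_one] at this
    rw [← this, add_right_comm, CharTwo.add_self_eq_zero, zero_add]
  · rintro ⟨s, hs⟩
    refine ⟨s + t, forall_pcons.2 ⟨fun x hx => ?_, fun x hx => ?_⟩⟩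
    · simp [glue, pcons] at hx
    · rw [dot_pcons, mul_one, hs x (by simpa [glue, pcons, ptail] using hx), add_comm]

theorem cst_glue_zero_right (c : BF n) (t : ZMod 2) (b : Pt n) :
    Cst (glue c 0) (pcons t b) ↔ Cst c b := by
  constructor
  · rintro ⟨s, hs⟩
    refine ⟨s, fun x hx => ?_⟩
    have := hs (pcons 0 x) (by simpa [glue, pcons, ptail] using hx)
    rwa [dot_pcons, mul_zero, zero_add] at this
  · rintro ⟨s, hs⟩
    refine ⟨s, forall_pcons.2 ⟨fun x hx => ?_, fun x hx => ?_⟩⟩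
    · rw [dot_pcons, mul_zero, zero_add, hs x (by simpa [glue, pcons, ptail] using hx)]
    · simp [glue, pcons] at hx

/-- If one half of `u` is `0`, then constancy on the support of `u` is decided on the other half. -/
theorem cst_of_half_zero {f : BF (n + 1)} (h : lo f = 0 ∨ hi f = 0) (t : ZMod 2) (b : Pt n) :
    Cst f (pcons t b) ↔ Cst (lo f + hi f) b := by
  rw [← glue_lo_hi f]
  rcases h with h | h
  · rw [h, cst_glue_zero_left]; simp
  · rw [h, cst_glue_zero_right]; simp

theorem zc₂_of_half_zero {f g : BF (n + 1)} (hf : lo f = 0 ∨ hi f = 0) (hg : lo g = 0 ∨ hi g = 0) :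
    zc₂ f g = 1 + 2 * zc₂ (lo f + hi f) (lo g + hi g) := by
  classical
  have h1 : ∀ {n : ℕ} (f g : BF n), zc₂ f g + 1 =
      ∑ a : Pt n, if Cst f a ∧ Cst g a then 1 else 0 := by
    intro n f g
    rw [← Finset.card_filter, zc₂]
    have : univ.filter (fun a => Cst f a ∧ Cst g a) =
        insert 0 ((nz n).filter (fun a => Cst f a ∧ Cst g a)) := by
      ext a
      simp only [Finset.mem_filter, Finset.mem_univ, true_and, Finset.mem_insert, mem_nz]
      by_cases ha : a = 0
      · simp [ha, Cst.zero]
      · simp [ha]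
    rw [this, Finset.card_insert_of_notMem (by simp [mem_nz])]
  have h2 := h1 f g
  rw [sum_halves] at h2
  simp only [cst_of_half_zero hf, cst_of_half_zero hg, ← h1] at h2
  omega

theorem zc_of_half_zero {f : BF (n + 1)} (hf : lo f = 0 ∨ hi f = 0) :
    zc f = 1 + 2 * zc (lo f + hi f) := by
  rw [← zc₂_self, zc₂_of_half_zero hf hf, zc₂_self]

theorem sum_split {M : Type*} [AddCommMonoid M] (F : BF (n + 1) → M) :
    ∑ f, F f = ∑ p : BF n, ∑ q : BF n, F (glue p q) := by
  rw [← (splitEquiv n).symm.sum_comp, Fintype.sum_prod_type]; rfl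

/-! ### Minimum weight -/

theorem min_wt : ∀ {n k : ℕ} {f : BF n}, Deg k f → f ≠ 0 → 2 ^ (n + 1) ≤ 2 ^ k * wt f
  | n, 0, f, hf, h0 => absurd hf h0
  | 0, k + 1, f, _, h0 => by
    have := wt_pos.2 h0
    have h2 : 1 ≤ 2 ^ k := Nat.one_le_two_pow
    have h3 : 1 * 1 ≤ 2 ^ k * wt f := Nat.mul_le_mul h2 this
    rw [pow_succ 2 k, mul_right_comm, zero_add, pow_one]
    linarith
  | n + 1, k + 1, f, hf, h0 => by
    have hl := deg_succ_iff.1 hf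
    rw [wt_halves]
    by_cases h1 : lo f = 0
    · have h2 : hi f ≠ 0 := fun h2 => h0 (ext_halves.2 ⟨h1, h2⟩)
      have := hl.2
      rw [h1, zero_add] at this
      have := min_wt this h2
      rw [h1, wt_zero, pow_succ 2 (n + 1), pow_succ 2 k]; nlinarith
    · by_cases h2 : hi f = 0
      · have := hl.2
        rw [h2, add_zero] at this
        have := min_wt this h1
        rw [h2, wt_zero, pow_succ 2 (n + 1), pow_succ 2 k]; nlinarith
      · have h3 := min_wt hl.1 h1
        have h4 := min_wt hf.hi h2
        rw [pow_succ 2 (n + 1)]; nlinarith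

theorem sum_nz_S_sq (f : BF n) :
    ∑ a ∈ nz n, S f a ^ 2 = 2 ^ n * wt f - (wt f : ℤ) ^ 2 := by
  classical
  rw [← sum_S_sq_ne, nz]

theorem sum_nz_ite (c : ℤ) (p : Pt n → Prop) [DecidablePred p] :
    ∑ a ∈ nz n, (if p a then c else 0) = ((nz n).filter p).card * c := by
  rw [← Finset.sum_filter, Finset.sum_const, nsmul_eq_mul]

theorem S_eq_zero_of_min (hf : Deg k f) (hw : 2 ^ k * wt f = 2 ^ (n + 1)) (a : Pt n) :
    Cst f a ∨ S f a = 0 := by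
  rcases eq_or_ne a 0 with rfl | ha
  · exact Or.inl (Cst.zero f)
  cases n with
  | zero => exact absurd (Subsingleton.elim a 0) ha
  | succ n =>
  rw [cst_tr ha, S_tr ha]
  set F := act (tr a) f
  have hF : Deg k F := (deg_act _ _).2 hf
  rw [← wt_act (tr a) f, wt_halves] at hw
  by_cases h1 : lo F = 0
  · exact Or.inl (Or.inl h1)
  by_cases h2 : hi F = 0
  · exact Or.inl (Or.inr h2)
  right
  have h3 := min_wt hF.lo h1
  have h4 := min_wt hF.hi h2
  have h5 : 2 ^ k * wt (lo F) = 2 ^ k * wt (hi F) := by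
    have := pow_succ 2 (n + 1)
    change 2 ^ k * (wt (lo F) + wt (hi F)) = _ at hw
    nlinarith
  have := Nat.eq_of_mul_eq_mul_left (by positivity) h5
  omega

theorem zc_of_min (hf : Deg k f) (hw : 2 ^ k * wt f = 2 ^ (n + 1)) : (zc f + 1) * wt f = 2 ^ n := by
  classical
  have h1 := sum_nz_S_sq f
  have h2 : ∀ a ∈ nz n, S f a ^ 2 = if Cst f a then (wt f : ℤ) ^ 2 else 0 := by
    intro a _
    split_ifs with h
    · exact cst_iff_sq.1 h
    · rw [(S_eq_zero_of_min hf hw a).resolve_left h]; norm_num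
  rw [Finset.sum_congr rfl h2, sum_nz_ite] at h1
  have h0 : (wt f : ℤ) ≠ 0 := by
    intro h
    rw [Int.natCast_eq_zero] at h
    rw [h, mul_zero] at hw
    exact absurd hw.symm (by positivity)
  have h3 : ((zc f : ℤ) + 1) * wt f = 2 ^ n := by
    apply mul_right_cancel₀ h0
    rw [zc]; linarith
  exact_mod_cast h3

/-- Two words of minimum weight without common constant functional. -/
theorem wt_mul_of_min {k' : ℕ} (hf : Deg k f) (hw : 2 ^ k * wt f = 2 ^ (n + 1))
    (hg : Deg k' g) (hw' : 2 ^ k' * wt g = 2 ^ (n + 1)) (h : zc₂ f g = 0) :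
    2 ^ n * wt (f * g) = wt f * wt g := by
  have h1 := sum_S_mul f g
  rw [Finset.sum_eq_single 0] at h1
  · rw [S_zero, S_zero] at h1
    exact_mod_cast h1.symm
  · intro a _ ha
    have := zc₂_eq_zero.1 h a ha
    rcases S_eq_zero_of_min hf hw a with h2 | h2
    · rcases S_eq_zero_of_min hg hw' a with h3 | h3
      · exact absurd ⟨h2, h3⟩ this
      · rw [h3, mul_zero]
    · rw [h2, zero_mul]
  · intro h; exact absurd (Finset.mem_univ _) h

theorem hat_hat (F : Pt n → ℤ) (y : Pt n) : hat (hat F) y = 2 ^ n * F y := by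
  have := parseval_inner F (fun x => if x = y then 1 else 0)
  simp only [mul_ite, mul_one, mul_zero, Finset.sum_ite_eq', Finset.mem_univ, if_true] at this
  rw [← this, hat]
  refine Finset.sum_congr rfl fun a _ => ?_
  congr 1
  rw [hat]
  simp only [ite_mul, one_mul, zero_mul, Finset.sum_ite_eq', Finset.mem_univ, if_true]
  rw [dotProduct_comm]

/-- The support of a word of minimum weight is cut out by its constant functionals. -/
theorem min_support (hf : Deg k f) (hw : 2 ^ k * wt f = 2 ^ (n + 1)) {x y : Pt n}
    (h : ∀ a, Cst f a → a ⬝ᵥ x = a ⬝ᵥ y) : f x = f y := by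
  have h1 := hat_hat (fun x => ind (f x)) x
  have h2 := hat_hat (fun x => ind (f x)) y
  have h3 : hat (hat fun x => ind (f x)) x = hat (hat fun x => ind (f x)) y := by
    unfold hat
    refine Finset.sum_congr rfl fun a _ => ?_
    rcases S_eq_zero_of_min hf hw a with h4 | h4
    · rw [dotProduct_comm x, dotProduct_comm y, h a h4]
    · change S f a * _ = S f a * _
      rw [h4, zero_mul, zero_mul]
  rw [h1, h2] at h3
  have h4 := mul_left_cancel₀ (by positivity) h3
  revert h4
  change ind (f x) = ind (f y) → _
  generalize f x = b
  generalize f y = c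
  revert b c; decide

/-- The difference of two points in the support of a word of minimum weight is a period. -/
theorem min_period (hf : Deg k f) (hw : 2 ^ k * wt f = 2 ^ (n + 1)) {x y : Pt n}
    (hx : f x = 1) (hy : f y = 1) : der (x + y) f = 0 := by
  funext w
  have : f (w + (x + y)) = f w := by
    refine min_support hf hw fun a ⟨c, hc⟩ => ?_
    rw [dotProduct_add, dotProduct_add, hc x hx, hc y hy, CharTwo.add_self_eq_zero, add_zero]
  simp [der, this, CharTwo.add_self_eq_zero]

/-! ### Divisibility of weights -/

theorem two_dvd_wt : ∀ {n : ℕ} {f : BF n}, Deg n f → 2 ∣ wt f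
  | 0, f, hf => by
    rw [Deg] at hf
    rw [hf, wt_zero]; exact dvd_zero _
  | n + 1, f, hf => by
    have h1 := two_dvd_wt hf.lo_add_hi
    have h2 := dvd_wt_lo_add f
    omega

theorem four_dvd_wt : ∀ {n k : ℕ} {f : BF n}, Deg k f → 2 * k ≤ n + 1 → 2 ≤ n → 4 ∣ wt f
  | n, 0, f, hf, _, _ => by
    rw [Deg] at hf
    rw [hf, wt_zero]; exact dvd_zero _
  | 0, k + 1, f, hf, h, _ => by omega
  | n + 1, 1, f, hf, h, _ => by
    have h0 : lo f + hi f = 0 := hf.lo_add_hi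
    have h2 := dvd_wt_lo_add f
    have h3 := two_dvd_wt (hf.lo.mono (show 1 ≤ n by omega))
    rw [h0, mul_zero, wt_zero] at h2
    omega
  | n + 1, k + 2, f, hf, h, _ => by
    have h1 := four_dvd_wt hf.lo_add_hi (by omega) (by omega)
    have h2 := dvd_wt_lo_add f
    have h3 := two_dvd_wt (hf.lo.mono (show k + 2 ≤ n by omega))
    have h4 := two_dvd_wt ((hf.lo.mul hf.lo_add_hi).mono (show k + 1 + k + 1 ≤ n by omega))
    omega

theorem exists_halves {f : BF (n + 1)} (hf : Deg (k + 1) f) {a : Pt (n + 1)} (ha : a ≠ 0) :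
    ∃ p q : BF n, Deg (k + 1) p ∧ Deg (k + 1) q ∧ Deg k (p + q) ∧ wt p + wt q = wt f ∧
      S f a = wt p - wt q ∧ (Cst f a ↔ p = 0 ∨ q = 0) := by
  have hF := (deg_act (tr a) f).2 hf
  refine ⟨_, _, hF.lo, hF.hi, hF.lo_add_hi, ?_, S_tr ha f, cst_tr ha f⟩
  rw [← wt_halves, wt_act]

/-- If every `S f a ^ 2` with `a ≠ 0` is `c` or `(wt f) ^ 2`, then `zc f` is determined. -/
theorem zc_eq_of_sq (f : BF n) (c : ℤ) (h : ∀ a, a ≠ 0 → ¬ Cst f a → S f a ^ 2 = c) :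
    ((wt f : ℤ) ^ 2 - c) * zc f + c * (2 ^ n - 1) = 2 ^ n * wt f - (wt f : ℤ) ^ 2 := by
  classical
  rw [← sum_nz_S_sq]
  have h2 : ∀ a ∈ nz n, S f a ^ 2 = (if Cst f a then ((wt f : ℤ) ^ 2 - c) else 0) + c := by
    intro a ha
    split_ifs with hc
    · rw [cst_iff_sq.1 hc]; ring
    · rw [h a (mem_nz.1 ha) hc, zero_add]
  have h3 := card_nz n
  have h4 : ((nz n).card : ℤ) = 2 ^ n - 1 := by
    rw [eq_sub_iff_add_eq]; exact_mod_cast h3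
  rw [Finset.sum_congr rfl h2, Finset.sum_add_distrib, sum_nz_ite, Finset.sum_const, nsmul_eq_mul,
    h4, zc]
  ring

theorem min_wt_eight {f : BF (k + 2)} (hf : Deg k f) : wt f = 0 ∨ 8 ≤ wt f := by
  by_cases h : f = 0
  · left; rw [h, wt_zero]
  · right
    have h1 := min_wt hf h
    have : 2 ^ (k + 2 + 1) = 2 ^ k * 8 := by ring
    rw [this] at h1
    exact Nat.le_of_mul_le_mul_left h1 (by positivity)

theorem min_wt_four {f : BF (k + 1)} (hf : Deg k f) : wt f = 0 ∨ 4 ≤ wt f := by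
  by_cases h : f = 0
  · left; rw [h, wt_zero]
  · right
    have h1 := min_wt hf h
    have : 2 ^ (k + 1 + 1) = 2 ^ k * 4 := by ring
    rw [this] at h1
    exact Nat.le_of_mul_le_mul_left h1 (by positivity)

theorem wt_ne_ten : ∀ {k : ℕ} {f : BF (k + 2)}, Deg k f → wt f ≠ 10
  | 0, f, hf, h => by have := four_dvd_wt hf (by omega) (by omega); omega
  | 1, f, hf, h => by have := four_dvd_wt hf (by omega) (by omega); omega
  | 2, f, hf, h => by have := four_dvd_wt hf (by omega) (by omega); omega
  | 3, f, hf, h => by have := four_dvd_wt hf (by omega) (by omega); omega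
  | k + 4, f, hf, h => by
    have h1 := zc_eq_of_sq f 4 fun a ha hc => by
      obtain ⟨p, q, hp, hq, -, hw, hS, hC⟩ := exists_halves hf ha
      rw [hC, not_or, ← wt_eq_zero, ← wt_eq_zero] at hc
      have := min_wt_four hp
      have := min_wt_four hq
      have := two_dvd_wt (hp.mono (show k + 4 ≤ k + 5 by omega))
      have := two_dvd_wt (hq.mono (show k + 4 ≤ k + 5 by omega))
      have : S f a = 2 ∨ S f a = -2 := by omega
      rcases this with h | h <;> rw [h] <;> norm_num
    rw [h] at h1
    have h2 : 0 < zc f := by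
      by_contra h2
      have h3 : (2 : ℤ) ^ (k + 4 + 2) = 64 * 2 ^ k := by ring
      have h4 : (1 : ℤ) ≤ 2 ^ k := one_le_pow₀ (by norm_num)
      rw [show zc f = 0 by omega, h3] at h1
      push_cast at h1
      linarith
    obtain ⟨a, ha, hc⟩ := zc_pos.1 h2
    obtain ⟨p, q, hp, hq, hpq, hw, hS, hC⟩ := exists_halves hf ha
    rcases hC.1 hc with rfl | rfl
    · rw [zero_add] at hpq
      exact wt_ne_ten hpq (by rw [wt_zero] at hw; omega)
    · rw [add_zero] at hpq
      exact wt_ne_ten hpq (by rw [wt_zero] at hw; omega)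

/-- Weights below `16` in `RM(r, r + 3)`. -/
theorem wt_eight_cases {f : BF (k + 2)} (hf : Deg k f) :
    wt f = 0 ∨ wt f = 8 ∨ wt f = 12 ∨ wt f = 14 ∨ 16 ≤ wt f := by
  have h1 := min_wt_eight hf
  have h2 := wt_ne_ten hf
  have h3 := two_dvd_wt (hf.mono (show k ≤ k + 2 by omega))
  omega

theorem min_wt_sixteen {f : BF (k + 3)} (hf : Deg k f) : wt f = 0 ∨ 16 ≤ wt f := by
  by_cases h : f = 0
  · left; rw [h, wt_zero]
  · right
    have h1 := min_wt hf h
    have : 2 ^ (k + 3 + 1) = 2 ^ k * 16 := by ring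
    rw [this] at h1
    exact Nat.le_of_mul_le_mul_left h1 (by positivity)

theorem three_not_dvd_two_pow (n : ℕ) : ¬ (3 : ℤ) ∣ 2 ^ n := by
  intro h
  have := Int.Prime.dvd_pow' Nat.prime_three (show ((3 : ℕ) : ℤ) ∣ (2 : ℤ) ^ n from h)
  omega

/-- Weights below `32` in `RM(r, r + 4)`. -/
theorem wt_sixteen_cases {f : BF (k + 3)} (hf : Deg k f) :
    wt f = 0 ∨ wt f = 16 ∨ wt f = 24 ∨ wt f = 28 ∨ wt f = 30 ∨ 32 ≤ wt f := by
  have h1 := min_wt_sixteen hf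
  have h3 := two_dvd_wt (hf.mono (show k ≤ k + 3 by omega))
  cases k with
  | zero => left; rw [show f = 0 from hf, wt_zero]
  | succ k =>
  have hN := three_not_dvd_two_pow (k + 1 + 3)
  have hN0 : (1 : ℤ) ≤ 2 ^ (k + 1 + 3) := one_le_pow₀ (by norm_num)
  have key : ∀ a, a ≠ 0 → ¬ Cst f a → ∃ s t : ℕ, s + t = wt f ∧ S f a = s - t ∧
      (s = 8 ∨ s = 12 ∨ s = 14 ∨ 16 ≤ s) ∧ (t = 8 ∨ t = 12 ∨ t = 14 ∨ 16 ≤ t) := by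
    intro a ha hc
    obtain ⟨p, q, hp, hq, -, hw, hS, hC⟩ := exists_halves hf ha
    rw [hC, not_or, ← wt_eq_zero, ← wt_eq_zero] at hc
    have := wt_eight_cases hp
    have := wt_eight_cases hq
    exact ⟨wt p, wt q, hw, hS, by omega, by omega⟩
  have h18 : wt f ≠ 18 := by
    intro h
    have := zc_eq_of_sq f 324 fun a ha hc => by
      obtain ⟨s, t, h4, h5, h6, h7⟩ := key a ha hc
      omega
    rw [h] at this
    norm_num at this
    linarith
  have h20 : wt f ≠ 20 := by
    intro h
    have := zc_eq_of_sq f 16 fun a ha hc => by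
      obtain ⟨s, t, h4, h5, h6, h7⟩ := key a ha hc
      have : S f a = 4 ∨ S f a = -4 := by omega
      rcases this with h | h <;> rw [h] <;> norm_num
    rw [h] at this
    norm_num at this
    generalize (2 : ℤ) ^ (k + 1 + 3) = N at *
    omega
  have h22 : wt f ≠ 22 := by
    intro h
    have := zc_eq_of_sq f 36 fun a ha hc => by
      obtain ⟨s, t, h4, h5, h6, h7⟩ := key a ha hc
      have : S f a = 6 ∨ S f a = -6 := by omega
      rcases this with h | h <;> rw [h] <;> norm_num
    rw [h] at this
    norm_num at this
    generalize (2 : ℤ) ^ (k + 1 + 3) = N at *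
    omega
  have h26 : wt f ≠ 26 := by
    intro h
    have h4 := sum_nz_S_sq f
    have h5 : (3 : ℤ) ∣ ∑ a ∈ nz (k + 1 + 3), (S f a ^ 2 - 1) := by
      refine Finset.dvd_sum fun a ha => ?_
      by_cases hc : Cst f a
      · rw [cst_iff_sq.1 hc, h]; norm_num
      · obtain ⟨s, t, h4, h5, h6, h7⟩ := key a (mem_nz.1 ha) hc
        have : S f a = 2 ∨ S f a = -2 ∨ S f a = 10 ∨ S f a = -10 := by omega
        rcases this with h | h | h | h <;> rw [h] <;> norm_num
    have h6 := card_nz (k + 1 + 3)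
    have h7 : ((nz (k + 1 + 3)).card : ℤ) = 2 ^ (k + 1 + 3) - 1 := by
      rw [eq_sub_iff_add_eq]; exact_mod_cast h6
    rw [Finset.sum_sub_distrib, h4, h, Finset.sum_const, nsmul_eq_mul, h7] at h5
    generalize (2 : ℤ) ^ (k + 1 + 3) = N at *
    push_cast at h5
    omega
  omega

/-! ### Affine functions -/

/-- The constant function. -/
abbrev cst (c : ZMod 2) : BF n := fun _ => c

theorem deg_two_iff : Deg 2 g ↔ ∃ l c, g = lin l + cst c := by
  constructor
  · intro hg
    induction n with
    | zero =>
      refine ⟨0, g default, funext fun x => ?_⟩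
      rw [Subsingleton.elim x default]
      simp [lin]
    | succ n ih =>
      obtain ⟨l, c, h⟩ := ih hg.lo
      obtain ⟨d, hd⟩ := deg_one_iff.1 hg.lo_add_hi
      have h2 : hi g = lin l + cst c + cst d := by
        rw [← h, ← show lo g + hi g = cst d from hd, pi_add_add_cancel]
      refine ⟨pcons d l, c, ?_⟩
      rw [ext_halves, h, h2]
      constructor
      · funext x
        change _ = pcons d l ⬝ᵥ pcons 0 x + c
        rw [dot_pcons, mul_zero, zero_add]; rfl
      · funext x
        change _ = pcons d l ⬝ᵥ pcons 1 x + c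
        rw [dot_pcons, mul_one]
        change l ⬝ᵥ x + c + d = d + l ⬝ᵥ x + c
        ring
  · rintro ⟨l, c, rfl⟩
    exact (deg_lin l).add (deg_const c)

theorem lin_add (a b : Pt n) : lin (a + b) = lin a + lin b := by
  funext x; simp [lin]

theorem lin_zero : lin (0 : Pt n) = 0 := by
  funext x; simp [lin]

theorem cst_add (c d : ZMod 2) : (cst c + cst d : BF n) = cst (c + d) := rfl

theorem lin_add_cst_inj {a b : Pt n} {c d : ZMod 2} :
    lin a + cst c = lin b + cst d ↔ a = b ∧ c = d := by
  refine ⟨fun h => ?_, fun ⟨h1, h2⟩ => by rw [h1, h2]⟩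
  have h0 : c = d := by simpa [lin] using congrFun h 0
  subst h0
  exact ⟨dot_ext fun x => congrFun (add_right_cancel h) x, rfl⟩

theorem lin_add_cst_deg_one {a : Pt n} {c : ZMod 2} : Deg 1 (lin a + cst c) ↔ a = 0 := by
  rw [deg_one_iff]
  constructor
  · rintro ⟨d, hd⟩
    have : lin a + cst c = lin 0 + cst d := by rw [hd, lin_zero, zero_add]
    exact (lin_add_cst_inj.1 this).1
  · rintro rfl
    exact ⟨c, by rw [lin_zero, zero_add]⟩

open scoped Classical in
theorem sum_deg_two {M : Type*} [AddCommMonoid M] (f : BF n) (F : BF n → M) :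
    ∑ w, (if Deg 2 (f + w) then F w else 0) = ∑ l, ∑ c, F (f + (lin l + cst c)) := by
  rw [← Finset.sum_filter, ← Fintype.sum_prod_type']
  symm
  refine Finset.sum_bij (fun p _ => f + (lin p.1 + cst p.2)) ?_ ?_ ?_ ?_
  · intro p _
    rw [Finset.mem_filter, pi_add_add_cancel]
    exact ⟨Finset.mem_univ _, deg_two_iff.2 ⟨_, _, rfl⟩⟩
  · intro p _ q _ h
    exact Prod.ext_iff.2 (lin_add_cst_inj.1 (add_left_cancel h))
  · intro w hw
    obtain ⟨l, c, h⟩ := deg_two_iff.1 (Finset.mem_filter.1 hw).2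
    exact ⟨(l, c), Finset.mem_univ _, by rw [← h, pi_add_add_cancel]⟩
  · intro p _
    rfl

theorem sum_zmod2 {M : Type*} [AddCommMonoid M] (F : ZMod 2 → M) : ∑ c, F c = F 0 + F 1 := by
  rw [show (univ : Finset (ZMod 2)) = {0, 1} from rfl, Finset.sum_pair (by decide)]

theorem sum_chi_lin {l : Pt n} (hl : l ≠ 0) : ∑ x, chi (l ⬝ᵥ x) = 0 := by
  obtain ⟨i, hi⟩ := exists_ne_zero_coord hl
  have h : ∑ x, chi (l ⬝ᵥ x) = ∑ x, - chi (l ⬝ᵥ x) := by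
    rw [← Equiv.sum_comp (Equiv.addRight (Pi.single i (1 : ZMod 2)))]
    refine Finset.sum_congr rfl fun x _ => ?_
    simp [dotProduct_add, hi, chi_add]
  rw [Finset.sum_neg_distrib] at h
  omega

theorem wt_lin {l : Pt n} (hl : l ≠ 0) (c : ZMod 2) : 2 * wt (lin l + cst c) = 2 ^ n := by
  have h := W_zero (lin l + cst c)
  have h2 : W (lin l + cst c) 0 = 0 := by
    simp only [W, hat, zero_dotProduct, chi_zero, mul_one, Pi.add_apply, chi_add]
    change ∑ x, chi (l ⬝ᵥ x) * chi c = 0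
    rw [← Finset.sum_mul, sum_chi_lin hl, zero_mul]
  rw [h2] at h
  have : (2 * wt (lin l + cst c) : ℤ) = 2 ^ n := by linarith
  exact_mod_cast this

/-! ### Quadratic functions -/

/-- The group of periods of `f`. -/
def Per (f : BF n) : AddSubgroup (Pt n) where
  carrier := {e | der e f = 0}
  zero_mem' := by
    funext x; simp [der, CharTwo.add_self_eq_zero]
  add_mem' {a b} ha hb := by
    have ha' : ∀ x, f (x + a) = f x := fun x => CharTwo.add_eq_zero.mp (congrFun ha x)
    have hb' : ∀ x, f (x + b) = f x := fun x => CharTwo.add_eq_zero.mp (congrFun hb x)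
    funext x
    simp only [der, ← add_assoc, ha', hb', CharTwo.add_self_eq_zero, Pi.zero_apply]
  neg_mem' {a} ha := by
    rwa [show -a = a from funext fun i => ZModModule.neg_eq_self (a i)]

theorem mem_Per {e : Pt n} : e ∈ Per f ↔ der e f = 0 := Iff.rfl

open scoped Classical in
/-- The functionals vanishing on the periods of `f`. -/
noncomputable def Lam (f : BF n) : Finset (Pt n) := univ.filter (fun l => ∀ e ∈ Per f, l ⬝ᵥ e = 0)

theorem mem_Lam {l : Pt n} : l ∈ Lam f ↔ ∀ e ∈ Per f, l ⬝ᵥ e = 0 := by simp [Lam]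

theorem zero_mem_Lam : (0 : Pt n) ∈ Lam f := mem_Lam.2 fun e _ => zero_dotProduct e

theorem Lam_add_iff {l l' : Pt n} (h : l ∈ Lam f) : l + l' ∈ Lam f ↔ l' ∈ Lam f := by
  rw [mem_Lam] at *
  rw [mem_Lam]
  refine forall₂_congr fun e he => ?_
  rw [add_dotProduct, h e he, zero_add]

theorem sum_chi_subgroup (P : AddSubgroup (Pt n)) [DecidablePred (· ∈ P)] {l : Pt n} {e' : Pt n}
    (he : e' ∈ P) (hl : l ⬝ᵥ e' = 1) : ∑ e, (if e ∈ P then chi (l ⬝ᵥ e) else 0) = 0 := by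
  have h : ∑ e, (if e ∈ P then chi (l ⬝ᵥ e) else 0) =
      ∑ e, - (if e ∈ P then chi (l ⬝ᵥ e) else 0) := by
    rw [← Equiv.sum_comp (Equiv.addRight e')]
    refine Finset.sum_congr rfl fun x _ => ?_
    simp only [Equiv.coe_addRight, dotProduct_add, hl, chi_add, P.add_mem_cancel_right he, chi_one]
    split_ifs <;> simp
  rw [Finset.sum_neg_distrib] at h
  omega

theorem sum_chi_der (hf : Deg 3 f) (h0 : W f 0 ≠ 0) (e : Pt n) [Decidable (e ∈ Per f)] :
    ∑ x, chi (der e f x) = if e ∈ Per f then 2 ^ n else 0 := by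
  obtain ⟨l, c, h⟩ := deg_two_iff.1 (hf e)
  by_cases hl : l = 0
  · subst hl
    rw [lin_zero, zero_add] at h
    rcases zmod2_cases c with rfl | rfl
    · have : e ∈ Per f := h
      rw [if_pos this, h]
      simp [ZMod.card]
    · exfalso
      apply h0
      have h1 : ∀ x, f (x + e) = f x + 1 := fun x => by
        have := congrFun h x
        change f (x + e) + f x = 1 at this
        rw [← this, add_left_comm, CharTwo.add_self_eq_zero, add_zero]
      have h2 : W f 0 = - W f 0 := by
        simp only [W, hat, zero_dotProduct, chi_zero, mul_one]
        rw [← Finset.sum_neg_distrib, ← Equiv.sum_comp (Equiv.addRight e)]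
        refine Finset.sum_congr rfl fun x _ => ?_
        simp [h1, chi_add]
      omega
  · rw [if_neg]
    · rw [h]
      simp only [Pi.add_apply, chi_add]
      change ∑ x, chi (l ⬝ᵥ x) * chi c = 0
      rw [← Finset.sum_mul, sum_chi_lin hl, zero_mul]
    · intro he
      rw [mem_Per, h] at he
      have : lin l + cst c = lin 0 + cst 0 := by rw [he, lin_zero, zero_add]; rfl
      exact hl (lin_add_cst_inj.1 this).1

theorem W_sq (f : BF n) (l : Pt n) : W f l ^ 2 = ∑ e, chi (l ⬝ᵥ e) * ∑ x, chi (der e f x) := by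
  rw [pow_two, W, hat, Finset.sum_mul_sum, Finset.sum_comm]
  simp only [Finset.mul_sum]
  rw [Finset.sum_comm (s := univ) (t := univ) (f := fun e x => chi (l ⬝ᵥ e) * chi (der e f x)),
    Finset.sum_comm]
  refine Finset.sum_congr rfl fun x _ => ?_
  rw [← Equiv.sum_comp (Equiv.addLeft x)]
  refine Finset.sum_congr rfl fun e _ => ?_
  simp only [Equiv.coe_addLeft, dotProduct_add, chi_add, der]
  have := chi_sq (l ⬝ᵥ x)
  linear_combination (chi (f x) * chi (f (x + e)) * chi (l ⬝ᵥ e)) * this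

theorem W_sq_eq (hf : Deg 3 f) (h0 : W f 0 ≠ 0) (l : Pt n) [Decidable (l ∈ Lam f)] :
    W f l ^ 2 = if l ∈ Lam f then 2 ^ n * (Nat.card (Per f) : ℤ) else 0 := by
  classical
  have h1 : W f l ^ 2 = 2 ^ n * ∑ e, (if e ∈ Per f then chi (l ⬝ᵥ e) else 0) := by
    rw [W_sq, Finset.mul_sum]
    refine Finset.sum_congr rfl fun e _ => ?_
    rw [sum_chi_der hf h0]
    split_ifs <;> ring
  rw [h1]
  split_ifs with hl
  · congr 1
    rw [mem_Lam] at hl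
    have : ∀ e, (if e ∈ Per f then chi (l ⬝ᵥ e) else 0) = if e ∈ Per f then 1 else 0 := by
      intro e
      split_ifs with h
      · rw [hl e h, chi_zero]
      · rfl
    simp only [this, Finset.sum_boole, Nat.card_eq_fintype_card]
    rw [Fintype.card_subtype]
  · rw [mem_Lam] at hl
    push Not at hl
    obtain ⟨e, he, h⟩ := hl
    rw [sum_chi_subgroup _ he (zmod2_ne_zero.1 h), mul_zero]

theorem W_zero_sq (hf : Deg 3 f) (h0 : W f 0 ≠ 0) : W f 0 ^ 2 = 2 ^ n * (Nat.card (Per f) : ℤ) := by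
  classical
  rw [W_sq_eq hf h0, if_pos zero_mem_Lam]

theorem W_sq_eq' (hf : Deg 3 f) (h0 : W f 0 ≠ 0) (l : Pt n) [Decidable (l ∈ Lam f)] :
    W f l ^ 2 = if l ∈ Lam f then W f 0 ^ 2 else 0 := by
  rw [W_sq_eq hf h0, W_zero_sq hf h0]

theorem card_Lam (hf : Deg 3 f) (h0 : W f 0 ≠ 0) : ((Lam f).card : ℤ) * W f 0 ^ 2 = 4 ^ n := by
  classical
  rw [← sum_W_sq f]
  rw [Finset.sum_congr rfl fun l _ => W_sq_eq' hf h0 l, ← Finset.sum_filter, Finset.filter_univ_mem,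
    Finset.sum_const, nsmul_eq_mul]

/-- The Walsh coefficient of a quadratic function is a power of `2` up to sign. -/
theorem W_zero_sq_eq_pow (hf : Deg 3 f) (h0 : W f 0 ≠ 0) : ∃ i ≤ n, W f 0 ^ 2 = 2 ^ (n + i) := by
  have h1 : Nat.card (Per f) ∣ 2 ^ n := by
    have := (Per f).card_addSubgroup_dvd_card
    rwa [Nat.card_eq_fintype_card (α := Pt n), card_Pt] at this
  obtain ⟨i, hi, h⟩ := (Nat.dvd_prime_pow Nat.prime_two).1 h1
  exact ⟨i, hi, by rw [W_zero_sq hf h0, h, pow_add]; norm_num⟩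

/-! ### Weights in cosets -/

open scoped Classical in
/-- The functions of weight `t` in the coset of `f` modulo the functions of degree less than `k`. -/
noncomputable def Co (k : ℕ) (f : BF n) (t : ℕ) : Finset (BF n) :=
  univ.filter (fun w => Deg k (f + w) ∧ wt w = t)

/-- The functions of degree less than `k` and weight `t`. -/
noncomputable abbrev Wd (k n t : ℕ) : Finset (BF n) := Co k 0 t

theorem mem_Co {t : ℕ} {w : BF n} : w ∈ Co k f t ↔ Deg k (f + w) ∧ wt w = t := by simp [Co]

attribute [irreducible] Co

theorem mem_Wd {t : ℕ} : f ∈ Wd k n t ↔ Deg k f ∧ wt f = t := by rw [mem_Co, zero_add]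

theorem Co_congr (h : Deg k (f + g)) (t : ℕ) : Co k f t = Co k g t := by
  ext w
  rw [mem_Co, mem_Co, show f + w = (f + g) + (g + w) by rw [← add_assoc, add_assoc f, pi_add_self,
    add_zero], h.add_iff_right]

theorem Co_eq_Wd (h : Deg k f) (t : ℕ) : Co k f t = Wd k n t :=
  Co_congr (by rwa [add_zero]) t

theorem Wd_zero (k n : ℕ) : Wd k n 0 = {0} := by
  ext w
  rw [mem_Wd, Finset.mem_singleton, wt_eq_zero]
  exact ⟨fun h => h.2, fun hw => ⟨hw ▸ Deg.zero k, hw⟩⟩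

theorem act_mem_Co (E : GLn n) {t : ℕ} {w : BF n} : act E w ∈ Co k (act E f) t ↔ w ∈ Co k f t := by
  rw [mem_Co, mem_Co, ← act_add, deg_act, wt_act]

theorem sum_Co_act {M : Type*} [AddCommMonoid M] (E : GLn n) (f : BF n) (t : ℕ) (F : BF n → M) :
    ∑ w ∈ Co k (act E f) t, F w = ∑ w ∈ Co k f t, F (act E w) := by
  symm
  exact Finset.sum_equiv (act E) (fun w => (act_mem_Co E).symm) fun _ _ => rfl

theorem sum_Wd_act {M : Type*} [AddCommMonoid M] (E : GLn n) (t : ℕ) (F : BF n → M) :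
    ∑ w ∈ Wd k n t, F (act E w) = ∑ w ∈ Wd k n t, F w := by
  rw [← sum_Co_act, act_zero]

theorem card_Co_act (E : GLn n) (f : BF n) (t : ℕ) : (Co k (act E f) t).card = (Co k f t).card := by
  rw [Finset.card_eq_sum_ones, Finset.card_eq_sum_ones, sum_Co_act]

/-- Splitting a sum over a coset according to the two halves. -/
theorem sum_Co_split {M : Type*} [AddCommMonoid M] (f : BF (n + 1)) (t : ℕ) (F : BF (n + 1) → M) :
    ∑ w ∈ Co (k + 1) f t, F w = ∑ s ∈ range (t + 1), ∑ p ∈ Co (k + 1) (lo f) s,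
      ∑ q ∈ Co k (lo f + hi f + p) (t - s), F (glue p q) := by
  classical
  have key : ∀ p q : BF n, (Deg (k + 1) (f + glue p q) ∧ wt (glue p q) = t) ↔
      (Deg (k + 1) (lo f + p) ∧ wt p ≤ t ∧ (Deg k (lo f + hi f + p + q) ∧ wt q = t - wt p)) := by
    intro p q
    have h1 : f + glue p q = glue (lo f + p) (hi f + q) := by
      rw [← glue_add, glue_lo_hi]
    rw [h1, deg_glue, wt_glue, show lo f + p + (hi f + q) = lo f + hi f + p + q by abel]
    exact ⟨fun ⟨⟨h1, h2⟩, h3⟩ => ⟨h1, by omega, h2, by omega⟩,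
      fun ⟨h1, h2, h3, h4⟩ => ⟨⟨h1, h3⟩, by omega⟩⟩
  rw [Co, Finset.sum_filter, sum_split]
  simp only [key]
  have h2 : ∀ p : BF n, ∑ s ∈ range (t + 1), (if p ∈ Co (k + 1) (lo f) s then
      ∑ q ∈ Co k (lo f + hi f + p) (t - s), F (glue p q) else 0) =
      ∑ q, if (Deg (k + 1) (lo f + p) ∧ wt p ≤ t ∧ (Deg k (lo f + hi f + p + q) ∧ wt q = t - wt p))
        then F (glue p q) else 0 := by
    intro p
    by_cases hp : Deg (k + 1) (lo f + p) ∧ wt p ≤ t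
    · rw [Finset.sum_eq_single (wt p)]
      · rw [if_pos (mem_Co.2 ⟨hp.1, rfl⟩), Co, Finset.sum_filter]
        simp only [hp.1, hp.2, true_and]
      · intro s _ hs
        rw [if_neg]
        rw [mem_Co]
        exact fun h => hs h.2.symm
      · intro h
        rw [Finset.mem_range] at h
        omega
    · rw [Finset.sum_eq_zero, Finset.sum_eq_zero]
      · intro q _
        rw [if_neg]
        tauto
      · intro s hs
        rw [if_neg]
        rw [mem_Co]
        rintro ⟨h1, h2⟩
        rw [Finset.mem_range] at hs
        exact hp ⟨h1, by omega⟩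
  simp only [← h2]
  rw [Finset.sum_comm]
  refine Finset.sum_congr rfl fun s _ => ?_
  rw [← Finset.sum_filter, Finset.filter_univ_mem]

theorem card_Co_split (f : BF (n + 1)) (t : ℕ) :
    (Co (k + 1) f t).card = ∑ s ∈ range (t + 1), ∑ p ∈ Co (k + 1) (lo f) s,
      (Co k (lo f + hi f + p) (t - s)).card := by
  simp only [Finset.card_eq_sum_ones, sum_Co_split]

open scoped Classical in
/-- Words with a vanishing half. -/
theorem sum_Wd_half_zero {M : Type*} [AddCommMonoid M] {t : ℕ} (ht : t ≠ 0) (F : BF (n + 1) → M) :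
    ∑ w ∈ (Wd (k + 1) (n + 1) t).filter (fun w => lo w = 0 ∨ hi w = 0), F w =
      ∑ c ∈ Wd k n t, (F (glue 0 c) + F (glue c 0)) := by
  rw [Finset.filter_or, Finset.sum_union, Finset.sum_add_distrib]
  · congr 1
    · symm
      refine Finset.sum_bij (fun c _ => glue 0 c) ?_ ?_ ?_ ?_
      · intro c hc
        rw [mem_Wd] at hc
        rw [Finset.mem_filter, mem_Wd, deg_glue, wt_glue, wt_zero, zero_add, zero_add]
        exact ⟨⟨⟨Deg.zero _, hc.1⟩, hc.2⟩, by simp⟩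
      · intro c _ d _ h
        simpa using congrArg hi h
      · intro w hw
        rw [Finset.mem_filter, mem_Wd, ← glue_lo_hi w] at hw
        simp only [lo_glue, deg_glue, wt_glue] at hw
        refine ⟨hi w, ?_, ?_⟩
        · rw [mem_Wd]
          rw [hw.2, zero_add, wt_zero, zero_add] at hw
          exact ⟨hw.1.1.2, hw.1.2⟩
        · rw [← hw.2, glue_lo_hi]
      · intro _ _; rfl
    · symm
      refine Finset.sum_bij (fun c _ => glue c 0) ?_ ?_ ?_ ?_
      · intro c hc
        rw [mem_Wd] at hc
        rw [Finset.mem_filter, mem_Wd, deg_glue, wt_glue, wt_zero, add_zero, add_zero]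
        exact ⟨⟨⟨hc.1.succ, hc.1⟩, hc.2⟩, by simp⟩
      · intro c _ d _ h
        simpa using congrArg lo h
      · intro w hw
        rw [Finset.mem_filter, mem_Wd, ← glue_lo_hi w] at hw
        simp only [hi_glue, deg_glue, wt_glue] at hw
        refine ⟨lo w, ?_, ?_⟩
        · rw [mem_Wd]
          rw [hw.2, add_zero, wt_zero, add_zero] at hw
          exact ⟨hw.1.1.2, hw.1.2⟩
        · rw [← hw.2, glue_lo_hi]
      · intro _ _; rfl
  · rw [Finset.disjoint_left]
    intro w h1 h2
    rw [Finset.mem_filter] at h1 h2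
    rw [mem_Wd, wt_halves, h1.2, h2.2, wt_zero] at h1
    exact ht h1.1.2.symm

open scoped Classical in
/-- Words on whose support a given functional is constant. -/
theorem sum_Wd_cst {M : Type*} [AddCommMonoid M] {t : ℕ} (ht : t ≠ 0) {a : Pt (n + 1)} (ha : a ≠ 0)
    (F G : BF (n + 1) → M) (hFG : ∀ w ∈ Wd (k + 1) (n + 1) t, F w = G (act (tr a) w)) :
    ∑ w ∈ (Wd (k + 1) (n + 1) t).filter (fun w => Cst w a), F w =
      ∑ c ∈ Wd k n t, (G (glue 0 c) + G (glue c 0)) := by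
  rw [← sum_Wd_half_zero ht, Finset.sum_filter, Finset.sum_filter,
    ← sum_Wd_act (tr a) t fun w => if lo w = 0 ∨ hi w = 0 then G w else 0]
  refine Finset.sum_congr rfl fun w hw => ?_
  simp only [cst_tr ha, hFG w hw]

open scoped Classical in
/-- Counting pairs of a word and a functional that is constant on its support. -/
theorem sum_zc_mul {t : ℕ} (ht : t ≠ 0) (F : BF (n + 1) → ℤ)
    (hF : ∀ E w, F (act E w) = F w) :
    ∑ w ∈ Wd (k + 1) (n + 1) t, zc w * F w =
      (2 ^ (n + 1) - 1) * ∑ c ∈ Wd k n t, (F (glue 0 c) + F (glue c 0)) := by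
  have h1 : ∀ w, (zc w : ℤ) * F w = ∑ a ∈ nz (n + 1), if Cst w a then F w else 0 := fun w =>
    (sum_nz_ite _ _).symm
  have h2 : ((nz (n + 1)).card : ℤ) = 2 ^ (n + 1) - 1 := by
    have := card_nz (n + 1); zify at this; linarith
  simp only [h1]
  rw [Finset.sum_comm, ← h2, ← nsmul_eq_mul, ← Finset.sum_const]
  refine Finset.sum_congr rfl fun a ha => ?_
  rw [← Finset.sum_filter]
  exact sum_Wd_cst ht (mem_nz.1 ha) F F fun w _ => (hF _ w).symm

/-- The second moment identity for the words of weight `w`. -/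
theorem sum_Wd_moment (k n w : ℕ) :
    ((2 : ℤ) ^ (n + 1) * w - w ^ 2) * (Wd (k + 1) (n + 1) w).card = (2 ^ (n + 1) - 1) *
      ∑ s ∈ range (w + 1), (2 * s - w : ℤ) ^ 2 * ∑ u ∈ Wd (k + 1) n s, (Co k u (w - s)).card := by
  have h2 : ((nz (n + 1)).card : ℤ) = 2 ^ (n + 1) - 1 := by
    have := card_nz (n + 1); zify at this; linarith
  have h1 : ((2 : ℤ) ^ (n + 1) * w - w ^ 2) * (Wd (k + 1) (n + 1) w).card =
      ∑ f ∈ Wd (k + 1) (n + 1) w, ∑ a ∈ nz (n + 1), S f a ^ 2 := by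
    rw [mul_comm, ← nsmul_eq_mul, ← Finset.sum_const]
    refine Finset.sum_congr rfl fun f hf => ?_
    rw [sum_nz_S_sq, (mem_Wd.1 hf).2]
  have h3 : ∀ a ∈ nz (n + 1), ∑ f ∈ Wd (k + 1) (n + 1) w, S f a ^ 2 =
      ∑ s ∈ range (w + 1), (2 * s - w : ℤ) ^ 2 * ∑ u ∈ Wd (k + 1) n s, (Co k u (w - s)).card := by
    intro a ha
    have h4 : ∀ f, S f a ^ 2 = S (act (tr a) f) (e0 n) ^ 2 := fun f => by
      rw [← adj_tr (mem_nz.1 ha), S_act]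
    simp only [h4]
    rw [sum_Wd_act (tr a) w (fun f => S f (e0 n) ^ 2), sum_Co_split]
    refine Finset.sum_congr rfl fun s hs => ?_
    rw [Finset.mem_range] at hs
    push_cast
    rw [Finset.mul_sum, lo_zero]
    refine Finset.sum_congr rfl fun u hu => ?_
    rw [hi_zero, zero_add, zero_add, mul_comm, ← nsmul_eq_mul, ← Finset.sum_const]
    refine Finset.sum_congr rfl fun v hv => ?_
    rw [S_e0, lo_glue, hi_glue, (mem_Wd.1 hu).2, (mem_Co.1 hv).2, Nat.cast_sub (by omega)]
    ring
  rw [h1, Finset.sum_comm, Finset.sum_congr rfl h3, Finset.sum_const, nsmul_eq_mul, h2]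

/-- Pairs in a common coset can be listed in either order. -/
theorem sum_Co_comm (k s t : ℕ) (f : BF n) (hf : Deg (k + 1) f) :
    ∑ u ∈ Wd (k + 1) n s, (Co k (f + u) t).card = ∑ u ∈ Wd (k + 1) n t, (Co k (f + u) s).card := by
  classical
  have h : ∀ a b, ∑ u ∈ Wd (k + 1) n a, (Co k (f + u) b).card =
      ∑ u ∈ Wd (k + 1) n a, ∑ v ∈ Wd (k + 1) n b, if Deg k (f + u + v) then 1 else 0 := by
    intro a b
    refine Finset.sum_congr rfl fun u hu => ?_
    rw [← Finset.sum_filter, ← Finset.card_eq_sum_ones]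
    congr 1
    ext v
    rw [mem_Co, Finset.mem_filter, mem_Wd]
    refine ⟨fun hv => ⟨⟨?_, hv.2⟩, hv.1⟩, fun hv => ⟨hv.2, hv.1.2⟩⟩
    exact ((hf.add (mem_Wd.1 hu).1).add_iff_right).1 hv.1.succ
  rw [h, h, Finset.sum_comm]
  simp only [add_right_comm]

theorem sum_range_symm {R : Type*} [CommSemiring R] {t : ℕ} (G : ℕ → R)
    (hG : ∀ r ≤ t, G (t - r) = G r) (T : Finset ℕ) (hT : ∀ r ∈ T, 2 * r < t)
    (h : ∀ r, 2 * r < t → r ∉ T → G r = 0) :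
    ∑ r ∈ range (t + 1), G r = 2 * ∑ r ∈ T, G r + (if 2 ∣ t then G (t / 2) else 0) := by
  have h1 : ∑ r ∈ T, G r = ∑ r ∈ (range (t + 1)).filter (fun r => 2 * r < t), G r := by
    refine Finset.sum_subset (fun r hr => ?_) (fun r hr hrT => ?_)
    · have := hT r hr
      simp only [Finset.mem_filter, Finset.mem_range]; omega
    · exact h r (Finset.mem_filter.1 hr).2 hrT
  have h2 : ∑ r ∈ (range (t + 1)).filter (fun r => t < 2 * r), G r =
      ∑ r ∈ (range (t + 1)).filter (fun r => 2 * r < t), G r := by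
    refine Finset.sum_nbij' (fun r => t - r) (fun r => t - r) ?_ ?_ ?_ ?_ ?_
    all_goals
      intro r hr
      simp only [Finset.mem_filter, Finset.mem_range] at hr ⊢
    · omega
    · omega
    · omega
    · omega
    · rw [hG r (by omega)]
  have h3 : ∀ r, G r = (if 2 * r < t then G r else 0) + (if t < 2 * r then G r else 0) +
      (if 2 * r = t then G r else 0) := by
    intro r
    rcases lt_trichotomy (2 * r) t with h | h | h
    · simp [h, h.not_gt, h.ne]
    · simp [h]
    · simp [h, h.not_gt, h.ne']
  rw [Finset.sum_congr rfl fun r _ => h3 r, Finset.sum_add_distrib, Finset.sum_add_distrib,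
    ← Finset.sum_filter, ← Finset.sum_filter, h2, ← h1, two_mul]
  congr 1
  split_ifs with ht
  · obtain ⟨r, rfl⟩ := ht
    rw [Finset.sum_eq_single r]
    · rw [if_pos rfl, Nat.mul_div_cancel_left r two_pos]
    · intro x _ hx
      rw [if_neg (by omega)]
    · intro hr
      rw [Finset.mem_range] at hr
      omega
  · refine Finset.sum_eq_zero fun r _ => if_neg fun hr => ht ⟨r, hr.symm⟩

/-! ### Cosets of the affine functions -/

theorem W_add_cst (f : BF n) (l : Pt n) (c : ZMod 2) : W (f + cst c) l = chi c * W f l := by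
  simp only [W, hat, Finset.mul_sum, Pi.add_apply, chi_add]
  exact Finset.sum_congr rfl fun x _ => by ring

/-- Affine translates of a quadratic function of nonzero Walsh coefficient. -/
theorem W_affine_ne_zero (hf : Deg 3 f) (h0 : W f 0 ≠ 0) (l : Pt n) (c : ZMod 2) :
    W (f + (lin l + cst c)) 0 ≠ 0 ↔ l ∈ Lam f := by
  classical
  rw [← add_assoc, W_add_cst, ← W_eq, Ne, mul_eq_zero]
  have h1 := W_sq_eq' hf h0 l
  have h2 := chi_sq c
  have h3 : chi c ≠ 0 := fun h => by rw [h] at h2; norm_num at h2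
  split_ifs at h1 with h
  · refine iff_of_true ?_ h
    rw [not_or]
    refine ⟨h3, fun h4 => h0 ?_⟩
    rw [h4] at h1
    exact pow_eq_zero_iff (two_ne_zero) |>.1 (by rw [← h1]; norm_num)
  · exact iff_of_false (not_not.2 (Or.inr (by simpa using h1))) h

/-- The affine functions `p` for which `f + p` is unbalanced form a group. -/
theorem W_add_ne_zero_iff (hf : Deg 3 f) {p q : BF n} (hp : Deg 2 p) (hq : Deg 2 q) (h0 : W f 0 ≠ 0)
    (h1 : W (f + p) 0 ≠ 0) : W (f + p + q) 0 ≠ 0 ↔ W (f + q) 0 ≠ 0 := by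
  obtain ⟨l, c, rfl⟩ := deg_two_iff.1 hp
  obtain ⟨l', c', rfl⟩ := deg_two_iff.1 hq
  rw [W_affine_ne_zero hf h0] at *
  rw [show f + (lin l + cst c) + (lin l' + cst c') = f + (lin (l + l') + cst (c + c')) by
    rw [lin_add, ← cst_add]; abel, W_affine_ne_zero hf h0, Lam_add_iff h1]

theorem W_eq_zero_iff : W f 0 = 0 ↔ 2 * wt f = 2 ^ n := by
  rw [W_zero]
  zify
  constructor <;> intro h <;> linarith

/-- The weights in a coset of the affine functions. -/
theorem sum_wt_affine {M : Type*} [AddCommMonoid M] (hf : Deg 3 f) (h0 : W f 0 ≠ 0) (l : Pt n)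
    [Decidable (l ∈ Lam f)] (F : ℕ → M) (h : ℕ) (hh : 2 * h = 2 ^ n) :
    ∑ c, F (wt (f + (lin l + cst c))) =
      if l ∈ Lam f then F (wt f) + F (2 ^ n - wt f) else F h + F h := by
  have h1 := W_sq_eq' hf h0 l
  have e1 : f + (lin l + cst 0) = f + lin l := by
    rw [show (cst 0 : BF n) = 0 from rfl, add_zero]
  have e2 : f + (lin l + cst 1) = f + lin l + 1 := by rw [← add_assoc]; rfl
  rw [sum_zmod2, e1, e2]
  have h2 := (W_eq f l).symm
  rw [W_zero] at h2
  have h3 := wt_add_one (f + lin l)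
  have h4 : (2 : ℤ) * h = 2 ^ n := by exact_mod_cast hh
  split_ifs at h1 ⊢ with hl
  · rw [← h2, W_zero, sq_eq_sq_iff_eq_or_eq_neg] at h1
    rcases h1 with h1 | h1
    · rw [show wt (f + lin l) = wt f by omega, show wt (f + lin l + 1) = 2 ^ n - wt f by omega]
    · rw [show wt (f + lin l + 1) = wt f by omega,
        show wt (f + lin l) = 2 ^ n - wt f by omega, add_comm]
  · rw [← h2] at h1
    have h6 := pow_eq_zero_iff (two_ne_zero) |>.1 h1
    rw [show wt (f + lin l) = h by omega, show wt (f + lin l + 1) = h by omega]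

/-- The number of words of weight `t` in a coset of the affine functions. -/
theorem card_Co_two (hf : Deg 3 f) (L h t : ℕ) (hh : 2 * h = 2 ^ n)
    (hL : L * (2 ^ n - 2 * wt f : ℤ) ^ 2 = 4 ^ n) :
    (Co 2 f t).card = L * ((if wt f = t then 1 else 0) + (if 2 ^ n - wt f = t then 1 else 0)) +
      (2 ^ n - L) * (if h = t then 2 else 0) := by
  classical
  have h0 : W f 0 ≠ 0 := by
    rw [W_zero]
    intro h0
    rw [h0] at hL
    have : (0 : ℤ) < 4 ^ n := by positivity
    rw [← hL] at this
    simp at this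
  have hL' : (Lam f).card = L := by
    have h1 := card_Lam hf h0
    rw [← hL, W_zero] at h1
    rw [W_zero] at h0
    have := mul_right_cancel₀ (pow_ne_zero 2 h0) h1
    exact_mod_cast this
  have h1 : (Co 2 f t).card = ∑ l, ∑ c, if wt (f + (lin l + cst c)) = t then 1 else 0 := by
    rw [← sum_deg_two f (fun w => if wt w = t then 1 else 0), Finset.card_eq_sum_ones, Co,
      Finset.sum_filter]
    refine Finset.sum_congr rfl fun w _ => ?_
    rw [← ite_and]
  rw [h1, Finset.sum_congr rfl fun l _ =>
    sum_wt_affine hf h0 l (fun s => if s = t then 1 else 0) h hh,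
    Finset.sum_ite, Finset.sum_const, Finset.sum_const, Finset.filter_univ_mem, hL', smul_eq_mul,
    smul_eq_mul]
  congr 1
  have h2 := Finset.card_filter_add_card_filter_not (s := (univ : Finset (Pt n))) (· ∈ Lam f)
  rw [Finset.filter_univ_mem, hL', Finset.card_univ, card_Pt] at h2
  rw [show (univ.filter fun x => x ∉ Lam f).card = 2 ^ n - L by omega]
  congr 1
  split_ifs <;> rfl

/-- The possible weights of quadratic functions. -/
theorem wt_deg_three (hf : Deg 3 f) :
    2 * wt f = 2 ^ n ∨ ∃ i ≤ n, (2 ^ n - 2 * wt f : ℤ) ^ 2 = 2 ^ (n + i) := by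
  by_cases h0 : W f 0 = 0
  · exact Or.inl (W_eq_zero_iff.1 h0)
  · right
    rw [← W_zero]
    exact W_zero_sq_eq_pow hf h0

theorem Wd_three_eq_empty (n s : ℕ) (h : ¬ 2 * s = 2 ^ n)
    (h' : ∀ i ∈ range (n + 1), (2 ^ n - 2 * s : ℤ) ^ 2 ≠ 2 ^ (n + i)) : Wd 3 n s = ∅ := by
  rw [Finset.eq_empty_iff_forall_notMem]
  intro f hf
  obtain ⟨hf1, rfl⟩ := mem_Wd.1 hf
  rcases wt_deg_three hf1 with h1 | ⟨i, hi, h1⟩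
  · exact h h1
  · exact h' i (Finset.mem_range.2 (by omega)) h1

/-- The second moment identity, using symmetry. -/
theorem sum_Wd_moment_of (k n w : ℕ) {A : ℕ} (hA : (Wd (k + 1) (n + 1) w).card = A)
    (T : Finset ℕ) (hT : ∀ s ∈ T, 2 * s < w)
    (h : ∀ s, 2 * s < w → s ∉ T → ∑ u ∈ Wd (k + 1) n s, (Co k u (w - s)).card = 0) :
    ((2 : ℤ) ^ (n + 1) * w - w ^ 2) * A = (2 ^ (n + 1) - 1) *
      (2 * ∑ s ∈ T, (2 * s - w : ℤ) ^ 2 * ∑ u ∈ Wd (k + 1) n s, (Co k u (w - s)).card) := by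
  rw [← hA, sum_Wd_moment]
  congr 1
  set G : ℕ → ℤ := fun s => (2 * s - w : ℤ) ^ 2 * (∑ u ∈ Wd (k + 1) n s, (Co k u (w - s)).card : ℕ)
    with hG
  have hmid : (if 2 ∣ w then G (w / 2) else 0) = 0 := by
    split_ifs with hw
    · obtain ⟨r, rfl⟩ := hw
      simp [hG]
    · rfl
  change ∑ s ∈ range (w + 1), G s = 2 * ∑ s ∈ T, G s
  rw [sum_range_symm G (fun s hs => ?_) T hT fun s hs hsT => ?_, hmid, add_zero]
  · have h1 := sum_Co_comm k (w - s) s (0 : BF n) (Deg.zero _)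
    simp only [zero_add] at h1
    simp only [hG]
    rw [show w - (w - s) = s by omega, h1, Nat.cast_sub hs]
    ring
  · simp only [hG, h s hs hsT, Nat.cast_zero, mul_zero]

/-- A sum over words whose summand is constant. -/
theorem sum_Wd_card {s c t : ℕ} (h : ∀ u ∈ Wd j n s, (Co k u t).card = c) :
    ∑ u ∈ Wd j n s, (Co k u t).card = (Wd j n s).card * c := by
  rw [Finset.sum_congr rfl h, Finset.sum_const, smul_eq_mul]

/-! ### Words of small weight in second order codes -/

theorem sum_Co_two (n s t L h : ℕ) (hh : 2 * h = 2 ^ n) (hL : L * (2 ^ n - 2 * s : ℤ) ^ 2 = 4 ^ n) :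
    ∑ u ∈ Wd 3 n s, (Co 2 u t).card = (Wd 3 n s).card * (L * ((if s = t then 1 else 0) +
      (if 2 ^ n - s = t then 1 else 0)) + (2 ^ n - L) * (if h = t then 2 else 0)) := by
  refine sum_Wd_card fun u hu => ?_
  obtain ⟨hu1, rfl⟩ := mem_Wd.1 hu
  exact card_Co_two hu1 L h t hh hL

/-- The second moment identity for quadratic functions. -/
theorem moment_three (n w : ℕ) {A : ℕ} (hA : (Wd 3 (n + 1) w).card = A)
    (T : Finset ℕ) (hT : ∀ s ∈ T, 2 * s < w)
    (h : ∀ s ∈ range w, 2 * s < w → s ∉ T → ¬ 2 * s = 2 ^ n ∧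
      ∀ i ∈ range (n + 1), (2 ^ n - 2 * s : ℤ) ^ 2 ≠ 2 ^ (n + i)) :
    ((2 : ℤ) ^ (n + 1) * w - w ^ 2) * A = (2 ^ (n + 1) - 1) *
      (2 * ∑ s ∈ T, (2 * s - w : ℤ) ^ 2 * ∑ u ∈ Wd 3 n s, (Co 2 u (w - s)).card) := by
  refine sum_Wd_moment_of 2 n w hA T hT fun s hs hsT => ?_
  obtain ⟨h1, h2⟩ := h s (Finset.mem_range.2 (by omega)) hs hsT
  rw [Wd_three_eq_empty n s h1 h2, Finset.sum_empty]

theorem card_Wd_three_two : (Wd 3 3 2).card = 28 := by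
  generalize hA : (Wd 3 3 2).card = A
  have h := moment_three 2 2 hA {0} (by decide) (by decide)
  rw [Finset.sum_singleton, sum_Co_two 2 0 _ 1 2 (by norm_num) (by norm_num), Wd_zero] at h
  norm_num at h
  omega

theorem card_Wd_zero (k n : ℕ) : (Wd k n 0).card = 1 := by rw [Wd_zero, Finset.card_singleton]

theorem card_Wd_three_four_four : (Wd 3 4 4).card = 140 := by
  generalize hA : (Wd 3 4 4).card = A
  have h := moment_three 3 4 hA {0} (by decide) (by decide)
  rw [Finset.sum_singleton, sum_Co_two 3 0 _ 1 4 (by norm_num) (by norm_num), card_Wd_zero] at h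
  norm_num at h
  omega

theorem card_Wd_three_four_six : (Wd 3 4 6).card = 448 := by
  generalize hA : (Wd 3 4 6).card = A
  have h := moment_three 3 6 hA {0, 2} (by decide) (by decide)
  rw [Finset.sum_pair (by decide), sum_Co_two 3 0 _ 1 4 (by norm_num) (by norm_num),
    sum_Co_two 3 2 _ 4 4 (by norm_num) (by norm_num), card_Wd_zero, card_Wd_three_two] at h
  norm_num at h
  omega

theorem card_Wd_three_five_eight : (Wd 3 5 8).card = 620 := by
  generalize hA : (Wd 3 5 8).card = A
  have h := moment_three 4 8 hA {0} (by decide) (by decide)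
  rw [Finset.sum_singleton, sum_Co_two 4 0 _ 1 8 (by norm_num) (by norm_num), card_Wd_zero] at h
  norm_num at h
  omega

theorem card_Wd_three_five_twelve : (Wd 3 5 12).card = 13888 := by
  generalize hA : (Wd 3 5 12).card = A
  have h := moment_three 4 12 hA {0, 4} (by decide) (by decide)
  rw [Finset.sum_pair (by decide), sum_Co_two 4 0 _ 1 8 (by norm_num) (by norm_num),
    sum_Co_two 4 4 _ 4 8 (by norm_num) (by norm_num), card_Wd_zero, card_Wd_three_four_four] at h
  norm_num at h
  omega

theorem card_Wd_three_six_sixteen : (Wd 3 6 16).card = 2604 := by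
  generalize hA : (Wd 3 6 16).card = A
  have h := moment_three 5 16 hA {0} (by decide) (by decide)
  rw [Finset.sum_singleton, sum_Co_two 5 0 _ 1 16 (by norm_num) (by norm_num), card_Wd_zero] at h
  norm_num at h
  omega

theorem card_Wd_three_six_twentyfour : (Wd 3 6 24).card = 291648 := by
  generalize hA : (Wd 3 6 24).card = A
  have h := moment_three 5 24 hA {0, 8} (by decide) (by decide)
  rw [Finset.sum_pair (by decide), sum_Co_two 5 0 _ 1 16 (by norm_num) (by norm_num),
    sum_Co_two 5 8 _ 4 16 (by norm_num) (by norm_num), card_Wd_zero, card_Wd_three_five_eight] at h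
  norm_num at h
  omega

theorem card_Wd_three_six_twentyeight : (Wd 3 6 28).card = 888832 := by
  generalize hA : (Wd 3 6 28).card = A
  have h := moment_three 5 28 hA {0, 8, 12} (by decide) (by decide)
  rw [Finset.sum_insert (by decide), Finset.sum_pair (by decide),
    sum_Co_two 5 0 _ 1 16 (by norm_num) (by norm_num),
    sum_Co_two 5 8 _ 4 16 (by norm_num) (by norm_num),
    sum_Co_two 5 12 _ 16 16 (by norm_num) (by norm_num), card_Wd_zero, card_Wd_three_five_eight,
    card_Wd_three_five_twelve] at h
  norm_num at h
  omega

theorem sum_Co_two_six_sixteen (t : ℕ) : ∑ u ∈ Wd 3 6 16, (Co 2 u t).card = 2604 *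
    (4 * ((if 16 = t then 1 else 0) + (if 48 = t then 1 else 0))
      + 60 * (if 32 = t then 2 else 0)) := by
  rw [sum_Co_two 6 16 _ 4 32 (by norm_num) (by norm_num), card_Wd_three_six_sixteen]
  norm_num

theorem sum_Co_two_six_twentyfour (t : ℕ) : ∑ u ∈ Wd 3 6 24, (Co 2 u t).card = 291648 *
    (16 * ((if 24 = t then 1 else 0) + (if 40 = t then 1 else 0)) +
      48 * (if 32 = t then 2 else 0)) := by
  rw [sum_Co_two 6 24 _ 16 32 (by norm_num) (by norm_num), card_Wd_three_six_twentyfour]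
  norm_num

theorem sum_Co_two_six_twentyeight (t : ℕ) : ∑ u ∈ Wd 3 6 28, (Co 2 u t).card = 888832 *
    (64 * ((if 28 = t then 1 else 0) + (if 36 = t then 1 else 0))
      + 0 * (if 32 = t then 2 else 0)) := by
  rw [sum_Co_two 6 28 _ 64 32 (by norm_num) (by norm_num), card_Wd_three_six_twentyeight]
  norm_num

theorem card_Wd_three_seven_sixtyfour : (Wd 3 7 64).card = 300503590 := by
  generalize hA : (Wd 3 7 64).card = A
  have h := moment_three 6 64 hA {0, 16, 24, 28} (by decide) (by decide)
  rw [Finset.sum_insert (by decide), Finset.sum_insert (by decide), Finset.sum_pair (by decide),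
    sum_Co_two 6 0 _ 1 32 (by norm_num) (by norm_num), sum_Co_two_six_sixteen,
    sum_Co_two_six_twentyfour, sum_Co_two_six_twentyeight, card_Wd_zero] at h
  norm_num at h
  omega

/-! ### Triples of words -/

/-- The number of triples of functions of degree at most `k` of given weights whose sum has degree
less than `k`. -/
noncomputable def Tri (k n a b c : ℕ) : ℕ :=
  ∑ u ∈ Wd (k + 1) n a, ∑ v ∈ Wd (k + 1) n b, (Co k (u + v) c).card

theorem Tri_comm_left (k n a b c : ℕ) : Tri k n a b c = Tri k n b a c := by
  rw [Tri, Tri, Finset.sum_comm]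
  simp only [add_comm]

theorem Tri_comm_right (k n a b c : ℕ) : Tri k n a b c = Tri k n a c b :=
  Finset.sum_congr rfl fun u hu => sum_Co_comm k b c u (mem_Wd.1 hu).1

theorem Tri_zero (k n a c : ℕ) : Tri k n a 0 c = ∑ u ∈ Wd (k + 1) n a, (Co k u c).card := by
  simp only [Tri, Wd_zero, Finset.sum_singleton, add_zero]

theorem Tri_eq_zero {a b : ℕ} (c : ℕ) (h : Wd (k + 1) n b = ∅) : Tri k n a b c = 0 := by
  simp only [Tri, h, Finset.sum_empty, Finset.sum_const_zero]

theorem sum_zc_Co_mul (k n s t : ℕ) (hs : s ≠ 0) (F : BF (n + 1) → ℤ) (F' : BF n → ℤ)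
    (hF : ∀ E w, F (act E w) = F w)
    (hF0 : ∀ c ∈ Wd (k + 1) n s, F (glue 0 c) = F' c ∧ F (glue c 0) = F' c) :
    ∑ u ∈ Wd (k + 2) (n + 1) s, zc u * (F u * (Co (k + 1) u t).card) =
      (2 ^ (n + 1) - 1) * (2 * ∑ c ∈ Wd (k + 1) n s, F' c *
        ∑ r ∈ range (t + 1), ∑ p ∈ Wd (k + 1) n r, (Co k (c + p) (t - r)).card) := by
  rw [sum_zc_mul hs (fun u => F u * (Co (k + 1) u t).card) fun E w => by rw [hF, card_Co_act],
    Finset.mul_sum _ _ (2 : ℤ)]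
  congr 1
  refine Finset.sum_congr rfl fun c hc => ?_
  rw [(hF0 c hc).1, (hF0 c hc).2, ← mul_add, mul_left_comm, two_mul]
  congr 1
  rw [card_Co_split, card_Co_split]
  simp only [lo_glue, hi_glue, add_zero, zero_add, Co_eq_Wd (mem_Wd.1 hc).1]

theorem sum_Tri_half (k n s t : ℕ) (T : Finset ℕ) (hT : ∀ r ∈ T, 2 * r < t)
    (h : ∀ r, 2 * r < t → r ∉ T → Tri k n s r (t - r) = 0) :
    ∑ r ∈ range (t + 1), Tri k n s r (t - r) =
      2 * ∑ r ∈ T, Tri k n s r (t - r) + (if 2 ∣ t then Tri k n s (t / 2) (t / 2) else 0) := by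
  rw [sum_range_symm (fun r => Tri k n s r (t - r)) (fun r hr => ?_) T hT h]
  · split_ifs with ht
    · obtain ⟨r, rfl⟩ := ht
      rw [Nat.mul_div_cancel_left r two_pos, show 2 * r - r = r by omega]
    · rfl
  · rw [Tri_comm_right, show t - (t - r) = r by omega]

/-- Counting pairs weighted by the number of constant functionals. -/
theorem sum_zc_Co (k n s t : ℕ) (hs : s ≠ 0) (T : Finset ℕ) (hT : ∀ r ∈ T, 2 * r < t)
    (h : ∀ r, 2 * r < t → r ∉ T → Tri k n s r (t - r) = 0) :
    ∑ u ∈ Wd (k + 2) (n + 1) s, (zc u : ℤ) * (Co (k + 1) u t).card = (2 ^ (n + 1) - 1) * (2 *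
      ((2 * ∑ r ∈ T, Tri k n s r (t - r) +
        (if 2 ∣ t then Tri k n s (t / 2) (t / 2) else 0) : ℕ) : ℤ)) := by
  have h1 := sum_zc_Co_mul k n s t hs (fun _ => 1) (fun _ => 1) (fun _ _ => rfl)
    (fun _ _ => ⟨rfl, rfl⟩)
  simp only [one_mul] at h1
  rw [h1, ← sum_Tri_half k n s t T hT h]
  congr 2
  push_cast
  rw [Finset.sum_comm]
  refine Finset.sum_congr rfl fun r _ => ?_
  rw [Tri]
  push_cast
  rfl

/-! ### Cosets modulo constants -/

theorem deg_one_cases (h : Deg 1 f) : f = 0 ∨ f = 1 := by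
  obtain ⟨c, rfl⟩ := deg_one_iff.1 h
  rcases zmod2_cases c with rfl | rfl
  · exact Or.inl rfl
  · exact Or.inr rfl

theorem deg_one_one : Deg 1 (1 : BF n) := deg_one_iff.2 ⟨1, rfl⟩

theorem card_Co_one (f : BF n) (t : ℕ) :
    (Co 1 f t).card = (if wt f = t then 1 else 0) + (if 2 ^ n - wt f = t then 1 else 0) := by
  classical
  have h1 : Co 1 f t = (({f, f + 1} : Finset (BF n))).filter (fun w => wt w = t) := by
    ext w
    rw [mem_Co, Finset.mem_filter, Finset.mem_insert, Finset.mem_singleton]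
    refine and_congr_left fun _ => ⟨fun h => ?_, ?_⟩
    · have e : w = f + (f + w) := (pi_add_add_cancel f w).symm
      rcases deg_one_cases h with h | h
      · left; rw [e, h, add_zero]
      · right; rw [e, h]
    · rintro (rfl | rfl)
      · rw [pi_add_self]; exact Deg.zero 1
      · rw [pi_add_add_cancel]; exact deg_one_one
  have hne : f ≠ f + 1 := fun h => by
    have := congrFun h 0
    simp at this
  have h2 := wt_add_one f
  rw [h1, Finset.card_filter, Finset.sum_pair hne, show wt (f + 1) = 2 ^ n - wt f by omega]

/-- Summing over a difference of cosets in either order. -/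
theorem sum_Co_Co_comm {k' : ℕ} {p d : BF n} (hkk : k' ≤ k) (hd : Deg k (p + d)) (s t : ℕ) :
    ∑ y ∈ Co k p s, (Co k' (d + y) t).card = ∑ y ∈ Co k 0 t, (Co k' (d + y) s).card := by
  classical
  have h1 : ∀ y ∈ Co k p s, (Co k' (d + y) t).card =
      ∑ v ∈ Co k 0 t, if Deg k' (d + y + v) then 1 else 0 := by
    intro y hy
    rw [← Finset.sum_filter, ← Finset.card_eq_sum_ones]
    congr 1
    ext v
    rw [Finset.mem_filter, mem_Co, mem_Wd]
    refine ⟨fun hv => ⟨⟨?_, hv.2⟩, hv.1⟩, fun hv => ⟨hv.2, hv.1.2⟩⟩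
    have e : v = (p + d) + (p + y) + (d + y + v) := by
      rw [show p + d + (p + y) + (d + y + v) = (p + p) + ((d + d) + ((y + y) + v)) by abel,
        pi_add_self, pi_add_self, pi_add_self, zero_add, zero_add, zero_add]
    rw [e]
    exact (hd.add (mem_Co.1 hy).1).add (hv.1.mono hkk)
  have h2 : ∀ v ∈ Co k 0 t, (Co k' (d + v) s).card =
      ∑ y ∈ Co k p s, if Deg k' (d + y + v) then 1 else 0 := by
    intro v hv
    rw [← Finset.sum_filter, ← Finset.card_eq_sum_ones]
    congr 1
    ext y
    rw [Finset.mem_filter, mem_Co, mem_Co, show d + v + y = d + y + v by abel]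
    refine ⟨fun hy => ⟨⟨?_, hy.2⟩, hy.1⟩, fun hy => ⟨hy.2, hy.1.2⟩⟩
    have e : p + y = (p + d) + v + (d + y + v) := by
      rw [show p + d + v + (d + y + v) = (d + d) + ((v + v) + (p + y)) by abel,
        pi_add_self, pi_add_self, zero_add, zero_add]
    rw [e]
    exact (hd.add (mem_Wd.1 hv).1).add (hy.1.mono hkk)
  rw [Finset.sum_congr rfl h1, Finset.sum_comm, Finset.sum_congr rfl h2]

theorem sum_Co_Co_self_comm {k' : ℕ} {p d : BF n} (hkk : k' ≤ k) (hd : Deg k d) (s t : ℕ) :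
    ∑ y ∈ Co k p s, (Co k' (d + y) t).card = ∑ y ∈ Co k p t, (Co k' (d + y) s).card := by
  classical
  have h1 : ∀ s t, ∑ y ∈ Co k p s, (Co k' (d + y) t).card = ∑ y ∈ Co k p s, ∑ v ∈ Co k p t,
      if Deg k' (d + y + v) then 1 else 0 := by
    intro s t
    refine Finset.sum_congr rfl fun y hy => ?_
    rw [← Finset.sum_filter, ← Finset.card_eq_sum_ones]
    congr 1
    ext v
    rw [Finset.mem_filter, mem_Co, mem_Co]
    refine ⟨fun hv => ⟨⟨?_, hv.2⟩, hv.1⟩, fun hv => ⟨hv.2, hv.1.2⟩⟩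
    have e : p + v = d + (p + y) + (d + y + v) := by
      rw [show d + (p + y) + (d + y + v) = (d + d) + ((y + y) + (p + v)) by abel,
        pi_add_self, pi_add_self, zero_add, zero_add]
    rw [e]
    exact (hd.add (mem_Co.1 hy).1).add (hv.1.mono hkk)
  rw [h1, h1, Finset.sum_comm]
  simp only [add_right_comm]

/-- Counting the translates of `g` by a nonconstant affine function, up to a constant. -/
theorem sum_Wd_two_card_Co_one {h' : ℕ} (hh : 2 * h' = 2 ^ n) (g : BF n) (r : ℕ) :
    (∑ c ∈ Wd 2 n h', ((Co 1 (g + c) r).card : ℤ)) = 2 * ((Co 2 g r).card - (Co 1 g r).card) := by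
  classical
  have h0 : (∑ c ∈ Wd 2 n h', (Co 1 (g + c) r).card) = ∑ v ∈ Co 2 g r, (Co 1 (g + v) h').card :=
    sum_Co_Co_comm (by omega) (by rw [pi_add_self]; exact Deg.zero _) r h' |>.symm
  have h1 : ∀ v ∈ Co 2 g r, ((Co 1 (g + v) h').card : ℤ) =
    2 - 2 * (if v ∈ Co 1 g r then 1 else 0) := by
    intro v hv
    rw [mem_Co] at hv
    have hm : v ∈ Co 1 g r ↔ Deg 1 (g + v) := by rw [mem_Co, and_iff_left hv.2]
    simp only [card_Co_one, hm]
    have hp : 0 < 2 ^ n := by positivity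
    split_ifs with h3 h4 h5 h5 h4 h5 h5
    all_goals try omega
    all_goals try norm_num
    · rcases deg_one_cases h5 with h | h <;> rw [h] at h3
      · rw [wt_zero] at h3; omega
      · rw [wt_one] at h3; omega
    · obtain ⟨l, c, h⟩ := deg_two_iff.1 hv.1
      have hl : l ≠ 0 := by
        rintro rfl
        rw [h] at h5
        exact h5 (lin_add_cst_deg_one.2 rfl)
      have := wt_lin hl c
      rw [← h] at this
      omega
  rw [← Nat.cast_sum, h0, Nat.cast_sum, Finset.sum_congr rfl h1, Finset.sum_sub_distrib,
    ← Finset.mul_sum, Finset.sum_const, Finset.sum_boole, nsmul_eq_mul]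
  have h2 : (Co 2 g r).filter (· ∈ Co 1 g r) = Co 1 g r := by
    ext v
    rw [Finset.mem_filter, mem_Co, mem_Co]
    exact ⟨fun h => h.2, fun h => ⟨⟨h.1.succ, h.2⟩, h⟩⟩
  rw [h2]
  ring

open scoped Classical in
theorem sum_Wd_cst_Co {f : BF (n + 1)} (hf : Deg 3 f) {h' : ℕ} (hh : 2 * h' = 2 ^ n) (t : ℕ)
    {a : Pt (n + 1)} (ha : a ≠ 0) {p q : BF n} (hp : lo (act (tr a) f) = p)
    (hq : hi (act (tr a) f) = q) :
    (∑ u ∈ (Wd 3 (n + 1) h').filter (fun u => Cst u a), ((Co 2 (f + u) t).card : ℤ)) =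
      4 * ∑ s ∈ range (t + 1), ((Co 2 p s).card * (Co 2 p (t - s)).card -
        ∑ y ∈ Co 2 p s, (Co 1 (p + q + y) (t - s)).card : ℤ) := by
  have hF : Deg 3 (act (tr a) f) := (deg_act _ f).2 hf
  have hpq : Deg 2 (p + q) := by rw [← hp, ← hq]; exact hF.lo_add_hi
  have hpos : 0 < 2 ^ n := by positivity
  rw [sum_Wd_cst (k := 2) (by omega) ha _ (fun u => ((Co 2 (act (tr a) f + u) t).card : ℤ))
    fun w _ => by rw [← act_add, card_Co_act]]
  have h1 : ∀ c ∈ Wd 2 n h', ((Co 2 (act (tr a) f + glue 0 c) t).card : ℤ) +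
      (Co 2 (act (tr a) f + glue c 0) t).card =
      2 * ∑ s ∈ range (t + 1), ∑ y ∈ Co 2 p s, ((Co 1 (p + q + y + c) (t - s)).card : ℤ) := by
    intro c hc
    rw [card_Co_split, card_Co_split]
    simp only [lo_add, hi_add, lo_glue, hi_glue, hp, hq, add_zero]
    have h2 : ∀ s, Co 2 (p + c) s = Co 2 p s := fun s => by
      refine Co_congr ?_ s
      rw [add_comm p c, add_assoc, pi_add_self, add_zero]
      exact (mem_Wd.1 hc).1
    simp only [h2]
    push_cast
    have e1 : ∀ y, p + (q + c) + y = p + q + y + c := fun y => by abel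
    have e2 : ∀ y, p + c + q + y = p + q + y + c := fun y => by abel
    simp only [e1, e2, ← two_mul]
  rw [Finset.sum_congr rfl h1, ← Finset.mul_sum, Finset.sum_comm, Finset.mul_sum, Finset.mul_sum]
  refine Finset.sum_congr rfl fun s _ => ?_
  rw [Finset.sum_comm]
  have h3 : ∀ y ∈ Co 2 p s, (∑ c ∈ Wd 2 n h', ((Co 1 (p + q + y + c) (t - s)).card : ℤ)) =
      2 * ((Co 2 p (t - s)).card - (Co 1 (p + q + y) (t - s)).card) := by
    intro y hy
    rw [sum_Wd_two_card_Co_one hh, Co_congr (f := p + q + y) (g := p)]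
    rw [show p + q + y + p = (p + q) + (p + y) by abel]
    exact hpq.add (mem_Co.1 hy).1
  rw [Finset.sum_congr rfl h3, ← Finset.mul_sum, Finset.sum_sub_distrib, Finset.sum_const,
    nsmul_eq_mul]
  push_cast
  ring

/-! ### Minimum weight translates of second order words in six variables -/

theorem card_Co_pos {w : BF n} (hw : Deg k (f + w)) : 0 < (Co k f (wt w)).card :=
  Finset.card_pos.2 ⟨w, mem_Co.2 ⟨hw, rfl⟩⟩

theorem sum_Co_one_eq (hf : Deg 3 f) {d : BF n} (hd : Deg 2 d) (L h r : ℕ) (hh : 2 * h = 2 ^ n)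
    (hL : L * (2 ^ n - 2 * wt f : ℤ) ^ 2 = 4 ^ n) :
    ∑ y ∈ Co 2 f (wt f), (Co 1 (d + y) r).card = (Co 2 f (wt f)).card *
      if wt (f + d) = h then (if h = r then 2 else 0)
        else (if wt f = r then 1 else 0) + (if 2 ^ n - wt f = r then 1 else 0) := by
  rw [← smul_eq_mul, ← Finset.sum_const]
  refine Finset.sum_congr rfl fun y hy => ?_
  obtain ⟨hy1, hy2⟩ := mem_Co.1 hy
  have hne : W f 0 ≠ 0 := by
    rw [W_zero]
    intro h0
    rw [h0] at hL
    have : (0 : ℤ) < 4 ^ n := by positivity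
    simp at hL
    omega
  have hne' : W (f + (f + y)) 0 ≠ 0 := by
    rw [pi_add_add_cancel, W_zero, hy2, ← W_zero]
    exact hne
  have h1 := W_add_ne_zero_iff hf hy1 hd hne hne'
  rw [pi_add_add_cancel, not_iff_not, W_eq_zero_iff, W_eq_zero_iff, add_comm y d] at h1
  have h4 : wt f = wt (d + y) ∨ 2 ^ n - wt f = wt (d + y) ∨ h = wt (d + y) := by
    by_contra! hcon
    have h3 := card_Co_pos (k := 2) (f := f) (w := d + y)
      (by rw [add_left_comm]; exact hd.add hy1)
    rw [card_Co_two hf L h _ hh hL, if_neg hcon.1, if_neg hcon.2.1, if_neg hcon.2.2] at h3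
    omega
  have h5 := wt_le f
  rw [card_Co_one]
  split_ifs <;> omega

theorem sum_pairs_eq {p d : BF n} (hd : Deg 2 d) (c : ℕ → ℕ) (hc : ∀ s, (Co 2 p s).card = c s)
    (t : ℕ) (T : Finset ℕ) (hT : T ⊆ range (t + 1))
    (h : ∀ s ∈ range (t + 1), s ∉ T → c s = 0 ∨ c (t - s) = 0) :
    ∑ s ∈ range (t + 1), ((Co 2 p s).card * (Co 2 p (t - s)).card -
        ∑ y ∈ Co 2 p s, (Co 1 (d + y) (t - s)).card : ℤ) =
      ∑ s ∈ T, ((c s * c (t - s) : ℕ) - (∑ y ∈ Co 2 p s, (Co 1 (d + y) (t - s)).card : ℕ) : ℤ) := by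
  symm
  rw [Finset.sum_subset hT]
  · simp only [hc]
    push_cast
    rfl
  · intro s hs hsT
    rcases h s hs hsT with h | h
    · have h0 := h
      rw [← hc, Finset.card_eq_zero] at h0
      rw [h, h0, Finset.sum_empty]; simp
    · have h0 := h
      rw [← hc, Finset.card_eq_zero] at h0
      rw [h, sum_Co_Co_self_comm (by omega) hd, h0, Finset.sum_empty]; simp

/-- A double count over the coset of `p` by the affine functions. -/
noncomputable def pairSum (p q : BF n) (t : ℕ) : ℤ :=
  ∑ s ∈ range (t + 1), ((Co 2 p s).card * (Co 2 p (t - s)).card -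
    ∑ y ∈ Co 2 p s, (Co 1 (p + q + y) (t - s)).card : ℤ)

/-- The value of the double count, in terms of the weights of the two halves. -/
theorem pairSum_five {p q : BF 5} (hp : Deg 3 p) (hpq : Deg 2 (p + q)) :
    (wt p = 0 → wt q = 16 → pairSum p q 16 = 120) ∧ (wt p = 8 → wt q = 8 → pairSum p q 16 = 12) ∧
    (wt p = 8 → wt q = 16 → pairSum p q 16 = 16) ∧ (wt p = 8 → wt q = 16 → pairSum p q 24 = 432) ∧
    (wt p = 12 → wt q = 12 → pairSum p q 16 = 0) ∧
      (wt p = 12 → wt q = 12 → pairSum p q 24 = 240) := by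
  have hq : wt (p + (p + q)) = wt q := by rw [pi_add_add_cancel]
  have key := fun L r hL => sum_Co_one_eq hp hpq L 16 r (by norm_num) hL
  have hc := fun L t hL => card_Co_two hp L 16 t (by norm_num) hL
  rw [hq] at key
  refine ⟨fun h1 h2 => ?_, fun h1 h2 => ?_, fun h1 h2 => ?_, fun h1 h2 => ?_, fun h1 h2 => ?_,
    fun h1 h2 => ?_⟩ <;> rw [h1] at key hc <;> rw [h2] at key
  · have hc := fun t => hc 1 t (by norm_num)
    have key := fun r => key 1 r (by norm_num)
    rw [pairSum, sum_pairs_eq hpq _ hc 16 {0, 16} (by decide) (by decide),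
      Finset.sum_pair (by decide),
      sum_Co_Co_self_comm (by omega) hpq 16, show 16 - 16 = 0 from rfl, show 16 - 0 = 16 from rfl,
      key, hc]
    norm_num
  · have hc := fun t => hc 4 t (by norm_num)
    have key := fun r => key 4 r (by norm_num)
    rw [pairSum, sum_pairs_eq hpq _ hc 16 {8} (by decide) (by decide), Finset.sum_singleton,
      show 16 - 8 = 8 from rfl, key, hc]
    norm_num
  · have hc := fun t => hc 4 t (by norm_num)
    have key := fun r => key 4 r (by norm_num)
    rw [pairSum, sum_pairs_eq hpq _ hc 16 {8} (by decide) (by decide), Finset.sum_singleton,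
      show 16 - 8 = 8 from rfl, key, hc]
    norm_num
  · have hc := fun t => hc 4 t (by norm_num)
    have key := fun r => key 4 r (by norm_num)
    rw [pairSum, sum_pairs_eq hpq _ hc 24 {8, 16} (by decide) (by decide),
      Finset.sum_pair (by decide),
      sum_Co_Co_self_comm (by omega) hpq 16, show 24 - 16 = 8 from rfl, show 24 - 8 = 16 from rfl,
      key, hc]
    norm_num
  · have hc := fun t => hc 16 t (by norm_num)
    rw [pairSum, sum_pairs_eq hpq _ hc 16 ∅ (by decide) (by decide), Finset.sum_empty]
  · have hc := fun t => hc 16 t (by norm_num)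
    have key := fun r => key 16 r (by norm_num)
    rw [pairSum, sum_pairs_eq hpq _ hc 24 {12} (by decide) (by decide), Finset.sum_singleton,
      show 24 - 12 = 12 from rfl, key, hc]
    norm_num

theorem pairSum_comm {p q : BF n} (hpq : Deg 2 (p + q)) (t : ℕ) :
    pairSum p q t = pairSum q p t := by
  simp only [pairSum, Co_congr hpq, add_comm p q]

theorem wt_three_five {p : BF 5} (hp : Deg 3 p) :
    wt p = 0 ∨ wt p = 8 ∨ wt p = 12 ∨ wt p = 16 ∨ wt p = 20 ∨ wt p = 24 ∨ wt p = 32 := by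
  by_contra hcon
  have h1 : ∀ s ∈ range 33, ¬ (s = 0 ∨ s = 8 ∨ s = 12 ∨ s = 16 ∨ s = 20 ∨ s = 24 ∨ s = 32) →
      (¬ 2 * s = 2 ^ 5 ∧ ∀ i ∈ range (5 + 1), (2 ^ 5 - 2 * s : ℤ) ^ 2 ≠ 2 ^ (5 + i)) := by decide
  have h2 := h1 (wt p) (Finset.mem_range.2 (by have := wt_le p; omega)) hcon
  have h3 := Wd_three_eq_empty 5 (wt p) h2.1 h2.2
  have h4 : p ∈ Wd 3 5 (wt p) := (mem_Wd (k := 3) (n := 5)).2 ⟨hp, rfl⟩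
  rw [h3] at h4
  exact Finset.notMem_empty p h4

open scoped Classical in
theorem sum_nz_cst_filter (s : Finset (BF n)) (F : BF n → ℤ) :
    ∑ u ∈ s, (zc u : ℤ) * F u = ∑ a ∈ nz n, ∑ u ∈ s.filter (fun u => Cst u a), F u := by
  classical
  simp only [Finset.sum_filter]
  rw [Finset.sum_comm]
  refine Finset.sum_congr rfl fun u _ => ?_
  rw [sum_nz_ite]
  rfl

/-- The number of words `w` in the coset of `f + u`, for `u` of minimum weight. -/
theorem three_mul_sum_card_Co {f : BF (n + 1)} (hf : Deg 3 f) {h' : ℕ} (hh : 2 * h' = 2 ^ n) (t : ℕ)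
    (K A B : ℤ)
    (h : ∀ p q : BF n, Deg 3 p → Deg 2 (p + q) → wt p + wt q = wt f → (wt p : ℤ) ≤ wt q →
      K * (4 * pairSum p q t) = A + B * (wt p - wt q : ℤ) ^ 2) :
    K * (3 * (∑ u ∈ Wd 3 (n + 1) h', (Co 2 (f + u) t).card : ℕ)) =
      (2 ^ (n + 1) - 1) * A + B * (2 ^ (n + 1) * wt f - (wt f : ℤ) ^ 2) := by
  classical
  have h1 : ∀ u ∈ Wd 3 (n + 1) h', (zc u : ℤ) * (Co 2 (f + u) t).card =
      3 * (Co 2 (f + u) t).card := by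
    intro u hu
    obtain ⟨hu1, hu2⟩ := (mem_Wd (k := 3) (n := n + 1) (t := h')).1 hu
    have := zc_of_min hu1 (by rw [hu2]; ring_nf; omega)
    rw [hu2, pow_succ, ← hh] at this
    have h0 : 0 < h' := by
      have := pow_pos (two_pos (α := ℕ)) n
      omega
    rw [show zc u = 3 by nlinarith]; rfl
  have h2 := sum_nz_cst_filter (Wd 3 (n + 1) h') (fun u => ((Co 2 (f + u) t).card : ℤ))
  rw [Finset.sum_congr rfl h1, ← Finset.mul_sum] at h2
  push_cast
  rw [h2, Finset.mul_sum]
  have h3 : ∀ a ∈ nz (n + 1), K * ∑ u ∈ (Wd 3 (n + 1) h').filter (fun u => Cst u a),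
      ((Co 2 (f + u) t).card : ℤ) = A + B * S f a ^ 2 := by
    intro a ha
    have ha := mem_nz.1 ha
    have hF : Deg 3 (act (tr a) f) := (deg_act _ f).2 hf
    have hw := wt_halves (act (tr a) f)
    rw [wt_act] at hw
    rw [S_tr ha]
    rw [sum_Wd_cst_Co hf hh t ha rfl rfl, ← pairSum]
    have hd := hF.lo_add_hi
    rcases le_total (wt (lo (act (tr a) f))) (wt (hi (act (tr a) f))) with hl | hl
    · exact h _ _ hF.lo hd hw.symm (by exact_mod_cast hl)
    · rw [pairSum_comm hd, h _ _ hF.hi (by rw [add_comm]; exact hd) (by omega)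
        (by exact_mod_cast hl)]
      ring
  rw [Finset.sum_congr rfl h3, Finset.sum_add_distrib, Finset.sum_const, ← Finset.mul_sum,
    sum_nz_S_sq, nsmul_eq_mul]
  have := card_nz (n + 1)
  rw [show ((nz (n + 1)).card : ℤ) = 2 ^ (n + 1) - 1 by rw [eq_sub_iff_add_eq]; exact_mod_cast this]

theorem wt_deg_two (hf : Deg 2 f) : wt f = 0 ∨ 2 * wt f = 2 ^ n ∨ wt f = 2 ^ n := by
  obtain ⟨l, c, rfl⟩ := deg_two_iff.1 hf
  by_cases hl : l = 0
  · rw [hl, lin_zero, zero_add]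
    rcases zmod2_cases c with rfl | rfl
    · exact Or.inl wt_zero
    · exact Or.inr (Or.inr wt_one)
  · exact Or.inr (Or.inl (wt_lin hl c))

theorem sum_card_Co_of_wt_sixteen {f : BF 6} (hf : f ∈ Wd 3 6 16) :
    ∑ u ∈ Wd 3 6 16, (Co 2 (f + u) 16).card = 1440 := by
  obtain ⟨hf1, hf2⟩ := mem_Wd.1 hf
  have h := three_mul_sum_card_Co hf1 (h' := 16) (by norm_num) 16 16 768 27
    fun p q hp hpq hw hle => by
    rw [hf2] at hw
    obtain ⟨h1, h2, -⟩ := pairSum_five hp hpq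
    rcases wt_three_five hp with h | h | h | h | h | h | h <;>
    rcases wt_three_five ((hp.add_iff_right (g := q)).1 (hpq.mono (by norm_num)) ) with
      h' | h' | h' | h' | h' | h' | h' <;> first | omega | skip
    · rw [h1 h h', h, h']; norm_num
    · rw [h2 h h', h, h']; norm_num
  rw [hf2] at h
  generalize ∑ u ∈ Wd 3 6 16, (Co 2 (f + u) 16).card = M at h ⊢
  norm_num at h
  omega

theorem sum_card_Co_of_wt_twentyfour {f : BF 6} (hf : f ∈ Wd 3 6 24) :
    ∑ u ∈ Wd 3 6 16, (Co 2 (f + u) 16).card = 320 ∧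
      ∑ u ∈ Wd 3 6 16, (Co 2 (f + u) 24).card = 24000 := by
  obtain ⟨hf1, hf2⟩ := mem_Wd.1 hf
  constructor
  · have h := three_mul_sum_card_Co hf1 (h' := 16) (by norm_num) 16 1 0 1
      fun p q hp hpq hw hle => by
      rw [hf2] at hw
      obtain ⟨-, -, h1, -, h2, -⟩ := pairSum_five hp hpq
      rcases wt_three_five hp with h | h | h | h | h | h | h <;>
      rcases wt_three_five ((hp.add_iff_right (g := q)).1 (hpq.mono (by norm_num)) ) with
        h' | h' | h' | h' | h' | h' | h' <;> first | omega | skip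
      · exact absurd (wt_deg_two (by rwa [wt_eq_zero.1 h, zero_add] at hpq)) (by rw [h']; norm_num)
      · rw [h1 h h', h, h']; norm_num
      · rw [h2 h h', h, h']; norm_num
    rw [hf2] at h
    generalize ∑ u ∈ Wd 3 6 16, (Co 2 (f + u) 16).card = M at h ⊢
    norm_num at h
    omega
  · have h := three_mul_sum_card_Co hf1 (h' := 16) (by norm_num) 24 1 960 12
      fun p q hp hpq hw hle => by
      rw [hf2] at hw
      obtain ⟨-, -, -, h1, -, h2⟩ := pairSum_five hp hpq
      rcases wt_three_five hp with h | h | h | h | h | h | h <;>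
      rcases wt_three_five ((hp.add_iff_right (g := q)).1 (hpq.mono (by norm_num)) ) with
        h' | h' | h' | h' | h' | h' | h' <;> first | omega | skip
      · exact absurd (wt_deg_two (by rwa [wt_eq_zero.1 h, zero_add] at hpq)) (by rw [h']; norm_num)
      · rw [h1 h h', h, h']; norm_num
      · rw [h2 h h', h, h']; norm_num
    rw [hf2] at h
    generalize ∑ u ∈ Wd 3 6 16, (Co 2 (f + u) 24).card = M at h ⊢
    norm_num at h
    omega

theorem Tri_two_six : Tri 2 6 16 16 16 = 2604 * 1440 ∧ Tri 2 6 16 16 24 = 291648 * 320 ∧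
    Tri 2 6 16 24 24 = 291648 * 24000 := by
  have h1 : ∀ a b c, (∀ f ∈ Wd 3 6 a, ∑ u ∈ Wd 3 6 16, (Co 2 (f + u) b).card = c) →
      Tri 2 6 16 b a = (Wd 3 6 a).card * c := by
    intro a b c h
    rw [Tri_comm_right, Tri_comm_left, Tri, Finset.sum_congr rfl h, Finset.sum_const, smul_eq_mul]
  rw [h1 16 16 1440 fun f hf => sum_card_Co_of_wt_sixteen hf,
    h1 24 16 320 fun f hf => (sum_card_Co_of_wt_twentyfour hf).1,
    h1 24 24 24000 fun f hf => (sum_card_Co_of_wt_twentyfour hf).2,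
    card_Wd_three_six_sixteen, card_Wd_three_six_twentyfour]
  norm_num

/-! ### Pairs of minimum weight words -/

theorem Co_eq_of_mem {w : BF n} {s : ℕ} (hw : w ∈ Co k f s) (t : ℕ) : Co k f t = Co k w t :=
  Co_congr (mem_Co.1 hw).1 t

theorem card_Co_two_of_mem (hf : Deg 3 f) {w : BF n} {s : ℕ} (hw : w ∈ Co 2 f s) (L h t : ℕ)
    (hh : 2 * h = 2 ^ n) (hL : L * (2 ^ n - 2 * s : ℤ) ^ 2 = 4 ^ n) :
    (Co 2 f t).card = L * ((if s = t then 1 else 0) + (if 2 ^ n - s = t then 1 else 0)) +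
      (2 ^ n - L) * (if h = t then 2 else 0) := by
  rw [Co_eq_of_mem hw]
  obtain ⟨h1, rfl⟩ := mem_Co.1 hw
  exact card_Co_two ((hf.add_iff_right).1 (h1.succ)) L h t hh hL

theorem card_Co_six_cases {f : BF 6} (hf : Deg 3 f) :
    ((Co 2 f 0).card = 1 ∧ (Co 2 f 16).card = 0 ∧ (Co 2 f 24).card = 0 ∧ (Co 2 f 32).card = 126) ∨
    ((Co 2 f 0).card = 0 ∧ (Co 2 f 16).card = 4 ∧ (Co 2 f 24).card = 0 ∧ (Co 2 f 32).card = 120) ∨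
    ((Co 2 f 0).card = 0 ∧ (Co 2 f 16).card = 0 ∧ (Co 2 f 24).card = 16 ∧ (Co 2 f 32).card = 96) ∨
    ((Co 2 f 0).card = 0 ∧ (Co 2 f 16).card = 0 ∧ (Co 2 f 24).card = 0) := by
  have key := fun (s L : ℕ) (hL : L * (2 ^ 6 - 2 * s : ℤ) ^ 2 = 4 ^ 6) w (hw : w ∈ Co 2 f s) t =>
    card_Co_two_of_mem hf hw L 32 t (by norm_num) hL
  rcases (Co 2 f 0).eq_empty_or_nonempty with h0 | ⟨w, hw⟩
  · rcases (Co 2 f 16).eq_empty_or_nonempty with h1 | ⟨w, hw⟩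
    · rcases (Co 2 f 24).eq_empty_or_nonempty with h2 | ⟨w, hw⟩
      · simp [h0, h1, h2]
      · have := key 24 16 (by norm_num) w hw
        simp only [this]; norm_num
    · have := key 16 4 (by norm_num) w hw
      simp only [this]; norm_num
  · have := key 0 1 (by norm_num) w hw
    simp only [this]; norm_num

theorem sum_pairs_six (F : BF 6 → BF 6 → ℕ) :
    (∑ u ∈ Wd 3 6 16, ∑ v ∈ Wd 3 6 16, F u v) = ∑ x ∈ Wd 3 6 16 ×ˢ Wd 3 6 16, F x.1 x.2 :=
  (Finset.sum_product' _ _ _).symm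

/-- The class modulo affine functions of a sum of two minimum weight words. -/
theorem card_Co_pair {u v : BF 6} (hu : u ∈ Wd 3 6 16) (hv : v ∈ Wd 3 6 16) :
    16 * (Co 2 (u + v) 0).card + 4 * (Co 2 (u + v) 16).card + (Co 2 (u + v) 24).card = 16 := by
  have hle : ∀ x ∈ Wd 3 6 16 ×ˢ Wd 3 6 16, 16 * (Co 2 (x.1 + x.2) 0).card +
      4 * (Co 2 (x.1 + x.2) 16).card + (Co 2 (x.1 + x.2) 24).card ≤ 16 := by
    intro x hx
    obtain ⟨h1, h2⟩ := Finset.mem_product.1 hx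
    have := card_Co_six_cases ((mem_Wd.1 h1).1.add (mem_Wd.1 h2).1)
    omega
  have h0 : Tri 2 6 16 16 0 = 2604 * 4 := by
    rw [Tri_comm_right, Tri_zero, sum_Co_two_six_sixteen]; norm_num
  obtain ⟨h1, h2, -⟩ := Tri_two_six
  rw [Tri, sum_pairs_six] at h0 h1 h2
  have h3 : ∑ x ∈ Wd 3 6 16 ×ˢ Wd 3 6 16, (16 * (Co 2 (x.1 + x.2) 0).card +
      4 * (Co 2 (x.1 + x.2) 16).card + (Co 2 (x.1 + x.2) 24).card) =
      ∑ x ∈ Wd 3 6 16 ×ˢ Wd 3 6 16, 16 := by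
    rw [Finset.sum_add_distrib, Finset.sum_add_distrib, ← Finset.mul_sum, ← Finset.mul_sum, h0, h1,
      h2, Finset.sum_const, Finset.card_product, card_Wd_three_six_sixteen]
    norm_num
  exact (Finset.sum_eq_sum_iff_of_le hle).1 h3 (u, v) (Finset.mem_product.2 ⟨hu, hv⟩)

theorem Tri_two_six_thirtytwo : Tri 2 6 16 16 32 = 673769376 := by
  have h0 : Tri 2 6 16 16 0 = 2604 * 4 := by
    rw [Tri_comm_right, Tri_zero, sum_Co_two_six_sixteen]; norm_num
  obtain ⟨h1, h2, -⟩ := Tri_two_six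
  rw [Tri, sum_pairs_six] at *
  have h3 : ∀ x ∈ Wd 3 6 16 ×ˢ Wd 3 6 16, (Co 2 (x.1 + x.2) 32).card =
      126 * (Co 2 (x.1 + x.2) 0).card + 30 * (Co 2 (x.1 + x.2) 16).card +
        6 * (Co 2 (x.1 + x.2) 24).card := by
    intro x hx
    obtain ⟨h1, h2⟩ := Finset.mem_product.1 hx
    have := card_Co_six_cases ((mem_Wd.1 h1).1.add (mem_Wd.1 h2).1)
    have := card_Co_pair h1 h2
    omega
  rw [Finset.sum_congr rfl h3, Finset.sum_add_distrib, Finset.sum_add_distrib, ← Finset.mul_sum,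
    ← Finset.mul_sum, ← Finset.mul_sum, h0, h1, h2]
  norm_num

/-! ### Words with a period -/

theorem lo_act_eq_hi {f : BF (n + 1)} {E : GLn (n + 1)} (h : der (E (pcons 1 0)) f = 0) :
    lo (act E f) = hi (act E f) := by
  funext x
  have h1 := congrFun h (E (pcons 0 x))
  simp only [der, Pi.zero_apply, ← map_add, pcons_add, zero_add, add_zero] at h1
  exact (CharTwo.add_eq_zero.1 h1).symm

theorem cst_glue_self {b : Pt n} (h : Cst f b) : Cst (glue f f) (pcons 0 b) := by
  obtain ⟨c, hc⟩ := h
  refine ⟨c, fun x hx => ?_⟩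
  rw [← pcons_ptail x, dot_pcons, zero_mul, zero_add]
  refine hc _ ?_
  simpa [glue] using hx

theorem zc₂_glue_self (h : zc₂ (glue f f) (glue g g) = 0) : zc₂ f g = 0 := by
  rw [zc₂_eq_zero] at *
  intro b hb ⟨h1, h2⟩
  refine h (pcons 0 b) (fun h0 => hb ?_) ⟨cst_glue_self h1, cst_glue_self h2⟩
  rw [← pcons_zero] at h0
  funext i
  have := congrFun h0 i.succ
  simpa [pcons] using this

theorem exists_common_period {k' : ℕ} (hf : Deg k f) (hw : 2 ^ k * wt f = 2 ^ (n + 1))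
    (hg : Deg k' g) (hw' : 2 ^ k' * wt g = 2 ^ (n + 1)) (h : 1 < wt (f * g)) :
    ∃ e, e ≠ 0 ∧ der e f = 0 ∧ der e g = 0 := by
  obtain ⟨x, hx, y, hy, hxy⟩ := Finset.one_lt_card.1 h
  simp only [Finset.mem_filter, Finset.mem_univ, true_and, Pi.mul_apply] at hx hy
  have key : ∀ a b : ZMod 2, a * b = 1 → a = 1 ∧ b = 1 := by decide
  refine ⟨x + y, fun h0 => hxy ?_, min_period hf hw (key _ _ hx).1 (key _ _ hy).1,
    min_period hg hw' (key _ _ hx).2 (key _ _ hy).2⟩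
  exact (pi_add_eq_zero.1 h0)

/-- Restriction to the two sides of an affine hyperplane. -/
theorem exists_sides {ℓ : BF (n + 1)} (hl : Deg 2 ℓ) (h0 : ℓ ≠ 0) (h1 : ℓ ≠ 1) :
    ∃ r : BF (n + 1) → BF n, (∀ f g, r (f + g) = r f + r g) ∧ (∀ k f, Deg k f → Deg k (r f)) ∧
      (∀ f, wt (f * (ℓ + 1)) = wt (r f)) ∧
      ∃ r' : BF (n + 1) → BF n, (∀ k f, Deg (k + 1) f → Deg k (r f + r' f)) ∧
        ∀ f, wt f = wt (r f) + wt (r' f) := by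
  obtain ⟨l, c, rfl⟩ := deg_two_iff.1 hl
  have hl0 : l ≠ 0 := by
    rintro rfl
    rw [lin_zero, zero_add] at h0 h1
    rcases zmod2_cases c with rfl | rfl
    · exact h0 rfl
    · exact h1 rfl
  have key : ∀ f : BF (n + 1), wt (f * lin l) = wt (hi (act (tr l) f)) ∧
      wt f = wt (lo (act (tr l) f)) + wt (hi (act (tr l) f)) := by
    intro f
    have h2 := S_tr hl0 f
    have h3 := wt_halves (act (tr l) f)
    rw [wt_act] at h3
    rw [S_eq] at h2
    omega
  have h4 := fun f => wt_mul_add_wt_mul f (lin l)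
  rcases zmod2_cases c with rfl | rfl
  · refine ⟨fun f => lo (act (tr l) f), fun f g => rfl, fun k f hf => ((deg_act _ f).2 hf).lo,
      fun f => ?_, fun f => hi (act (tr l) f), fun k f hf => ((deg_act _ f).2 hf).lo_add_hi,
      fun f => (key f).2⟩
    have h5 := key f
    have h6 := h4 f
    show _ = wt (lo (act (tr l) f))
    rw [show (lin l + cst 0 : BF (n + 1)) = lin l from add_zero _]
    omega
  · refine ⟨fun f => hi (act (tr l) f), fun f g => rfl, fun k f hf => ((deg_act _ f).2 hf).hi,
      fun f => ?_, fun f => lo (act (tr l) f), fun k f hf => ?_, fun f => ?_⟩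
    · rw [show (lin l + cst 1 + 1 : BF (n + 1)) = lin l by
        rw [add_assoc, show (cst 1 : BF (n + 1)) = 1 from rfl, pi_add_self, add_zero]]
      exact (key f).1
    · rw [add_comm]; exact ((deg_act _ f).2 hf).lo_add_hi
    · have h5 := (key f).2
      show wt f = wt (hi (act (tr l) f)) + wt (lo (act (tr l) f))
      omega

theorem wt_ne_fourteen {p : BF 5} (hp : Deg 3 p) : wt p ≠ 14 := by
  have := wt_three_five hp
  omega

/-- A word in a coset of a periodic function is periodic, unless it has large weight. -/
theorem lo_eq_hi_of_glue_self {s : BF 6} (hs : Deg 4 s) (hw14 : wt s = 14) {w : BF 7}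
    (hw : Deg 3 (glue s s + w)) : lo w = hi w ∨ wt w = 64 ∨ 36 < wt w := by
  rw [← glue_lo_hi w, glue_add, deg_glue] at hw
  obtain ⟨hw1, hw2⟩ := hw
  rw [show s + lo w + (s + hi w) = lo w + hi w by
    rw [add_add_add_comm, pi_add_self, zero_add]] at hw2
  have e : hi w = lo w + (lo w + hi w) := (pi_add_add_cancel _ _).symm
  have hwt := wt_halves w
  by_cases h0 : lo w + hi w = 0
  · exact Or.inl (pi_add_eq_zero.1 h0)
  right
  by_cases h1 : lo w + hi w = 1
  · left
    rw [h1] at e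
    rw [hwt, e, add_comm, wt_add_one]; norm_num
  right
  obtain ⟨r, hr1, hr2, hr3, r', hr4, hr5⟩ := exists_sides hw2 h0 h1
  have h2 := wt_add (lo w) (lo w + hi w)
  have h3 := wt_mul_add_wt_mul (lo w) (lo w + hi w)
  rw [← e] at h2
  have h4 := (wt_deg_two hw2).resolve_left (fun h => h0 (wt_eq_zero.1 h))
  have h5 := h4.resolve_right (fun h => h1 ?_)
  · rw [hr3] at h3
    have hlw : Deg 4 (lo w) := (hs.add_iff_right).1 hw1.succ
    have h6 := min_wt_four (k := 4) (hr2 4 _ hlw)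
    rcases h6 with h6 | h6
    · exfalso
      have h7 : Deg 3 (r s) := by
        have := hr2 3 _ hw1
        rwa [hr1, wt_eq_zero.1 h6, add_zero] at this
      have h8 : Deg 3 (r' s) := (h7.add_iff_right).1 (hr4 3 s hs)
      have h9 := hr5 s
      have := wt_three_five h7
      have := wt_three_five h8
      omega
    · norm_num at h5
      omega
  · have := wt_add_one (lo w + hi w)
    have h0 : lo w + hi w + 1 = 0 := wt_eq_zero.1 (by omega)
    exact pi_add_eq_zero.1 h0

theorem wt_add_mod_four {s g : BF 6} (hs : Deg 4 s) (hg : Deg 3 g) :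
    wt (s + g) % 4 = wt s % 4 := by
  have h1 := wt_add s g
  have h2 := four_dvd_wt hg (by norm_num) (by norm_num)
  have h3 : Deg 6 (s * g) := Deg.mul hs hg
  have h4 := two_dvd_wt h3
  omega

/-- Two minimum weight words without common constant functional. -/
theorem Co_eq_empty_of_zc₂ {u v : BF 7} (hu : u ∈ Wd 4 7 16) (hv : v ∈ Wd 4 7 16)
    (h : zc₂ u v = 0) : Co 3 (u + v) 32 = ∅ := by
  obtain ⟨hu1, hu2⟩ := mem_Wd.1 hu
  obtain ⟨hv1, hv2⟩ := mem_Wd.1 hv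
  have hu3 : 2 ^ 4 * wt u = 2 ^ (7 + 1) := by rw [hu2]; norm_num
  have hv3 : 2 ^ 4 * wt v = 2 ^ (7 + 1) := by rw [hv2]; norm_num
  have h1 := wt_mul_of_min hu1 hu3 hv1 hv3 h
  rw [hu2, hv2] at h1
  obtain ⟨e, he, heu, hev⟩ := exists_common_period hu1 hu3 hv1 hv3 (by omega)
  obtain ⟨E, hE⟩ := exists_first_vector he
  rw [Finset.eq_empty_iff_forall_notMem]
  intro w hw
  obtain ⟨hw1, hw2⟩ := mem_Co.1 hw
  rw [← hE] at heu hev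
  have hlu := lo_act_eq_hi heu
  have hlv := lo_act_eq_hi hev
  have hau : act E u = glue (lo (act E u)) (lo (act E u)) := by
    conv_lhs => rw [← glue_lo_hi (act E u), ← hlu]
  have hav : act E v = glue (lo (act E v)) (lo (act E v)) := by
    conv_lhs => rw [← glue_lo_hi (act E v), ← hlv]
  have hz : zc₂ (lo (act E u)) (lo (act E v)) = 0 := by
    refine zc₂_glue_self ?_
    rw [← hau, ← hav, zc₂_act, h]
  have hdu : Deg 4 (lo (act E u)) := ((deg_act E u).2 hu1).lo
  have hdv : Deg 4 (lo (act E v)) := ((deg_act E v).2 hv1).lo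
  have hwu : wt (lo (act E u)) = 8 := by
    have := wt_act E u
    rw [hau, wt_glue] at this
    omega
  have hwv : wt (lo (act E v)) = 8 := by
    have := wt_act E v
    rw [hav, wt_glue] at this
    omega
  have hdw : Deg 3 (act E u + act E v + act E w) := by
    rw [← act_add, ← act_add, deg_act]; exact hw1
  rw [hau, hav, glue_add] at hdw
  generalize lo (act E u) = p at *
  generalize lo (act E v) = q at *
  have h2 := wt_mul_of_min hdu (by rw [hwu]; norm_num) hdv (by rw [hwv]; norm_num) hz
  have h3 := wt_add p q
  rw [hwu, hwv] at h2 h3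
  have hs : Deg 4 (p + q) := hdu.add hdv
  have h4 := lo_eq_hi_of_glue_self hs (by omega) hdw
  rw [wt_act, hw2] at h4
  have h5 := h4.resolve_right (by omega)
  have h6 := wt_halves (act E w)
  rw [wt_act, hw2, ← h5] at h6
  have h7 := (deg_glue.1 (by rwa [← glue_lo_hi (act E w), glue_add] at hdw)).1
  have h8 := wt_add_mod_four hs h7
  rw [pi_add_add_cancel] at h8
  omega

/-- Two functions with a common constant functional, restricted to a half space. -/
theorem common_halves {f g : BF (n + 1)} (hf : Deg (k + 2) f) (hg : Deg (k + 2) g)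
    (h : zc₂ f g ≠ 0) : ∃ (E : GLn (n + 1)) (c d : BF n), Deg (k + 1) c ∧ Deg (k + 1) d ∧
      wt c = wt f ∧ wt d = wt g ∧ zc₂ f g = 1 + 2 * zc₂ c d ∧
      Deg (k + 1) (act E (f + g) + glue 0 (c + d)) := by
  rw [Ne, zc₂_eq_zero] at h
  push Not at h
  obtain ⟨a, ha, hfa, hga⟩ := h
  rw [cst_tr ha] at hfa hga
  have key : ∀ f : BF (n + 1), Deg (k + 2) f → lo (act (tr a) f) = 0 ∨ hi (act (tr a) f) = 0 →
      Deg (k + 1) (lo (act (tr a) f) + hi (act (tr a) f)) ∧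
      wt (lo (act (tr a) f) + hi (act (tr a) f)) = wt f ∧
      Deg (k + 1) (act (tr a) f + glue 0 (lo (act (tr a) f) + hi (act (tr a) f))) := by
    intro f hf h
    have h1 := ((deg_act (tr a) f).2 hf).lo_add_hi
    have h2 := wt_halves (act (tr a) f)
    rw [wt_act] at h2
    refine ⟨h1, ?_, ?_⟩
    · rcases h with h | h
      · rw [h, zero_add, h2, h, wt_zero, zero_add]
      · rw [h, add_zero, h2, h, wt_zero, add_zero]
    · have h3 : Deg (k + 1) (lo (act (tr a) f)) := by
        rcases h with h | h
        · rw [h]; exact Deg.zero _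
        · rwa [h, add_zero] at h1
      conv => arg 2; arg 1; rw [← glue_lo_hi (act (tr a) f)]
      rw [glue_add, add_zero, add_comm (hi _), add_assoc, pi_add_self, add_zero, deg_glue,
        pi_add_self]
      exact ⟨h3, Deg.zero _⟩
  obtain ⟨h1, h2, h3⟩ := key f hf hfa
  obtain ⟨h4, h5, h6⟩ := key g hg hga
  refine ⟨tr a, _, _, h1, h4, h2, h5, ?_, ?_⟩
  · rw [← zc₂_of_half_zero hfa hga, zc₂_act]
  · have := h3.add h6
    rwa [add_add_add_comm, ← act_add, glue_add, add_zero] at this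

theorem deg_glue_zero {c : BF n} (hc : Deg k c) : Deg (k + 1) (glue 0 c) :=
  deg_glue.2 ⟨Deg.zero _, by rwa [zero_add]⟩

theorem deg_of_deg_act_add {E : GLn n} (h : Deg k (act E f + g)) (hg : Deg k g) : Deg k f :=
  (deg_act E f).1 ((hg.add_iff_left).1 h)

theorem zc₂_affine_five {c d : BF 5} (hc : c ∈ Wd 2 5 16) (hd : d ∈ Wd 2 5 16) :
    (zc₂ c d = 1 ∧ Deg 1 (c + d)) ∨ (zc₂ c d = 0 ∧ wt (c + d) = 16) := by
  obtain ⟨hc1, hc2⟩ := mem_Wd.1 hc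
  obtain ⟨hd1, hd2⟩ := mem_Wd.1 hd
  by_cases h : zc₂ c d = 0
  · refine Or.inr ⟨h, ?_⟩
    have h1 := wt_mul_of_min hc1 (by rw [hc2]; norm_num) hd1 (by rw [hd2]; norm_num) h
    have h2 := wt_add c d
    rw [hc2, hd2] at h1 h2
    omega
  · obtain ⟨E, x, y, hx, hy, hx', hy', hz, hD⟩ := common_halves (k := 0) hc1 hd1 h
    have h1 : ∀ x : BF 4, Deg 1 x → wt x = 16 → x = 1 := fun x hx hw =>
      (deg_one_cases hx).resolve_left (by rintro rfl; rw [wt_zero] at hw; omega)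
    obtain rfl := h1 x hx (by omega)
    obtain rfl := h1 y hy (by omega)
    have h2 := zc_of_min hx (by rw [hx', hc2]; norm_num)
    rw [hx', hc2, ← zc₂_self] at h2
    refine Or.inl ⟨by omega, deg_of_deg_act_add hD ?_⟩
    rw [pi_add_self]
    exact deg_glue_zero (Deg.zero _)

theorem zc₂_six {c d : BF 6} (hc : c ∈ Wd 3 6 16) (hd : d ∈ Wd 3 6 16) :
    (zc₂ c d = 3 ∧ (Co 2 (c + d) 0).Nonempty) ∨ (zc₂ c d = 1 ∧ (Co 2 (c + d) 16).Nonempty) ∨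
      (zc₂ c d = 0 ∧ (Co 2 (c + d) 24).Nonempty) := by
  obtain ⟨hc1, hc2⟩ := mem_Wd.1 hc
  obtain ⟨hd1, hd2⟩ := mem_Wd.1 hd
  by_cases h : zc₂ c d = 0
  · refine Or.inr (Or.inr ⟨h, c + d, mem_Co.2 ⟨?_, ?_⟩⟩)
    · rw [pi_add_self]; exact Deg.zero _
    have h1 := wt_mul_of_min hc1 (by rw [hc2]; norm_num) hd1 (by rw [hd2]; norm_num) h
    have h2 := wt_add c d
    rw [hc2, hd2] at h1 h2
    omega
  · obtain ⟨E, x, y, hx, hy, hx', hy', hz, hD⟩ := common_halves (k := 1) hc1 hd1 h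
    rcases zc₂_affine_five (mem_Wd.2 ⟨hx, by omega⟩) (mem_Wd.2 ⟨hy, by omega⟩) with
      ⟨h1, h2⟩ | ⟨h1, h2⟩
    · refine Or.inl ⟨by omega, 0, mem_Co.2 ⟨?_, wt_zero⟩⟩
      rw [add_zero]
      exact deg_of_deg_act_add hD (deg_glue_zero h2)
    · refine Or.inr (Or.inl ⟨by omega, ?_⟩)
      rw [← Finset.card_pos, ← card_Co_act E, Finset.card_pos]
      exact ⟨_, mem_Co.2 ⟨hD, by rw [wt_glue, wt_zero, h2]⟩⟩

theorem card_Co_glue_zero {f : BF 6} (hf : Deg 3 f) : (Co 3 (glue 0 f) 32).card =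
    2 * (Co 2 f 32).card + ∑ p ∈ Wd 3 6 16, (Co 2 (f + p) 16).card := by
  have hN : ∀ s ∉ ({0, 16, 32} : Finset ℕ), 2 * s < 32 → Wd 3 6 s = ∅ := by
    intro s hs hs'
    have : s < 16 := by omega
    interval_cases s <;> first | exact absurd (by decide) hs | skip
    all_goals exact Wd_three_eq_empty 6 _ (by decide) (by decide)
  have hc := fun s t => sum_Co_comm 2 s t f hf
  have h0 : ∑ p ∈ Wd 3 6 0, (Co 2 (f + p) 32).card = (Co 2 f 32).card := by
    rw [Wd_zero, Finset.sum_singleton, add_zero]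
  rw [card_Co_split, lo_glue, hi_glue]
  simp only [zero_add]
  rw [← Finset.sum_subset (s₁ := {0, 16, 32}) (by decide)]
  · rw [Finset.sum_insert (by decide), Finset.sum_insert (by decide), Finset.sum_singleton]
    simp only [Nat.sub_zero, Nat.sub_self, show 32 - 16 = 16 from rfl]
    rw [hc 32 0, h0]
    ring
  · intro s hs hs'
    rw [Finset.mem_range] at hs
    by_cases h : 2 * s < 32
    · exact Finset.sum_eq_zero fun p hp =>
        absurd hp (by rw [show Co (2 + 1) 0 s = ∅ from hN s hs' h]; simp)
    · have h' : 32 - s ∉ ({0, 16, 32} : Finset ℕ) := by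
        simp only [Finset.mem_insert, Finset.mem_singleton] at hs' ⊢; omega
      rw [hc, hN _ h' (by simp only [Finset.mem_insert, Finset.mem_singleton] at hs'; omega),
        Finset.sum_empty]

theorem card_Co_glue_zero_mul {c d : BF 6} (hc : c ∈ Wd 3 6 16) (hd : d ∈ Wd 3 6 16) :
    21 / (1 + 2 * zc₂ c d) * (Co 3 (glue 0 (c + d)) 32).card = 32004 * (Co 2 (c + d) 0).card +
      2940 * (Co 2 (c + d) 16).card + 672 * (Co 2 (c + d) 24).card := by
  have hcd := (mem_Wd.1 hc).1.add (mem_Wd.1 hd).1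
  have hz := zc₂_six hc hd
  rw [card_Co_glue_zero hcd]
  have h1 : ∀ s, (Co 2 (c + d) s).Nonempty → ∃ w ∈ Wd 3 6 s,
      ∑ p ∈ Wd 3 6 16, (Co 2 (c + d + p) 16).card = ∑ p ∈ Wd 3 6 16, (Co 2 (w + p) 16).card := by
    rintro s ⟨w, hw⟩
    obtain ⟨hw1, hw2⟩ := mem_Co.1 hw
    refine ⟨w, mem_Wd.2 ⟨(hcd.add_iff_right).1 hw1.succ, hw2⟩, ?_⟩
    refine Finset.sum_congr rfl fun p _ => ?_
    rw [Co_congr]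
    rwa [add_add_add_comm, pi_add_self, add_zero]
  have h0 := card_Co_six_cases hcd
  rcases hz with ⟨hz, hn⟩ | ⟨hz, hn⟩ | ⟨hz, hn⟩ <;> obtain ⟨w, hw, e⟩ := h1 _ hn <;>
    rw [← Finset.card_pos] at hn <;> rw [e, hz]
  · rw [Wd_zero, Finset.mem_singleton] at hw
    simp only [hw, zero_add]
    rw [sum_Co_two_six_sixteen]
    norm_num
    omega
  · rw [sum_card_Co_of_wt_sixteen hw]
    norm_num
    omega
  · rw [(sum_card_Co_of_wt_twentyfour hw).1]
    norm_num
    omega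

theorem zc₂_mul_card {u v : BF 7} (hu : u ∈ Wd 4 7 16) (hv : v ∈ Wd 4 7 16) :
    zc₂ u v * (21 / zc₂ u v * (Co 3 (u + v) 32).card) = 21 * (Co 3 (u + v) 32).card := by
  by_cases h : zc₂ u v = 0
  · rw [Co_eq_empty_of_zc₂ hu hv h, Finset.card_empty]; simp
  · obtain ⟨hu1, hu2⟩ := mem_Wd.1 hu
    obtain ⟨hv1, hv2⟩ := mem_Wd.1 hv
    obtain ⟨E, x, y, hx, hy, hx', hy', hz, -⟩ := common_halves (k := 2) hu1 hv1 h
    rw [← mul_assoc, hz]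
    congr 1
    rcases zc₂_six (mem_Wd.2 ⟨hx, by omega⟩) (mem_Wd.2 ⟨hy, by omega⟩) with
      ⟨h, -⟩ | ⟨h, -⟩ | ⟨h, -⟩ <;> norm_num [h]

open scoped Classical in
theorem zc₂_eq_sum (f g : BF n) :
    zc₂ f g = ∑ a ∈ nz n, if Cst f a ∧ Cst g a then 1 else 0 := by
  rw [zc₂, Finset.card_filter]

open scoped Classical in
/-- Counting triples of two words and a common constant functional. -/
theorem sum_zc₂_mul {s t : ℕ} (hs : s ≠ 0) (ht : t ≠ 0) (H : BF (n + 1) → BF (n + 1) → ℕ)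
    (hH : ∀ E u v, H (act E u) (act E v) = H u v) :
    ∑ u ∈ Wd (k + 1) (n + 1) s, ∑ v ∈ Wd (k + 1) (n + 1) t, zc₂ u v * H u v =
      (nz (n + 1)).card * ∑ c ∈ Wd k n s, ∑ d ∈ Wd k n t,
        (H (glue 0 c) (glue 0 d) + H (glue 0 c) (glue d 0) +
          (H (glue c 0) (glue 0 d) + H (glue c 0) (glue d 0))) := by
  have h1 : ∀ u v : BF (n + 1), zc₂ u v * H u v =
      ∑ a ∈ nz (n + 1), if Cst u a then (if Cst v a then H u v else 0) else 0 := by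
    intro u v
    rw [zc₂_eq_sum, Finset.sum_mul]
    refine Finset.sum_congr rfl fun a _ => ?_
    rw [ite_mul, one_mul, zero_mul, ite_and]
  simp only [h1]
  simp_rw [Finset.sum_comm (t := nz (n + 1))]
  rw [← smul_eq_mul, ← Finset.sum_const]
  refine Finset.sum_congr rfl fun a ha => ?_
  rw [mem_nz] at ha
  have h2 : ∀ u : BF (n + 1), ∑ v ∈ Wd (k + 1) (n + 1) t, (if Cst u a then (if Cst v a then H u v
      else 0) else 0) = if Cst u a then ∑ v ∈ (Wd (k + 1) (n + 1) t).filter (Cst · a), H u v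
      else 0 := by
    intro u
    split_ifs
    · rw [Finset.sum_filter]
    · simp
  rw [Finset.sum_congr rfl fun u _ => h2 u, ← Finset.sum_filter,
    sum_Wd_cst hs ha _ (fun u => ∑ d ∈ Wd k n t, (H u (glue 0 d) + H u (glue d 0)))]
  · simp only [← Finset.sum_add_distrib]
  · intro w _
    exact sum_Wd_cst ht ha _ (fun v => H (act (tr a) w) v) fun v _ => (hH _ _ _).symm

theorem Tri_three_seven : Tri 3 7 16 16 32 = 1791876479232 := by
  have h := sum_zc₂_mul (k := 3) (n := 6) (s := 16) (t := 16) (by norm_num) (by norm_num)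
    (fun u v => 21 / zc₂ u v * (Co 3 (u + v) 32).card) fun E u v => by
      rw [← act_add, zc₂_act, card_Co_act]
  have e1 : 21 * Tri 3 7 16 16 32 = ∑ u ∈ Wd 4 7 16, ∑ v ∈ Wd 4 7 16,
      zc₂ u v * (21 / zc₂ u v * (Co 3 (u + v) 32).card) := by
    rw [Tri, Finset.mul_sum]
    refine Finset.sum_congr rfl fun u hu => ?_
    rw [Finset.mul_sum]
    exact Finset.sum_congr rfl fun v hv => (zc₂_mul_card hu hv).symm
  have e2 : ∀ c ∈ Wd 3 6 16, ∀ d ∈ Wd 3 6 16, ∀ u v : BF 7, (u = glue 0 c ∨ u = glue c 0) →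
      (v = glue 0 d ∨ v = glue d 0) → 21 / zc₂ u v * (Co 3 (u + v) 32).card =
      32004 * (Co 2 (c + d) 0).card + 2940 * (Co 2 (c + d) 16).card +
        672 * (Co 2 (c + d) 24).card := by
    intro c hc d hd u v hu hv
    rw [← card_Co_glue_zero_mul hc hd]
    have hc1 := (mem_Wd.1 hc).1
    have hd1 := (mem_Wd.1 hd).1
    have hu' : lo u = 0 ∨ hi u = 0 := by rcases hu with rfl | rfl <;> simp
    have hv' : lo v = 0 ∨ hi v = 0 := by rcases hv with rfl | rfl <;> simp
    have hcu : lo u + hi u = c := by rcases hu with rfl | rfl <;> simp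
    have hdv : lo v + hi v = d := by rcases hv with rfl | rfl <;> simp
    rw [zc₂_of_half_zero hu' hv', hcu, hdv]
    congr 2
    refine Co_congr ?_ 32
    rw [← glue_lo_hi (u + v), glue_add, add_zero, lo_add, hi_add, deg_glue]
    have e : lo u + lo v + (hi u + hi v + (c + d)) = 0 := by
      rw [← hcu, ← hdv]
      rw [← pi_add_self (lo u + lo v + (hi u + hi v))]
      ring
    rw [e]
    refine ⟨Deg.add ?_ ?_, Deg.zero _⟩
    · rcases hu with rfl | rfl
      · rw [lo_glue]; exact Deg.zero _
      · rwa [lo_glue]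
    · rcases hv with rfl | rfl
      · rw [lo_glue]; exact Deg.zero _
      · rwa [lo_glue]
  have h3 : ∀ t, Tri 2 6 16 16 t = ∑ c ∈ Wd 3 6 16, ∑ d ∈ Wd 3 6 16, (Co 2 (c + d) t).card :=
    fun t => rfl
  have e4 : ∑ c ∈ Wd 3 6 16, ∑ d ∈ Wd 3 6 16,
      (32004 * (Co 2 (c + d) 0).card + 2940 * (Co 2 (c + d) 16).card +
        672 * (Co 2 (c + d) 24).card) = 32004 * Tri 2 6 16 16 0 + 2940 * Tri 2 6 16 16 16 +
        672 * Tri 2 6 16 16 24 := by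
    simp only [h3, Finset.mul_sum, Finset.sum_add_distrib]
  have h0 : Tri 2 6 16 16 0 = 2604 * 4 := by
    rw [Tri_comm_right, Tri_zero, sum_Co_two_six_sixteen]; norm_num
  have e5 : (nz (6 + 1)).card + 1 = 2 ^ 7 := card_nz 7
  have e6 := (e1.trans h).trans (congrArg ((nz (6 + 1)).card * ·) ((Finset.sum_congr rfl
    fun c hc => (Finset.sum_congr rfl fun d hd => show _ =
    4 * (32004 * (Co 2 (c + d) 0).card + 2940 * (Co 2 (c + d) 16).card +
        672 * (Co 2 (c + d) 24).card) by
      rw [e2 c hc d hd _ _ (Or.inl rfl) (Or.inl rfl), e2 c hc d hd _ _ (Or.inl rfl) (Or.inr rfl),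
        e2 c hc d hd _ _ (Or.inr rfl) (Or.inl rfl), e2 c hc d hd _ _ (Or.inr rfl) (Or.inr rfl)]
      ring).trans (Finset.mul_sum _ _ _).symm).trans
        ((Finset.mul_sum _ _ _).symm.trans (congrArg (4 * ·) e4))))
  clear h e1 e4
  generalize Tri 3 7 16 16 32 = T at e6 ⊢
  rw [h0, Tri_two_six.1, Tri_two_six.2.1, show (nz (6 + 1)).card = 127 by omega] at e6
  omega

theorem pi_add_add_cancel_right (x y : Pt n) : x + y + y = x := by
  rw [add_assoc, pi_add_self, add_zero]

/-- An affine change of variables. -/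
def aff (E : GLn n) (t : Pt n) : BF n ≃ BF n where
  toFun f := fun x => f (E x + t)
  invFun f := fun x => f (E.symm (x + t))
  left_inv f := by funext x; simp [pi_add_add_cancel_right]
  right_inv f := by funext x; simp [pi_add_add_cancel_right]

theorem aff_apply (E : GLn n) (t : Pt n) (f : BF n) (x : Pt n) : aff E t f x = f (E x + t) := rfl

theorem aff_add (E : GLn n) (t : Pt n) (f g : BF n) :
    aff E t (f + g) = aff E t f + aff E t g := rfl

theorem aff_aff (E E' : GLn n) (t t' : Pt n) (f : BF n) :
    aff E' t' (aff E t f) = aff (E'.trans E) (E t' + t) f := by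
  funext x
  simp [aff_apply, add_assoc]

theorem aff_zero_right (E : GLn n) (f : BF n) : aff E 0 f = act E f := by
  funext x
  rw [aff_apply, add_zero]; rfl

theorem deg_aff (E : GLn n) (t : Pt n) (f : BF n) : Deg k (aff E t f) ↔ Deg k f := by
  refine ⟨fun h => ?_, fun h => h.comp (fun x => E x + t) E fun x e => ?_⟩
  · have := h.comp (fun x => E.symm (x + t)) E.symm fun x e => by simp [add_right_comm]
    convert this
    funext x
    simp [aff_apply, pi_add_add_cancel_right]
  · rw [map_add, add_right_comm]

theorem wt_aff (E : GLn n) (t : Pt n) (f : BF n) : wt (aff E t f) = wt f :=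
  wt_comp f (E.toEquiv.trans (Equiv.addRight t))

theorem zc_ne_zero_of_aff {E : GLn n} {t : Pt n} (h : zc (aff E t f) ≠ 0) : zc f ≠ 0 := by
  rw [← Nat.pos_iff_ne_zero, zc_pos] at *
  obtain ⟨a, ha, c, hc⟩ := h
  refine ⟨adj E.symm a, fun h => ha ((adj_eq_zero _).1 h), c + a ⬝ᵥ E.symm t, fun x hx => ?_⟩
  rw [adj_dot, ← hc (E.symm (x + t)) (by simpa [aff_apply, pi_add_add_cancel_right] using hx),
    map_add, dotProduct_add, add_assoc, CharTwo.add_self_eq_zero, add_zero]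

theorem der_of_aff {E : GLn n} {t e : Pt n} (h : der e (aff E t f) = 0) : der (E e) f = 0 := by
  funext x
  have := congrFun h (E.symm (x + t))
  simpa [der, aff_apply, pi_add_add_cancel_right, add_right_comm] using this

/-- A linear change of variables that preserves the first coordinate. -/
def blk (E : GLn n) (z : Pt n) : GLn (n + 1) where
  toFun x := pcons (x 0) (E (ptail x + x 0 • z))
  map_add' x y := by
    rw [pcons_add, ← map_add]
    congr 2
    rw [show ptail (x + y) = ptail x + ptail y from rfl, Pi.add_apply, add_smul]
    abel
  map_smul' c x := by
    have : ∀ (c s : ZMod 2) (y : Pt n), c • pcons s y = pcons (c * s) (c • y) := by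
      intro c s y
      funext i
      refine Fin.cases ?_ (fun i => ?_) i <;> simp [pcons]
    rw [RingHom.id_apply, this, ← map_smul]
    congr 2
    rw [smul_add, smul_smul]
    rfl
  invFun x := pcons (x 0) (E.symm (ptail x) + x 0 • z)
  left_inv x := by
    simp only [pcons, ptail, Fin.cons_zero, Fin.tail_cons, LinearEquiv.symm_apply_apply,
      pi_add_add_cancel_right]
    exact pcons_ptail x
  right_inv x := by
    simp only [pcons, ptail, Fin.cons_zero, Fin.tail_cons, LinearEquiv.apply_symm_apply,
      pi_add_add_cancel_right]
    exact pcons_ptail x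

theorem blk_pcons (E : GLn n) (z y : Pt n) (c : ZMod 2) :
    blk E z (pcons c y) = pcons c (E (y + c • z)) := rfl

theorem lo_aff_blk (E : GLn n) (t : Pt n) (f : BF (n + 1)) :
    lo (aff (blk E 0) (pcons 0 t) f) = aff E t (lo f) := by
  funext x
  simp only [lo, aff_apply, blk_pcons, pcons_add, smul_zero, add_zero]

theorem hi_aff_blk (E : GLn n) (t : Pt n) (f : BF (n + 1)) :
    hi (aff (blk E 0) (pcons 0 t) f) = aff E t (hi f) := by
  funext x
  simp only [hi, aff_apply, blk_pcons, pcons_add, smul_zero, add_zero]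

/-- A function one of whose halves has a constant functional has a vanishing quarter after an
affine change of variables. -/
theorem exists_quarters {f : BF (n + 2)} (hf : Deg (k + 1) f) {a : Pt (n + 2)} (ha : a ≠ 0)
    {s : ℕ} (h : S f a ^ 2 = (wt f - 2 * s : ℤ) ^ 2)
    (hz : ∀ p : BF (n + 1), Deg (k + 1) p → wt p = s → zc p ≠ 0) :
    ∃ (E : GLn (n + 2)) (t : Pt (n + 2)) (p q r : BF n),
      aff E t f = glue (glue 0 p) (glue q r) ∧ wt p = s ∧
      ∀ g, S g a ^ 2 = (wt (lo (aff E t g)) - wt (hi (aff E t g)) : ℤ) ^ 2 := by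
  have h1 : ∃ c, ∀ E t, E = tr a → t = tr a (pcons c 0) → wt (lo (aff E t f)) = s ∧
      ∀ g, S g a ^ 2 = (wt (lo (aff E t g)) - wt (hi (aff E t g)) : ℤ) ^ 2 := by
    have e0 : ∀ g, lo (aff (tr a) (tr a (pcons 0 0)) g) = lo (act (tr a) g) ∧
        hi (aff (tr a) (tr a (pcons 0 0)) g) = hi (act (tr a) g) := by
      intro g
      rw [pcons_zero, map_zero, aff_zero_right]
      exact ⟨rfl, rfl⟩
    have e1 : ∀ g, lo (aff (tr a) (tr a (pcons 1 0)) g) = hi (act (tr a) g) ∧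
        hi (aff (tr a) (tr a (pcons 1 0)) g) = lo (act (tr a) g) := by
      intro g
      constructor <;> funext x <;>
        simp only [lo, hi, aff_apply, ← map_add, pcons_add, add_zero, zero_add] <;> rfl
    have hw := wt_halves (act (tr a) f)
    rw [wt_act] at hw
    rw [S_tr ha, sq_eq_sq_iff_eq_or_eq_neg] at h
    rcases h with h | h
    · refine ⟨1, ?_⟩
      rintro _ _ rfl rfl
      refine ⟨by rw [(e1 f).1]; omega, fun g => ?_⟩
      rw [(e1 g).1, (e1 g).2, S_tr ha]; ring
    · refine ⟨0, ?_⟩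
      rintro _ _ rfl rfl
      refine ⟨by rw [(e0 f).1]; omega, fun g => ?_⟩
      rw [(e0 g).1, (e0 g).2, S_tr ha]
  obtain ⟨c, hc⟩ := h1
  obtain ⟨h1, h2⟩ := hc _ _ rfl rfl
  generalize tr a = E, tr a (pcons c 0) = t at h1 h2
  have h3 := hz _ ((deg_aff E t f).2 hf).lo h1
  rw [← Nat.pos_iff_ne_zero, zc_pos] at h3
  obtain ⟨b, hb, hb'⟩ := h3
  rw [cst_tr hb] at hb'
  have h4 : ∃ d, lo (aff (tr b) d (lo (aff E t f))) = 0 := by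
    rcases hb' with h | h
    · exact ⟨0, by rwa [aff_zero_right]⟩
    · refine ⟨tr b (pcons 1 0), ?_⟩
      rw [← h]
      funext x
      simp only [lo, hi, aff_apply, ← map_add, pcons_add, add_zero, zero_add]
      rfl
  obtain ⟨d, hd⟩ := h4
  have h6 := fun g => lo_aff_blk (tr b) d (aff E t g)
  have h7 := fun g => hi_aff_blk (tr b) d (aff E t g)
  simp only [aff_aff] at h6 h7
  refine ⟨(blk (tr b) 0).trans E, E (pcons 0 d) + t, hi (aff (tr b) d (lo (aff E t f))),
    lo (aff (tr b) d (hi (aff E t f))),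
    hi (aff (tr b) d (hi (aff E t f))), ?_, ?_, fun g => ?_⟩
  · rw [glue_lo_hi, ← h7 f, ← hd, glue_lo_hi, ← h6 f, glue_lo_hi]
  · rw [← h1, ← wt_aff (tr b) d, wt_halves (aff (tr b) d _), hd, wt_zero, zero_add]
  · rw [h2, h6, h7, wt_aff, wt_aff]

/-- The degrees of the quarters. -/
theorem deg_quarters {p q r : BF n} (h : Deg (k + 2) (glue (glue 0 p) (glue q r))) :
    Deg (k + 1) p ∧ Deg (k + 1) q ∧ Deg (k + 1) r ∧ Deg k (p + q + r) := by
  have h1 := h.lo.lo_add_hi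
  have h2 := h.lo_add_hi
  simp only [lo_glue, hi_glue, zero_add, glue_add] at h1 h2
  obtain ⟨h3, h4⟩ := deg_glue.1 h2
  refine ⟨h1, h3, ?_, by rwa [add_comm p q, add_assoc]⟩
  have h5 := (h3.add_iff_right).1 h4.succ
  exact (h1.add_iff_right).1 h5

theorem zc_quarters {p q r : BF n} (a : Pt n) (c₁ c₂ c₃ : ZMod 2)
    (hp : ∀ x, p x = 1 → a ⬝ᵥ x = c₁) (hq : ∀ x, q x = 1 → a ⬝ᵥ x = c₂)
    (hr : ∀ x, r x = 1 → a ⬝ᵥ x = c₃) (h : a ≠ 0 ∨ c₁ ≠ c₃ ∨ c₂ ≠ c₃) :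
    zc (glue (glue 0 p) (glue q r)) ≠ 0 := by
  rw [← Nat.pos_iff_ne_zero, zc_pos]
  refine ⟨pcons (c₁ + c₃) (pcons (c₂ + c₃) a), fun h0 => ?_, c₁ + c₂ + c₃, ?_⟩
  · have e1 : c₁ + c₃ = 0 := by have := congrFun h0 0; simpa [pcons] using this
    have e2 : c₂ + c₃ = 0 := by have := congrFun h0 1; simpa [pcons] using this
    have e3 : a = 0 := by
      funext i
      have := congrFun h0 i.succ.succ
      simpa [pcons] using this
    rw [CharTwo.add_eq_zero] at e1 e2
    tauto
  · simp only [forall_pcons, dot_pcons]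
    have key : ∀ c₁ c₂ c₃ : ZMod 2, (c₁ + c₃) * 0 + ((c₂ + c₃) * 1 + c₁) = c₁ + c₂ + c₃ ∧
      (c₁ + c₃) * 1 + ((c₂ + c₃) * 0 + c₂) = c₁ + c₂ + c₃ ∧
      (c₁ + c₃) * 1 + ((c₂ + c₃) * 1 + c₃) = c₁ + c₂ + c₃ := by decide
    refine ⟨⟨fun x hx => ?_, fun x hx => ?_⟩, fun x hx => ?_, fun x hx => ?_⟩
    · exact absurd hx (by simp [glue, pcons, ptail])
    · rw [hp x (by simpa [glue, pcons, ptail] using hx)]; exact (key _ _ _).1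
    · rw [hq x (by simpa [glue, pcons, ptail] using hx)]; exact (key _ _ _).2.1
    · rw [hr x (by simpa [glue, pcons, ptail] using hx)]; exact (key _ _ _).2.2

theorem zc_quarters_of_cst {p q r : BF n} {a : Pt n} (ha : a ≠ 0) (hp : Cst p a) (hq : Cst q a)
    (hr : Cst r a) : zc (glue (glue 0 p) (glue q r)) ≠ 0 := by
  obtain ⟨_, hp⟩ := hp
  obtain ⟨_, hq⟩ := hq
  obtain ⟨_, hr⟩ := hr
  exact zc_quarters a _ _ _ hp hq hr (Or.inl ha)

theorem zc_quarters_of_eq_zero {p q r : BF n} (h : q = 0 ∨ r = 0) :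
    zc (glue (glue 0 p) (glue q r)) ≠ 0 := by
  rcases h with rfl | rfl
  · exact zc_quarters 0 0 1 0 (by simp) (by simp) (by simp) (Or.inr (by decide))
  · exact zc_quarters 0 0 0 1 (by simp) (by simp) (by simp) (Or.inr (by decide))

theorem exists_sq_gt (f : BF n) (B : ℤ) (h : B * (2 ^ n - 1) < 2 ^ n * wt f - (wt f : ℤ) ^ 2) :
    ∃ a, a ≠ 0 ∧ B < S f a ^ 2 := by
  by_contra! hc
  have h1 := Finset.sum_le_card_nsmul (nz n) (fun a => S f a ^ 2) B fun a ha => hc a (mem_nz.1 ha)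
  rw [sum_nz_S_sq, nsmul_eq_mul] at h1
  have h2 : ((nz n).card : ℤ) + 1 = 2 ^ n := by exact_mod_cast card_nz n
  rw [show ((nz n).card : ℤ) = 2 ^ n - 1 by omega] at h1
  linarith [mul_comm B (2 ^ n - 1)]

/-- If two quarters share a constant functional and the third is light, it is constant on the
third, too. -/
theorem cst_third {p q z : BF (n + 1)} {a : Pt (n + 1)} (ha : a ≠ 0) (hp : Deg (k + 2) p)
    (hq : Deg (k + 2) q) (hs : Deg (k + 1) (p + q + z)) (cp : Cst p a)
    (cq : Cst q a) (hw : 2 ^ (k + 1) * wt z < 2 ^ (n + 2)) : Cst z a := by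
  have aux : ∀ {p : BF (n + 1)}, Deg (k + 2) p → Cst p a →
      Deg (k + 1) (lo (act (tr a) p)) ∧ Deg (k + 1) (hi (act (tr a) p)) := by
    intro p hp cp
    have h1 := ((deg_act (tr a) p).2 hp).lo_add_hi
    rcases (cst_tr ha p).1 cp with h | h <;> rw [h] at h1 ⊢
    · exact ⟨Deg.zero _, by simpa using h1⟩
    · exact ⟨by simpa using h1, Deg.zero _⟩
  have h2 := (deg_act (tr a) _).2 hs
  rw [act_add, act_add] at h2
  have h3 := ((aux hp cp).1.add (aux hq cq).1).add_iff_right.1 h2.lo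
  have h4 := ((aux hp cp).2.add (aux hq cq).2).add_iff_right.1 h2.hi
  rw [cst_tr ha]
  by_contra! hc
  have h5 : 2 ^ (n + 1) ≤ 2 ^ (k + 1) * wt (lo (act (tr a) z)) := min_wt h3 hc.1
  have h6 : 2 ^ (n + 1) ≤ 2 ^ (k + 1) * wt (hi (act (tr a) z)) := min_wt h4 hc.2
  have h7 := wt_halves (act (tr a) z)
  rw [wt_act] at h7
  rw [h7, mul_add] at hw
  rw [pow_succ 2 (n + 1)] at hw
  omega

theorem zc_quarters_of_common {p q r : BF (n + 1)}
    (h : Deg (k + 3) (glue (glue 0 p) (glue q r)))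
    (hc : (zc₂ p q ≠ 0 ∧ 2 ^ (k + 1) * wt r < 2 ^ (n + 2)) ∨
      (zc₂ p r ≠ 0 ∧ 2 ^ (k + 1) * wt q < 2 ^ (n + 2))) :
    zc (glue (glue 0 p) (glue q r)) ≠ 0 := by
  obtain ⟨hp, hq, hr, hs⟩ := deg_quarters h
  rcases hc with ⟨hc, hw⟩ | ⟨hc, hw⟩ <;> rw [Ne, zc₂_eq_zero] at hc <;> push Not at hc <;>
    obtain ⟨a, ha, h1, h2⟩ := hc
  · exact zc_quarters_of_cst ha h1 h2 (cst_third ha hp hq hs h1 h2 hw)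
  · exact zc_quarters_of_cst ha h1
      (cst_third ha hp hr (by rwa [add_right_comm] at hs) h1 h2 hw) h2

theorem wt_quarters {p q r : BF n} :
    wt (glue (glue 0 p) (glue q r)) = wt p + wt q + wt r := by
  simp only [wt_glue, wt_zero, zero_add, add_assoc]

theorem zc_ne_zero_of_wt_twelve_of {f : BF (j + 5)} (hf : Deg (j + 3) f) (hw : wt f = 12)
    (H : ∀ p q r : BF (j + 3), Deg (j + 2) p → Deg (j + 2) q → Deg (j + 1) (p + q + r) →
      wt p = 4 → wt q = 4 → wt r = 4 → zc₂ p q ≠ 0) : zc f ≠ 0 := by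
  intro hz
  obtain ⟨a, ha, hS⟩ := exists_sq_gt f 0 (by
    have : (1 : ℤ) ≤ 2 ^ j := one_le_pow₀ (by norm_num)
    rw [hw, pow_add]; push_cast; linarith)
  obtain ⟨p, q, hp, hq, -, hpq, hSa, hC⟩ := exists_halves hf ha
  have hC := mt hC.2 (zc_eq_zero.1 hz a ha)
  push Not at hC
  have h1 := (min_wt_four hp).resolve_left (mt wt_eq_zero.1 hC.1)
  have h2 := (min_wt_four hq).resolve_left (mt wt_eq_zero.1 hC.2)
  have h3 := two_dvd_wt hp.succ
  have h4 := two_dvd_wt hq.succ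
  rw [hw] at hpq
  have h5 : wt p ≠ wt q := fun h => by rw [hSa, h] at hS; norm_num at hS
  have h6 : S f a ^ 2 = (wt f - 2 * (4 : ℕ) : ℤ) ^ 2 := by
    rw [hSa, hw]
    have : (wt p = 4 ∧ wt q = 8) ∨ (wt p = 8 ∧ wt q = 4) := by omega
    rcases this with ⟨h, h'⟩ | ⟨h, h'⟩ <;> rw [h, h'] <;> norm_num
  obtain ⟨E, t, p, q, r, hE, hp4, -⟩ := exists_quarters hf ha h6 fun p hp hw h0 => by
    have := zc_of_min hp (by rw [hw]; ring)
    rw [h0, hw, show j + 3 + 1 = j + 4 from rfl, pow_add] at this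
    omega
  refine zc_ne_zero_of_aff (E := E) (t := t) ?_ hz
  have hD := (deg_aff E t f).2 hf
  have hW := wt_aff E t f
  rw [hE] at hD hW ⊢
  rw [wt_quarters, hw, hp4] at hW
  obtain ⟨hp, hq, hr, hs⟩ := deg_quarters hD
  rcases min_wt_four hq with h7 | h7
  · exact zc_quarters_of_eq_zero (Or.inl (wt_eq_zero.1 h7))
  rcases min_wt_four hr with h8 | h8
  · exact zc_quarters_of_eq_zero (Or.inr (wt_eq_zero.1 h8))
  exact zc_quarters_of_common (k := j) hD (Or.inl
    ⟨H p q r hp hq hs hp4 (by omega) (by omega), by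
      have h9 : 2 ^ (j + 2 + 2) = 2 ^ (j + 1) * 8 := by ring
      have := pow_pos (two_pos (α := ℕ)) (j + 1)
      rw [h9, show wt r = 4 by omega]
      omega⟩)

theorem zc_ne_zero_of_wt_twelve {f : BF 7} (hf : Deg 5 f) (hw : wt f = 12) : zc f ≠ 0 :=
  zc_ne_zero_of_wt_twelve_of hf hw fun p q r hp hq _ hp4 hq4 _ h0 => by
    have := wt_mul_of_min hp (by rw [hp4]; norm_num) hq (by rw [hq4]; norm_num) h0
    rw [hp4, hq4] at this
    omega

theorem zc_six_ne_zero_of_wt_twelve {f : BF 6} (hf : Deg 4 f) (hw : wt f = 12) : zc f ≠ 0 :=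
  zc_ne_zero_of_wt_twelve_of (j := 1) hf hw fun p q r hp hq hs hp4 hq4 hr4 h0 => by
    have h1 := wt_mul_of_min hp (by rw [hp4]; norm_num) hq (by rw [hq4]; norm_num) h0
    rw [hp4, hq4] at h1
    have h2 := wt_add p q
    have h3 := card_Co_pos hs
    rw [card_Co_two (hp.add hq) 16 8 _ (by norm_num) (by
      rw [show wt (p + q) = 6 by omega]; norm_num), show wt (p + q) = 6 by omega, hr4] at h3
    norm_num at h3

theorem zc_ne_zero_of_eight_eight {p q r : BF 6} (hD : Deg 5 (glue (glue 0 p) (glue q r)))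
    (hp8 : wt p = 8) (hq : wt q < 16) (hr : wt r < 16)
    (h : (wt q = 8 ∧ 4 ∣ wt r) ∨ (wt r = 8 ∧ 4 ∣ wt q)) :
    zc (glue (glue 0 p) (glue q r)) ≠ 0 := by
  have core : ∀ {q r : BF 6}, Deg 4 p → Deg 4 q → Deg 3 (p + q + r) → wt q = 8 → 4 ∣ wt r →
      zc₂ p q ≠ 0 := by
    intro q r hp hq hs hq8 hr h0
    have h1 := wt_mul_of_min hp (by rw [hp8]; norm_num) hq (by rw [hq8]; norm_num) h0
    have h2 := wt_add p q
    have h3 := wt_add_mod_four (hp.add hq) hs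
    rw [pi_add_add_cancel] at h3
    rw [hp8, hq8] at h1 h2
    omega
  obtain ⟨dp, dq, dr, hs⟩ := deg_quarters hD
  refine zc_quarters_of_common hD ?_
  rcases h with ⟨h1, h2⟩ | ⟨h1, h2⟩
  · exact Or.inl ⟨core dp dq hs h1 h2, by norm_num; omega⟩
  · exact Or.inr ⟨core dp dr (by rwa [add_right_comm] at hs) h1 h2, by norm_num; omega⟩

/-- A word of weight 24 or 28 without constant functionals splits off a word of weight 8. -/
theorem exists_sq_eq {f : BF (k + 3)} (hf : Deg k f) (hk : k = 4 ∨ k = 5)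
    (hw : wt f = 24 ∨ wt f = 28) (hz : zc f = 0) :
    ∃ a, a ≠ 0 ∧ S f a ^ 2 = (wt f - 2 * (8 : ℕ) : ℤ) ^ 2 := by
  obtain ⟨a, ha, hS⟩ := exists_sq_gt f (if wt f = 24 then 0 else 16) (by
    rcases hw with hw | hw <;> rcases hk with rfl | rfl <;> rw [hw] <;> norm_num)
  obtain ⟨k, rfl⟩ : ∃ j, k = j + 1 := by rcases hk with rfl | rfl <;> exact ⟨_, rfl⟩
  obtain ⟨p, q, hp, hq, -, hpq, hSa, hC⟩ := exists_halves hf ha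
  have hC := mt hC.2 (zc_eq_zero.1 hz a ha)
  push Not at hC
  have h1 := wt_pos.2 hC.1
  have h2 := wt_pos.2 hC.2
  refine ⟨a, ha, ?_⟩
  rw [hSa] at hS ⊢
  have e1 : (wt q : ℤ) = wt f - wt p := by omega
  rw [e1] at hS ⊢
  have h3 : wt p = 8 ∨ wt q = 8 ∨ (wt p = 12 ∧ wt q = 12) ∨ (wt p = 12 ∧ wt q = 16) ∨
      (wt p = 16 ∧ wt q = 12) ∨ (wt p = 14 ∧ wt q = 14) := by
    have := wt_eight_cases hp
    have := wt_eight_cases hq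
    omega
  rcases h3 with h | h | ⟨h, h'⟩ | ⟨h, h'⟩ | ⟨h, h'⟩ | ⟨h, h'⟩
  · rw [h]; push_cast; ring
  · rw [show (wt p : ℤ) = wt f - 8 by omega]; push_cast; ring
  all_goals
    have e2 : wt f = wt p + wt q := hpq.symm
    rw [e2, h, h'] at hS
    norm_num at hS

theorem zc_ne_zero_of_wt {f : BF 8} (hf : Deg 5 f) (hw : wt f = 24 ∨ wt f = 28) : zc f ≠ 0 := by
  intro hz
  obtain ⟨a, ha, h6⟩ := exists_sq_eq hf (Or.inr rfl) hw hz
  obtain ⟨E, t, p, q, r, hE, hp8, -⟩ := exists_quarters hf ha h6 fun p hp hw h0 => by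
    have := zc_of_min hp (by rw [hw]; norm_num)
    rw [h0, hw] at this
    norm_num at this
  refine zc_ne_zero_of_aff (E := E) (t := t) ?_ hz
  have hD := (deg_aff E t f).2 hf
  have hW := wt_aff E t f
  rw [hE] at hD hW ⊢
  rw [wt_quarters, hp8] at hW
  obtain ⟨hp, hq, hr, hs⟩ := deg_quarters hD
  have h7 := wt_eight_cases hq
  have h8 := wt_eight_cases hr
  rcases eq_or_ne (wt q) 0 with h9 | h9
  · exact zc_quarters_of_eq_zero (Or.inl (wt_eq_zero.1 h9))
  rcases eq_or_ne (wt r) 0 with h10 | h10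
  · exact zc_quarters_of_eq_zero (Or.inr (wt_eq_zero.1 h10))
  exact zc_ne_zero_of_eight_eight hD hp8 (by omega) (by omega) (by omega)

theorem der_eq_zero_iff {f : BF (n + 1)} {E : GLn (n + 1)} :
    der (E (pcons 1 0)) f = 0 ↔ lo (act E f) = hi (act E f) := by
  refine ⟨lo_act_eq_hi, fun h => ?_⟩
  have key : ∀ x, f (E x + E (pcons 1 0)) = f (E x) := by
    rw [forall_pcons]
    simp only [← map_add, pcons_add, add_zero]
    exact ⟨fun x => (congrFun h x).symm, fun x => congrFun h x⟩
  funext x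
  have := key (E.symm x)
  rw [LinearEquiv.apply_symm_apply] at this
  show f _ + f x = 0
  rw [this, CharTwo.add_self_eq_zero]

theorem glue_zero_zero : glue (0 : BF n) 0 = 0 := ext_halves.2 ⟨rfl, rfl⟩

theorem der_glue (e : Pt n) (f g : BF n) :
    der (pcons 0 e) (glue f g) = glue (der e f) (der e g) := by
  rw [ext_halves]
  constructor <;> funext x <;> simp [der, lo, hi, glue, pcons_add, pcons, ptail]

theorem exists_period_third {p q z : BF 5} (hp : Deg 3 p) (hq : Deg 3 q)
    (hs : Deg 2 (p + q + z)) (hp8 : wt p = 8) (hq8 : wt q = 8) (hz : wt z < 16)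
    (h0 : zc₂ p q = 0) : wt z % 8 = 4 ∧ ∃ e, e ≠ 0 ∧ der e p = 0 ∧ der e q = 0 ∧ der e z = 0 := by
  have h1 := wt_mul_of_min hp (by rw [hp8]; norm_num) hq (by rw [hq8]; norm_num) h0
  rw [hp8, hq8] at h1
  obtain ⟨e, he, h2, h3⟩ := exists_common_period hp (by rw [hp8]; norm_num) hq
    (by rw [hq8]; norm_num) (by omega)
  have h4 := wt_add p q
  obtain ⟨E, rfl⟩ := exists_first_vector he
  have h5 := lo_act_eq_hi h2
  have h6 := lo_act_eq_hi h3
  have h7 := (deg_act E _).2 hs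
  have h8 := (deg_act E _).2 (hp.add hq)
  have h9 : lo (act E z) = hi (act E z) := by
    have h10 := h7.lo_add_hi
    rw [act_add, act_add, lo_add, lo_add, hi_add, hi_add, h5, h6,
      add_add_add_comm, pi_add_self, zero_add] at h10
    rcases deg_one_cases h10 with h | h
    · exact pi_add_eq_zero.1 h
    · have h11 := wt_halves (act E z)
      have h12 := wt_add_one (lo (act E z))
      rw [← h, pi_add_add_cancel] at h12
      rw [wt_act] at h11
      omega
  refine ⟨?_, _, he, h2, h3, der_eq_zero_iff.2 h9⟩
  generalize hsE : act E (p + q) = s at *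
  have e1 : lo s = hi s := by rw [← hsE, act_add, lo_add, hi_add, h5, h6]
  rw [act_add, hsE] at h7
  have h13 := wt_add (lo s) (lo (s + act E z))
  rw [lo_add, pi_add_add_cancel] at h13
  have h14 : Deg 2 (lo s + lo (act E z)) := h7.lo
  have h15 := four_dvd_wt h14 (by norm_num) (by norm_num)
  have h16 := two_dvd_wt (h8.lo.mul h14)
  have h17 := wt_halves (act E z)
  have h18 := wt_halves s
  rw [← h9, wt_act] at h17
  rw [← e1, ← hsE, wt_act] at h18
  rw [← hsE] at h13 h15 h16
  omega

/-- A word of weight 24 or 28 without constant functionals has weight 28 and a period. -/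
theorem exists_period_of_zc_eq_zero {f : BF 7} (hf : Deg 4 f) (hw : wt f = 24 ∨ wt f = 28)
    (hz : zc f = 0) : wt f = 28 ∧ ∃ e, e ≠ 0 ∧ der e f = 0 := by
  obtain ⟨a, ha, h6⟩ := exists_sq_eq hf (Or.inl rfl) hw hz
  obtain ⟨E, t, p, q, r, hE, hp8, -⟩ := exists_quarters hf ha h6 fun p hp hw h0 => by
    have := zc_of_min hp (by rw [hw]; norm_num)
    rw [h0, hw] at this
    norm_num at this
  have hz' : zc (glue (glue 0 p) (glue q r)) = 0 := by
    by_contra hc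
    rw [← hE] at hc
    exact zc_ne_zero_of_aff hc hz
  have hD := (deg_aff E t f).2 hf
  have hW := wt_aff E t f
  rw [hE] at hD hW
  rw [wt_quarters, hp8] at hW
  obtain ⟨hp, hq, hr, hs⟩ := deg_quarters hD
  have h7 := wt_three_five hq
  have h8 := wt_three_five hr
  have h9 : wt q ≠ 0 := fun h => zc_quarters_of_eq_zero (Or.inl (wt_eq_zero.1 h)) hz'
  have h10 : wt r ≠ 0 := fun h => zc_quarters_of_eq_zero (Or.inr (wt_eq_zero.1 h)) hz'
  have main : (wt q = 12 ∨ wt r = 12) ∧ ∃ e, e ≠ 0 ∧ der e p = 0 ∧ der e q = 0 ∧ der e r = 0 := by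
    rcases eq_or_ne (wt q) 8 with h11 | h11
    · have h12 : zc₂ p q = 0 := by
        by_contra hc
        exact zc_quarters_of_common hD (Or.inl ⟨hc, by norm_num; omega⟩) hz'
      obtain ⟨h13, h14⟩ := exists_period_third hp hq hs hp8 h11 (by omega) h12
      exact ⟨Or.inr (by omega), h14⟩
    · have h11 : wt r = 8 := by omega
      have h12 : zc₂ p r = 0 := by
        by_contra hc
        exact zc_quarters_of_common hD (Or.inr ⟨hc, by norm_num; omega⟩) hz'
      obtain ⟨h13, e, he, h14, h15, h16⟩ := exists_period_third hp hr
        (by rwa [add_right_comm] at hs) hp8 h11 (by omega) h12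
      exact ⟨Or.inl (by omega), e, he, h14, h16, h15⟩
  obtain ⟨h11, e, he, h12, h13, h14⟩ := main
  refine ⟨by omega, E (pcons 0 (pcons 0 e)), fun h => he ?_, der_of_aff (t := t) ?_⟩
  · rw [LinearEquiv.map_eq_zero_iff] at h
    funext i
    simpa [pcons] using congrFun h i.succ.succ
  · rw [hE, der_glue, der_glue, der_glue, der_zero, h12, h13, h14]
    simp only [glue_zero_zero]

theorem exists_half_of_zc {f : BF (n + 1)} (hf : Deg (k + 1) f) (hz : zc f ≠ 0) :
    ∃ c : BF n, Deg k c ∧ wt c = wt f ∧ zc f = 1 + 2 * zc c := by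
  obtain ⟨a, ha, h⟩ := zc_pos.1 (Nat.pos_of_ne_zero hz)
  rw [cst_tr ha] at h
  refine ⟨_, ((deg_act (tr a) f).2 hf).lo_add_hi, ?_, by rw [← zc_act (tr a), zc_of_half_zero h]⟩
  rw [← wt_act (tr a) f, wt_halves (act (tr a) f)]
  rcases h with h | h <;> simp [h, wt_zero]

theorem zc_six_eq_zero {f : BF 6} (hf : Deg 3 f) (hw : wt f = 24 ∨ wt f = 28) : zc f = 0 := by
  by_contra hz
  obtain ⟨c, hc, hcw, -⟩ := exists_half_of_zc hf hz
  have := wt_deg_two hc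
  omega

theorem zc_fourteen {f : BF 6} (hf : Deg 4 f) (hw : wt f = 14) : zc f = 0 := by
  by_contra hz
  obtain ⟨c, hc, hcw, -⟩ := exists_half_of_zc hf hz
  exact wt_ne_fourteen hc (hcw.trans hw)

theorem zc_of_wt_twentyfour {f : BF 7} (hf : f ∈ Wd 4 7 24) : zc f = 1 := by
  obtain ⟨hf, hw⟩ := mem_Wd.1 hf
  have hz : zc f ≠ 0 := fun hz => by
    have := (exists_period_of_zc_eq_zero hf (Or.inl hw) hz).1
    omega
  obtain ⟨c, hc, hcw, h⟩ := exists_half_of_zc hf hz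
  rw [h, zc_six_eq_zero hc (by omega)]

theorem zc_eight_of_wt_twentyfour {f : BF 8} (hf : f ∈ Wd 5 8 24) : zc f = 3 := by
  obtain ⟨hf, hw⟩ := mem_Wd.1 hf
  obtain ⟨c, hc, hcw, h⟩ := exists_half_of_zc hf (zc_ne_zero_of_wt hf (by omega))
  rw [h, zc_of_wt_twentyfour (mem_Wd.2 ⟨hc, by omega⟩)]

open scoped Classical in
/-- The number of nonzero periods. -/
noncomputable def pc (f : BF n) : ℕ := ((nz n).filter fun e => der e f = 0).card

theorem pc_eq_zero : pc f = 0 ↔ ∀ e, e ≠ 0 → der e f ≠ 0 := by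
  rw [pc, card_eq_zero, filter_eq_empty_iff]
  simp only [mem_nz]

theorem der_act (E : GLn n) (e : Pt n) (f : BF n) : der e (act E f) = 0 ↔ der (E e) f = 0 := by
  have h1 : der e (act E f) = act E (der (E e) f) := by
    funext x
    simp [der, act_apply]
  rw [h1]
  exact ⟨fun h => (act E).injective (h.trans (act_zero E).symm), fun h => h ▸ act_zero E⟩

theorem pc_act (E : GLn n) (f : BF n) : pc (act E f) = pc f := by
  refine card_nbij' E E.symm (fun e he => ?_) (fun e he => ?_) (fun e _ => by simp)
    fun e _ => by simp
  · simpa [mem_nz, der_act] using he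
  · simpa [mem_nz, der_act] using he

theorem exists_glue_self {f : BF (n + 1)} (h : pc f ≠ 0) :
    ∃ E s, act E f = glue s s := by
  rw [Ne, pc_eq_zero] at h
  push Not at h
  obtain ⟨e, he, h⟩ := h
  obtain ⟨E, rfl⟩ := exists_first_vector he
  refine ⟨E, lo (act E f), ?_⟩
  nth_rw 2 [lo_act_eq_hi h]
  exact (glue_lo_hi _).symm

theorem deg_glue_self {s : BF n} : Deg (k + 1) (glue s s) ↔ Deg (k + 1) s := by
  rw [deg_glue, pi_add_self]
  exact and_iff_left (Deg.zero _)

theorem zc_glue_self {s : BF n} (hs : s ≠ 0) (h : zc s = 0) : zc (glue s s) = 0 := by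
  rw [zc_eq_zero] at h ⊢
  obtain ⟨x, hx⟩ : ∃ x, s x = 1 := by
    by_contra! hc
    exact hs (funext fun x => zmod2_ne_one.1 (hc x))
  rintro a ha ⟨c, hc⟩
  rw [← pcons_ptail a] at ha hc
  rw [forall_pcons] at hc
  simp only [dot_pcons, mul_zero, mul_one, zero_add] at hc
  have h1 := hc.1 x hx
  have h2 := hc.2 x hx
  have h3 : a 0 = 0 := by rw [← h2] at h1; simpa using h1.symm
  rw [h3] at ha
  exact h (ptail a) (fun h => ha (h ▸ pcons_zero)) ⟨c, hc.1⟩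

theorem der_glue_self (t : ZMod 2) (e : Pt n) (s : BF n) :
    der (pcons t e) (glue s s) = glue (der e s) (der e s) := by
  rw [ext_halves]
  constructor <;> funext x <;> simp [der, lo, hi, glue, pcons_add, pcons, ptail]

theorem pc_glue_self {s : BF (n + 1)} (hs : Deg n s) (hw : ¬ 4 ∣ wt s) : pc (glue s s) = 1 := by
  have h1 : pc s = 0 := by
    by_contra h
    obtain ⟨E, c, hE⟩ := exists_glue_self h
    have h2 := (deg_act E s).2 hs
    rw [hE] at h2
    have h3 := two_dvd_wt (show Deg n c from by simpa using h2.lo)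
    have h4 := wt_act E s
    rw [hE, wt_glue] at h4
    omega
  rw [pc_eq_zero] at h1
  rw [pc, card_eq_one]
  refine ⟨pcons 1 0, ?_⟩
  ext e
  rw [mem_filter, mem_nz, mem_singleton, ← pcons_ptail e, der_glue_self]
  constructor
  · rintro ⟨h2, h3⟩
    have h4 : ptail e = 0 := by
      by_contra h4
      exact h1 _ h4 (ext_halves.1 h3).1
    rw [h4] at h2 ⊢
    rcases zmod2_cases (e 0) with h | h <;> rw [h] at h2 ⊢
    exact absurd pcons_zero h2
  · intro h
    have h4 : ptail e = 0 := by
      funext i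
      simpa [pcons] using congrFun h i.succ
    rw [h]
    refine ⟨fun h0 => ?_, ?_⟩
    · simpa [pcons] using congrFun h0 0
    · rw [h4, show der 0 s = 0 from funext fun x => ?_, glue_zero_zero]
      show s (x + 0) + s x = 0
      rw [add_zero, CharTwo.add_self_eq_zero]

open scoped Classical in
/-- Counting pairs of a word and a period. -/
theorem sum_pc_mul {t : ℕ} (F : BF (n + 1) → ℕ) (hF : ∀ E w, F (act E w) = F w) :
    ∑ w ∈ Wd (k + 1) (n + 1) (t + t), pc w * F w =
      (nz (n + 1)).card * ∑ s ∈ Wd (k + 1) n t, F (glue s s) := by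
  have h1 : ∀ w : BF (n + 1), pc w * F w = ∑ e ∈ nz (n + 1), if der e w = 0 then F w else 0 := by
    intro w
    rw [← sum_filter, sum_const, smul_eq_mul, pc]
  simp only [h1]
  rw [sum_comm, ← smul_eq_mul, ← sum_const]
  refine sum_congr rfl fun e he => ?_
  obtain ⟨E, rfl⟩ := exists_first_vector (mem_nz.1 he)
  simp only [der_eq_zero_iff]
  have h2 := sum_Wd_act (k := k + 1) E (t + t) fun v => if lo v = hi v then F v else 0
  simp only [hF] at h2
  rw [h2, ← sum_filter]
  refine sum_nbij' lo (fun s => glue s s) (fun w hw => ?_) (fun s hs => ?_) (fun w hw => ?_)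
    (fun s hs => by simp) fun w hw => ?_
  · obtain ⟨hw, h⟩ := mem_filter.1 hw
    obtain ⟨hd, hw⟩ := mem_Wd.1 hw
    refine mem_Wd.2 ⟨hd.lo, ?_⟩
    rw [wt_halves, ← h] at hw
    omega
  · obtain ⟨hd, hw⟩ := mem_Wd.1 hs
    simp only [mem_filter, mem_Wd, lo_glue, hi_glue, and_true, deg_glue_self, wt_glue, hw, hd]
  · have h := (mem_filter.1 hw).2
    nth_rw 2 [h]
    exact glue_lo_hi w
  · have h := (mem_filter.1 hw).2
    nth_rw 2 [h]
    rw [glue_lo_hi]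

theorem zc_add_pc {f : BF 7} (hf : f ∈ Wd 4 7 28) : zc f + pc f = 1 := by
  obtain ⟨hf, hw⟩ := mem_Wd.1 hf
  have key : pc f ≠ 0 → zc f = 0 ∧ pc f = 1 := by
    intro h
    obtain ⟨E, s, hE⟩ := exists_glue_self h
    have hd := (deg_act E f).2 hf
    have hw' := wt_act E f
    rw [hE, wt_glue, hw] at hw'
    rw [hE, deg_glue_self] at hd
    have h14 : wt s = 14 := by omega
    rw [← zc_act E, ← pc_act E, hE]
    exact ⟨zc_glue_self (wt_pos.1 (by omega)) (zc_fourteen hd h14),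
      pc_glue_self (hd.mono (by norm_num)) (by omega)⟩
  rcases eq_or_ne (zc f) 0 with hz | hz
  · obtain ⟨-, e, he, h⟩ := exists_period_of_zc_eq_zero hf (Or.inr hw) hz
    have := key fun h0 => pc_eq_zero.1 h0 e he h
    omega
  · obtain ⟨c, hc, hcw, h⟩ := exists_half_of_zc hf hz
    rw [zc_six_eq_zero hc (by omega)] at h
    have : pc f = 0 := by
      by_contra h0
      exact hz (key h0).1
    omega

theorem wt_mul_le (f g : BF n) : wt (f * g) ≤ wt f := by
  have := wt_mul_add_wt_mul f g
  omega

/-- A coset containing a word of weight 8 contains no word of weight 12. -/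
theorem wt_ne_twelve {p q : BF 6} (hp : Deg 4 p) (hp8 : wt p = 8) (hpq : Deg 3 (p + q)) :
    wt q ≠ 12 := by
  intro hq
  have h1 := wt_add p q
  have h3 := wt_add p (p + q)
  rw [pi_add_add_cancel] at h3
  have h4 := wt_sixteen_cases hpq
  generalize p + q = g at *
  have hg : wt g = 16 := by omega
  have h6 : wt (p * g) = 6 := by omega
  have h7 : ∀ a, Cst g a → Cst p a := by
    intro a ha
    refine (S_eq_zero_of_min hp (by rw [hp8]; norm_num) a).resolve_right fun h => ?_
    rw [S_eq, hp8] at h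
    have h8 := wt_mul_add_wt_mul p (lin a)
    have h9 := wt_mul_add_wt_mul (p * g) (lin a)
    have h10 := wt_mul_le (p * lin a) g
    have h11 := wt_mul_le (p * (lin a + 1)) g
    rw [mul_right_comm] at h10 h11
    rcases cst_iff_mul.1 ha with h12 | h12
    · rw [mul_assoc, h12, mul_zero, wt_zero] at h9
      omega
    · rw [mul_assoc p g (lin a + 1), h12, mul_zero, wt_zero] at h9
      omega
  have key : ∀ a b : ZMod 2, a * b = 1 → a = 1 ∧ b = 1 := by decide
  obtain ⟨x, hx⟩ : ∃ x, (p * g) x = 1 := by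
    by_contra! hc
    have : p * g = 0 := funext fun x => zmod2_ne_one.1 (hc x)
    rw [this, wt_zero] at h6
    omega
  obtain ⟨hpx, hgx⟩ := key _ _ hx
  have h8 : p * g = p := by
    funext y
    rcases zmod2_cases (p y) with hy | hy
    · show p y * g y = p y
      rw [hy, zero_mul]
    · have : g x = g y := min_support hpq (by rw [hg]; norm_num) fun a ha => by
        obtain ⟨c, hc⟩ := h7 a ha
        rw [hc x hpx, hc y hy]
      show p y * g y = p y
      rw [← this, hgx, mul_one]
  rw [h8] at h6
  omega

theorem wt_eq_eight_of_sum {p q r p' q' r' : BF 6} (hp : Deg 4 p) (hq : Deg 4 q) (hr : Deg 4 r)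
    (hp8 : wt p = 8) (hqr : (wt q = 8 ∧ wt r = 14) ∨ (wt q = 14 ∧ wt r = 8))
    (hpp : Deg 3 (p + p')) (hqq : Deg 3 (q + q')) (hrr : Deg 3 (r + r'))
    (hw : wt p' + wt q' + wt r' = 34) : wt p' = 8 := by
  have key : ∀ {p p' : BF 6}, Deg 4 p → (wt p = 8 ∨ wt p = 14) → Deg 3 (p + p') →
      wt p' % 4 = wt p % 4 ∧ wt p ≤ wt p' := by
    intro p p' hp hw hpp
    have h1 := wt_add_mod_four hp hpp
    rw [pi_add_add_cancel] at h1
    have h2 := wt_eight_cases (hp.add_iff_right.1 hpp.succ)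
    have h3 : wt p' ≠ 0 := fun h0 => by
      rw [wt_eq_zero] at h0
      rw [h0, add_zero] at hpp
      have := min_wt_sixteen hpp
      omega
    exact ⟨h1, by omega⟩
  have h1 := key hp (Or.inl hp8) hpp
  have h2 := (key hq (by omega) hqq).2
  have h3 := (key hr (by omega) hrr).2
  have h4 := wt_ne_twelve hp hp8 hpp
  rcases hqr with ⟨h5, h6⟩ | ⟨h5, h6⟩ <;> omega

theorem wt_halves_sq {p q r : BF 6} {w : BF 8} (hu : Deg 5 (glue (glue 0 p) (glue q r)))
    (hp8 : wt p = 8) (hqr : (wt q = 8 ∧ wt r = 14) ∨ (wt q = 14 ∧ wt r = 8))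
    (hw : Deg 4 (glue (glue 0 p) (glue q r) + w)) (hw34 : wt w = 34) :
    (wt (lo w) - wt (hi w) : ℤ) ^ 2 = 324 := by
  obtain ⟨hp, hq, hr, hs⟩ := deg_quarters hu
  obtain ⟨w0, w1, rfl⟩ : ∃ w0 w1, w = glue w0 w1 := ⟨_, _, (glue_lo_hi w).symm⟩
  obtain ⟨a, b, rfl⟩ : ∃ a b, w0 = glue a b := ⟨_, _, (glue_lo_hi w0).symm⟩
  obtain ⟨c, d, rfl⟩ : ∃ a b, w1 = glue a b := ⟨_, _, (glue_lo_hi w1).symm⟩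
  have h1 := hw.lo.lo_add_hi
  have h2 := hw.lo_add_hi.lo
  have h3 := hw.hi.lo_add_hi
  have h0 := (hw.lo).lo
  simp only [glue_add, lo_glue, hi_glue, zero_add] at h0 h1 h2 h3
  have da : Deg 4 a := h0
  have db : Deg 4 b := hp.add_iff_right.1 (h0.add_iff_right.1 h1.succ)
  have dc : Deg 4 c := hq.add_iff_right.1 (h0.add_iff_right.1 h2.succ)
  have dd : Deg 4 d := hr.add_iff_right.1 ((hq.add dc).add_iff_right.1 h3.succ)
  simp only [wt_glue] at hw34
  simp only [lo_glue, hi_glue, wt_glue]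
  have ea := wt_eight_cases da
  have eb := wt_eight_cases db
  have ec := wt_eight_cases dc
  have ed := wt_eight_cases dd
  have e : wt a = 0 ∨ wt b = 0 ∨ wt c = 0 ∨ wt d = 0 := by omega
  clear ea eb ec ed
  have hrq := hqr.symm.imp And.symm And.symm
  have main : wt a + wt b = 8 ∨ wt c + wt d = 8 := by
    have aux : ∀ {f g : BF 6}, f = g → Deg 3 f → Deg 3 g := fun h hf => h ▸ hf
    rcases e with e | e | e | e <;> rw [e] at hw34 ⊢ <;> rw [wt_eq_zero] at e <;> subst e
    · left
      rw [zero_add]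
      refine wt_eq_eight_of_sum (p' := b) (q' := c) (r' := d) hp hq hr hp8 hqr (aux ?_ h1)
        (aux ?_ h2) (aux ?_ (h3.add h2))
        (by linarith)
      all_goals funext x; simp only [Pi.add_apply, Pi.zero_apply]; grind
    · left
      rw [add_zero]
      refine wt_eq_eight_of_sum (p' := a) (q' := c) (r' := d) hp hr hq hp8 hrq (aux ?_ h1)
        (aux ?_ ((h1.add h2).add hs))
        (aux ?_ (((h1.add h2).add hs).add h3)) (by linarith)
      all_goals funext x; simp only [Pi.add_apply, Pi.zero_apply]; grind
    · right
      rw [zero_add]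
      refine wt_eq_eight_of_sum (p' := d) (q' := b) (r' := a) hp hr hq hp8 hrq (aux ?_ (h3.add hs))
        (aux ?_ ((h1.add h2).add hs)) (aux ?_ h2) (by linarith)
      all_goals funext x; simp only [Pi.add_apply, Pi.zero_apply]; grind
    · right
      rw [add_zero]
      refine wt_eq_eight_of_sum (p' := c) (q' := b) (r' := a) hp hq hr hp8 hqr (aux ?_ (h3.add hs))
        (aux ?_ ((h1.add (h2.add h3)).add hs)) (aux ?_ (h2.add h3)) (by linarith)
      all_goals funext x; simp only [Pi.add_apply, Pi.zero_apply]; grind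
  rcases main with h | h
  · have e1 : (wt a : ℤ) + wt b = 8 := by omega
    have e2 : (wt c : ℤ) + wt d = 26 := by omega
    push_cast
    rw [e1, e2]
    norm_num
  · have e1 : (wt c : ℤ) + wt d = 8 := by omega
    have e2 : (wt a : ℤ) + wt b = 26 := by omega
    push_cast
    rw [e1, e2]
    norm_num

theorem Co_eq_empty_of_wt_thirty {u : BF 8} (hu : u ∈ Wd 5 8 30) : Co 4 u 34 = ∅ := by
  obtain ⟨hu, hw⟩ := mem_Wd.1 hu
  have hz : zc u = 0 := by
    by_contra hz
    obtain ⟨c, hc, hcw, -⟩ := exists_half_of_zc hu hz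
    have := four_dvd_wt hc (by norm_num) (by norm_num)
    omega
  refine eq_empty_of_forall_notMem fun w hwm => ?_
  obtain ⟨hd, hw34⟩ := mem_Co.1 hwm
  have quarter_zero : ∀ {s : ℕ} {a : Pt 8} (ha : a ≠ 0) (hs : S u a ^ 2 = (wt u - 2 * s : ℤ) ^ 2)
      (hz' : ∀ p : BF 7, Deg 5 p → wt p = s → zc p ≠ 0), ∃ (E : GLn 8) (t : Pt 8) (p q r : BF 6),
      aff E t u = glue (glue 0 p) (glue q r) ∧ wt p = s ∧ s + wt q + wt r = 30 ∧ wt q ≠ 0 ∧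
      wt r ≠ 0 ∧ (wt q = 0 ∨ wt q = 8 ∨ wt q = 12 ∨ wt q = 14 ∨ 16 ≤ wt q) ∧
      (wt r = 0 ∨ wt r = 8 ∨ wt r = 12 ∨ wt r = 14 ∨ 16 ≤ wt r) ∧
      ∀ g, S g a ^ 2 = (wt (lo (aff E t g)) - wt (hi (aff E t g)) : ℤ) ^ 2 := by
    intro s a ha hs hz'
    obtain ⟨E, t, p, q, r, hE, hps, hS⟩ := exists_quarters hu ha hs hz'
    have hD := (deg_aff E t u).2 hu
    have hW := wt_aff E t u
    have hz2 : zc (glue (glue 0 p) (glue q r)) = 0 := by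
      by_contra hc
      rw [← hE] at hc
      exact zc_ne_zero_of_aff hc hz
    rw [hE] at hD hW
    rw [wt_quarters, hw, hps] at hW
    obtain ⟨hp, hq, hr, -⟩ := deg_quarters hD
    exact ⟨E, t, p, q, r, hE, hps, hW,
      fun h => zc_quarters_of_eq_zero (Or.inl (wt_eq_zero.1 h)) hz2,
      fun h => zc_quarters_of_eq_zero (Or.inr (wt_eq_zero.1 h)) hz2, wt_eight_cases hq,
      wt_eight_cases hr, hS⟩
  have main : ∀ a ∈ nz 8, 324 * S u a ^ 2 ≤ 192 * S w a ^ 2 + 1296 := by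
    intro a ha
    rw [mem_nz] at ha
    obtain ⟨p, q, hp, hq, -, hpq, hSa, hC⟩ := exists_halves hu ha
    have hC := mt hC.2 (zc_eq_zero.1 hz a ha)
    push Not at hC
    have h1 := wt_pos.2 hC.1
    have h2 := wt_pos.2 hC.2
    have h3 := wt_eight_cases hp
    have h4 := wt_eight_cases hq
    rw [hw] at hpq
    have h5 : (wt p = 14 ∧ wt q = 16) ∨ (wt p = 16 ∧ wt q = 14) ∨ (wt p = 8 ∧ wt q = 22) ∨
        (wt p = 22 ∧ wt q = 8) ∨ (wt p = 12 ∧ wt q = 18) ∨ (wt p = 18 ∧ wt q = 12) := by omega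
    have h6 : S u a ^ 2 = 4 ∨ S u a ^ 2 = (wt u - 2 * (8 : ℕ) : ℤ) ^ 2 ∨
        S u a ^ 2 = (wt u - 2 * (12 : ℕ) : ℤ) ^ 2 := by
      rw [hSa, hw]
      rcases h5 with ⟨h, h'⟩ | ⟨h, h'⟩ | ⟨h, h'⟩ | ⟨h, h'⟩ | ⟨h, h'⟩ | ⟨h, h'⟩ <;> rw [h, h'] <;>
        norm_num
    rcases h6 with h6 | h6 | h6
    · rw [h6]
      nlinarith [sq_nonneg (S w a)]
    · obtain ⟨E, t, p, q, r, hE, hp8, hW, hq0, hr0, hq, hr, hS⟩ :=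
        quarter_zero ha h6 fun p hp hw h0 => by
          have := zc_of_min hp (by rw [hw]; norm_num)
          rw [h0, hw] at this
          norm_num at this
      have hD := (deg_aff E t u).2 hu
      have hD' := (deg_aff E t _).2 hd
      rw [aff_add, hE] at hD'
      rw [hE] at hD
      have hqr : (wt q = 8 ∧ wt r = 14) ∨ (wt q = 14 ∧ wt r = 8) := by omega
      rw [h6, hS w, wt_halves_sq hD hp8 hqr hD' (by rw [wt_aff, hw34]), hw]
      norm_num
    · obtain ⟨E, t, p, q, r, hE, hp8, hW, hq0, hr0, hq, hr, hS⟩ :=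
        quarter_zero ha h6 fun p hp hw => zc_ne_zero_of_wt_twelve hp hw
      omega
  have h7 := sum_le_sum main
  rw [sum_add_distrib, ← mul_sum, ← mul_sum, sum_nz_S_sq, sum_nz_S_sq, hw, hw34, sum_const] at h7
  have h8 := card_nz 8
  rw [show (nz 8).card = 255 by omega] at h7
  norm_num at h7

theorem wt_mem_of_deg_three {p : BF n} (hp : Deg 3 p) (T : Finset ℕ)
    (hT : ∀ s ∈ range (2 ^ n + 1), s ∉ T → ¬ 2 * s = 2 ^ n ∧
      ∀ i ∈ range (n + 1), (2 ^ n - 2 * s : ℤ) ^ 2 ≠ 2 ^ (n + i)) : wt p ∈ T := by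
  by_contra hcon
  obtain ⟨h1, h2⟩ := hT _ (Finset.mem_range.2 (Nat.lt_succ_of_le (wt_le p))) hcon
  have h3 : p ∈ Wd 3 n (wt p) := mem_Wd.2 ⟨hp, rfl⟩
  rw [Wd_three_eq_empty n _ h1 h2] at h3
  exact Finset.notMem_empty p h3

theorem sum_card_Co_of_wt_six {f : BF 4} (hf : f ∈ Wd 3 4 6) :
    ∑ u ∈ Wd 3 4 4, (Co 2 (f + u) 4).card = 320 := by
  obtain ⟨hf1, hf2⟩ := mem_Wd.1 hf
  have h := three_mul_sum_card_Co hf1 (h' := 4) (by norm_num) 4 1 0 16 fun p q hp hpq hw hle => by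
    rw [hf2] at hw
    have hq' := (hp.add_iff_right (g := q)).1 (hpq.mono (by norm_num))
    have h2 := wt_mem_of_deg_three hq' {0, 2, 4, 6, 8} (by decide)
    simp only [Finset.mem_insert, Finset.mem_singleton] at h2
    have h3 : (wt p = 0 ∧ wt q = 6) ∨ (wt p = 2 ∧ wt q = 4) := by omega
    rcases h3 with ⟨h, h'⟩ | ⟨h, h'⟩
    · exact absurd (wt_deg_two (by rwa [wt_eq_zero.1 h, zero_add] at hpq)) (by rw [h']; norm_num)
    · have hq : wt (p + (p + q)) = wt q := by rw [pi_add_add_cancel]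
      have key := fun r => sum_Co_one_eq hp hpq 4 4 r (by norm_num) (by rw [h]; norm_num)
      have hc := fun t => card_Co_two hp 4 4 t (by norm_num) (by rw [h]; norm_num)
      rw [hq] at key
      rw [h] at key hc
      rw [h'] at key
      rw [pairSum, sum_pairs_eq hpq _ hc 4 {2} (by decide) (by decide), Finset.sum_singleton,
        show 4 - 2 = 2 from rfl, key, hc, h, h']
      norm_num
  rw [hf2] at h
  generalize ∑ u ∈ Wd 3 4 4, (Co 2 (f + u) 4).card = N at h ⊢
  norm_num at h
  omega

theorem sum_card_Co_of_wt_twelve {f : BF 5} (hf : f ∈ Wd 3 5 12) :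
    ∑ u ∈ Wd 3 5 8, (Co 2 (f + u) 8).card = 320 := by
  obtain ⟨hf1, hf2⟩ := mem_Wd.1 hf
  have h := three_mul_sum_card_Co hf1 (h' := 8) (by norm_num) 8 1 0 4 fun p q hp hpq hw hle => by
    rw [hf2] at hw
    have hq' := (hp.add_iff_right (g := q)).1 (hpq.mono (by norm_num))
    have h1 := wt_mem_of_deg_three hp {0, 4, 6, 8, 10, 12, 16} (by decide)
    have h2 := wt_mem_of_deg_three hq' {0, 4, 6, 8, 10, 12, 16} (by decide)
    simp only [Finset.mem_insert, Finset.mem_singleton] at h1 h2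
    have h3 : (wt p = 0 ∧ wt q = 12) ∨ (wt p = 4 ∧ wt q = 8) ∨ (wt p = 6 ∧ wt q = 6) := by omega
    have hq : wt (p + (p + q)) = wt q := by rw [pi_add_add_cancel]
    rcases h3 with ⟨h, h'⟩ | ⟨h, h'⟩ | ⟨h, h'⟩
    · exact absurd (wt_deg_two (by rwa [wt_eq_zero.1 h, zero_add] at hpq)) (by rw [h']; norm_num)
    · have key := fun r => sum_Co_one_eq hp hpq 4 8 r (by norm_num) (by rw [h]; norm_num)
      have hc := fun t => card_Co_two hp 4 8 t (by norm_num) (by rw [h]; norm_num)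
      rw [hq] at key
      rw [h] at key hc
      rw [h'] at key
      rw [pairSum, sum_pairs_eq hpq _ hc 8 {4} (by decide) (by decide), Finset.sum_singleton,
        show 8 - 4 = 4 from rfl, key, hc, h, h']
      norm_num
    · have hc := fun t => card_Co_two hp 16 8 t (by norm_num) (by rw [h]; norm_num)
      rw [h] at hc
      rw [pairSum, sum_pairs_eq hpq _ hc 8 ∅ (by decide) (by decide), Finset.sum_empty, h, h']
      norm_num
  rw [hf2] at h
  generalize ∑ u ∈ Wd 3 5 8, (Co 2 (f + u) 8).card = N at h ⊢
  norm_num at h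
  omega

theorem Tri_two_four : Tri 2 4 4 4 6 = 143360 := by
  rw [Tri_comm_right, Tri_comm_left, Tri, sum_congr rfl fun f hf => sum_card_Co_of_wt_six hf,
    sum_const, card_Wd_three_four_six]
  rfl

theorem Tri_two_five : Tri 2 5 8 8 12 = 4444160 := by
  rw [Tri_comm_right, Tri_comm_left, Tri, sum_congr rfl fun f hf => sum_card_Co_of_wt_twelve hf,
    sum_const, card_Wd_three_five_twelve]
  rfl

theorem Wd_eq_empty {t : ℕ} (h : ∀ u : BF n, Deg k u → wt u ≠ t) : Wd k n t = ∅ :=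
  eq_empty_of_forall_notMem fun u hu => h u (mem_Wd.1 hu).1 (mem_Wd.1 hu).2

theorem sum_Wd_eq_zero {t : ℕ} (F : BF n → ℕ) (h : ∀ u : BF n, Deg k u → wt u ≠ t) :
    ∑ u ∈ Wd k n t, F u = 0 := by
  rw [Wd_eq_empty h, sum_empty]

theorem sum_Wd_zero_Co (k n t : ℕ) : ∑ u ∈ Wd (k + 1) n 0, (Co k u t).card = (Wd k n t).card := by
  rw [Wd_zero, sum_singleton, Co_eq_Wd (Deg.zero _)]

/-- Counting words by the weights of their halves. -/
theorem card_Wd_split (k n t : ℕ) (T : Finset ℕ) (hT : ∀ s ∈ T, 2 * s < t)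
    (h : ∀ s, 2 * s < t → s ∉ T → ∑ u ∈ Wd (k + 1) n s, (Co k u (t - s)).card = 0) :
    (Wd (k + 1) (n + 1) t).card = 2 * ∑ s ∈ T, ∑ u ∈ Wd (k + 1) n s, (Co k u (t - s)).card +
      (if 2 ∣ t then ∑ u ∈ Wd (k + 1) n (t / 2), (Co k u (t - t / 2)).card else 0) := by
  rw [Wd, card_Co_split, ← sum_range_symm
    (fun s => ∑ u ∈ Wd (k + 1) n s, (Co k u (t - s)).card) (fun s hs => ?_) T hT h]
  · refine sum_congr rfl fun s _ => sum_congr ?_ fun u _ => ?_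
    · exact Co_eq_Wd (Deg.zero _) s
    · rw [show lo (0 : BF (n + 1)) + hi 0 + u = u by
        rw [show lo (0 : BF (n + 1)) = 0 from rfl, show hi (0 : BF (n + 1)) = 0 from rfl]; simp]
  · have h1 := sum_Co_comm k (t - s) s (0 : BF n) (Deg.zero _)
    simp only [zero_add] at h1
    rw [show t - (t - s) = s by omega, h1]

theorem sum_zc_const {s c : ℕ} (h : ∀ u ∈ Wd k n s, zc u = c) (F : BF n → ℕ) :
    ∑ u ∈ Wd k n s, (zc u : ℤ) * F u = c * (∑ u ∈ Wd k n s, F u : ℕ) := by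
  rw [Nat.cast_sum, mul_sum]
  exact sum_congr rfl fun u hu => by rw [h u hu]

theorem sum_card_Co_four_ten : ∑ u ∈ Wd 4 5 4, (Co 3 u 10).card = 2539520 := by
  have h := sum_zc_Co 2 4 4 10 (by norm_num) {4} (by decide) fun r hr hrT => by
    rw [Finset.mem_singleton] at hrT
    rcases Nat.eq_zero_or_pos r with rfl | h0
    · rw [Tri_zero, sum_Co_two 4 4 _ 4 8 (by norm_num) (by norm_num)]
      norm_num
    · exact Tri_eq_zero _ (Wd_eq_empty fun u hu h => by have := min_wt_four hu; omega)
  rw [sum_singleton, if_pos (by norm_num), show 10 - 4 = 6 from rfl, Tri_two_four,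
    Tri_eq_zero (b := 10 / 2) _
      (Wd_eq_empty fun u hu h => by have := two_dvd_wt hu.succ; omega),
    sum_zc_const (c := 7) fun u hu => by
      have := zc_of_min (mem_Wd.1 hu).1 (by rw [(mem_Wd.1 hu).2]; norm_num)
      rw [(mem_Wd.1 hu).2] at this
      omega] at h
  generalize ∑ u ∈ Wd 4 5 4, (Co 3 u 10).card = N at h ⊢
  norm_num at h
  omega

theorem card_Wd_four_six_fourteen : (Wd 4 6 14).card = 22855680 := by
  have h0 : ∀ s, 2 * s < 14 → s ∉ ({4, 6} : Finset ℕ) →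
      ∑ u ∈ Wd 4 5 s, (Co 3 u (14 - s)).card = 0 := fun s hs hsT => by
    simp only [Finset.mem_insert, Finset.mem_singleton] at hsT
    rcases Nat.eq_zero_or_pos s with rfl | h0
    · rw [sum_Wd_zero_Co, Wd_eq_empty fun u hu => wt_ne_fourteen hu, card_empty]
    · refine sum_Wd_eq_zero _ fun u hu h => ?_
      have h1 := min_wt_four hu
      have h2 := two_dvd_wt hu.succ
      omega
  have h1 := card_Wd_split 3 5 14 {4, 6} (by decide) h0
  rw [sum_pair (by decide), if_pos (by norm_num), sum_Wd_eq_zero (t := 14 / 2) _ fun u hu h => by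
    have := two_dvd_wt hu.succ; omega] at h1
  have h2 := sum_Wd_moment_of 3 5 14 rfl {4, 6} (by decide) h0
  rw [sum_pair (by decide), h1] at h2
  rw [h1]
  have h3 : ∑ u ∈ Wd 4 5 4, (Co 3 u (14 - 4)).card = _ := sum_card_Co_four_ten
  rw [h3] at h2 ⊢
  generalize ∑ u ∈ Wd 4 5 6, (Co 3 u (14 - 6)).card = N at h2 ⊢
  push_cast at h2
  norm_num at h2
  omega

theorem sum_card_Co_eight_twenty : ∑ u ∈ Wd 4 6 8, (Co 3 u 20).card = 159989760 := by
  have h := sum_zc_Co 2 5 8 20 (by norm_num) {8} (by decide) fun r hr hrT => by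
    rw [Finset.mem_singleton] at hrT
    rcases Nat.eq_zero_or_pos r with rfl | h0
    · rw [Tri_zero, sum_Co_two 5 8 _ 4 16 (by norm_num) (by norm_num)]
      norm_num
    · refine Tri_eq_zero _ (Wd_eq_empty fun u hu h => ?_)
      have h1 := min_wt_eight hu
      have h2 := two_dvd_wt (hu.mono (by norm_num : 3 ≤ 5))
      omega
  rw [sum_singleton, if_pos (by norm_num), show 20 - 8 = 12 from rfl, Tri_two_five,
    Tri_eq_zero (b := 20 / 2) _ (Wd_eq_empty fun u hu h => wt_ne_ten hu (h.trans (by norm_num))),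
    sum_zc_const (c := 7) fun u hu => by
      have := zc_of_min (mem_Wd.1 hu).1 (by rw [(mem_Wd.1 hu).2]; norm_num)
      rw [(mem_Wd.1 hu).2] at this
      omega] at h
  generalize ∑ u ∈ Wd 4 6 8, (Co 3 u 20).card = N at h ⊢
  norm_num at h
  omega

theorem zc_six_of_wt_twelve {f : BF 6} (hf : Deg 4 f) (hw : wt f = 12) : zc f = 1 := by
  have hz := zc_six_ne_zero_of_wt_twelve hf hw
  obtain ⟨c, hc, hcw, h⟩ := exists_half_of_zc hf hz
  rw [h]
  by_contra hz
  obtain ⟨d, hd, hdw, -⟩ := exists_half_of_zc hc (by omega)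
  have := wt_deg_two hd
  omega

theorem sum_card_Co_twelve_sixteen : ∑ u ∈ Wd 4 6 12, (Co 3 u 16).card = 671956992 := by
  have h := sum_zc_Co 2 5 12 16 (by norm_num) {0} (by decide) fun r hr hrT => by
    rw [Finset.mem_singleton] at hrT
    exact Tri_eq_zero _ (Wd_eq_empty fun u hu h => by have := min_wt_eight hu; omega)
  rw [sum_singleton, if_pos (by norm_num), Tri_zero,
    sum_Co_two 5 12 _ 16 16 (by norm_num) (by norm_num), card_Wd_three_five_twelve,
    show Tri 2 5 12 (16 / 2) (16 / 2) = 4444160 by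
      rw [← Tri_two_five, Tri_comm_left, Tri_comm_right],
    sum_zc_const (c := 1) fun u hu => zc_six_of_wt_twelve (mem_Wd.1 hu).1 (mem_Wd.1 hu).2] at h
  generalize ∑ u ∈ Wd 4 6 12, (Co 3 u 16).card = N at h ⊢
  norm_num at h
  omega

theorem sum_card_Co_fourteen_fourteen : ∑ u ∈ Wd 4 6 14, (Co 3 u 14).card = 1462763520 := by
  have h0 : ∀ s, 2 * s < 28 → s ∉ ({0, 8, 12} : Finset ℕ) →
      ∑ u ∈ Wd 4 6 s, (Co 3 u (28 - s)).card = 0 := fun s hs hsT => by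
    simp only [Finset.mem_insert, Finset.mem_singleton] at hsT
    refine sum_Wd_eq_zero _ fun u hu h => ?_
    have := wt_eight_cases hu
    omega
  have h1 := card_Wd_split 3 6 28 {0, 8, 12} (by decide) h0
  have h2 := sum_Wd_moment_of 3 6 28 rfl {0, 8, 12} (by decide) h0
  rw [sum_insert (by decide), sum_pair (by decide)] at h1 h2
  rw [if_pos (by norm_num)] at h1
  have h3 : ∑ u ∈ Wd 4 6 8, (Co 3 u (28 - 8)).card = _ := sum_card_Co_eight_twenty
  have h4 : ∑ u ∈ Wd 4 6 12, (Co 3 u (28 - 12)).card = _ := sum_card_Co_twelve_sixteen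
  have h5 : ∑ u ∈ Wd 4 6 0, (Co 3 u (28 - 0)).card = 888832 := by
    rw [sum_Wd_zero_Co]; exact card_Wd_three_six_twentyeight
  generalize ∑ u ∈ Wd 4 6 8, (Co 3 u (28 - 8)).card = X at h1 h2 h3
  generalize ∑ u ∈ Wd 4 6 12, (Co 3 u (28 - 12)).card = Y at h1 h2 h4
  generalize ∑ u ∈ Wd 4 6 0, (Co 3 u (28 - 0)).card = Z at h1 h2 h5
  subst h3 h4 h5
  change _ = _ + ∑ u ∈ Wd 4 6 14, (Co 3 u 14).card at h1
  generalize ∑ u ∈ Wd 4 6 14, (Co 3 u 14).card = N at h1 ⊢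
  generalize (Wd 4 7 28).card = A at h1 h2
  rw [h1] at h2
  push_cast at h2
  omega

/-! ### Power sums of Walsh values over a coset -/

/-- The minimum distance of the dual code. -/
theorem eq_zero_of_orthogonal : ∀ {n r : ℕ} {q : BF n}, (∀ w : BF n, Deg r w → ∑ x, q x * w x = 0) →
    wt q < 2 ^ r → q = 0
  | n, 0, q, _, hw => wt_eq_zero.1 (by omega)
  | 0, r + 1, q, h, _ => by
    ext x
    have := h 1 (deg_const 1)
    rw [Fintype.sum_eq_single x fun y hy => (hy (Subsingleton.elim y x)).elim] at this
    simpa using this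
  | n + 1, r + 1, q, h, hw => by
    have hs : ∀ a b : BF n, ∑ x, q x * glue a b x = ∑ x, lo q x * a x + ∑ x, hi q x * b x :=
      fun a b => by
        rw [sum_halves]
        congr 1
    have h1 : lo q + hi q = 0 := by
      refine eq_zero_of_orthogonal (r := r + 1) (fun w hd => ?_) ?_
      · rw [← h (glue w w) (deg_glue.2 ⟨hd, by rw [pi_add_self]; exact Deg.zero _⟩), hs,
          ← sum_add_distrib]
        exact sum_congr rfl fun x _ => add_mul _ _ _
      · have := wt_add (lo q) (hi q)
        have := wt_halves q
        omega
    rw [pi_add_eq_zero] at h1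
    have h2 : hi q = 0 := by
      refine eq_zero_of_orthogonal (r := r) (fun w hd => ?_) ?_
      · rw [← h (glue 0 w) (deg_glue.2 ⟨Deg.zero _, by rwa [zero_add]⟩), hs]
        simp
      · have := wt_halves q
        rw [h1] at this
        rw [pow_succ] at hw
        omega
    rw [← glue_lo_hi q, h1, h2, glue_zero_zero]

theorem sum_apply_eq_zero {r d : ℕ} (hd : d < 2 ^ r) (p : Fin d → Pt n)
    (hp : ∀ w : BF n, Deg r w → ∑ i, w (p i) = 0) (g : BF n) : ∑ i, g (p i) = 0 := by
  set q : BF n := fun x => ∑ i, if p i = x then 1 else 0 with hq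
  have h1 : ∀ w : BF n, ∑ x, q x * w x = ∑ i, w (p i) := fun w => by
    simp only [hq, sum_mul]
    rw [sum_comm]
    refine sum_congr rfl fun i _ => ?_
    rw [Fintype.sum_eq_single (p i) fun x hx =>
      by rw [if_neg hx.symm, zero_mul], if_pos rfl, one_mul]
  have h2 : wt q ≤ d := by
    rw [wt]
    refine (card_le_card (t := univ.image p) fun x hx => ?_).trans (card_image_le.trans (by simp))
    rw [mem_image]
    by_contra hcon
    push Not at hcon
    have : q x = 0 := sum_eq_zero fun i hi => if_neg (hcon i hi)
    simp [this] at hx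
  have h3 := eq_zero_of_orthogonal (fun w hw => (h1 w).trans (hp w hw)) (h2.trans_lt hd)
  rw [← h1, h3]
  simp

theorem chi_sum {ι : Type*} (s : Finset ι) (a : ι → ZMod 2) :
    chi (∑ i ∈ s, a i) = ∏ i ∈ s, chi (a i) := by
  induction s using Finset.cons_induction with
  | empty => rfl
  | cons i s hi ih => rw [sum_cons, prod_cons, chi_add, ih]

open scoped Classical in
theorem sum_W_pow {r d : ℕ} (hd : d < 2 ^ r) (g : BF n) :
    ∑ w ∈ univ.filter (fun w : BF n => Deg r w), W (g + w) 0 ^ d =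
      ∑ w ∈ univ.filter (fun w : BF n => Deg r w), W w 0 ^ d := by
  have hW : ∀ f : BF n, W f 0 ^ d = ∑ p : Fin d → Pt n, chi (∑ i, f (p i)) := fun f => by
    simp only [chi_sum]
    rw [← Fintype.sum_pow fun x => chi (f x)]
    simp [W, hat]
  simp only [hW]
  rw [sum_comm, sum_comm (s := univ.filter _)]
  refine sum_congr rfl fun p _ => ?_
  by_cases hp : ∀ w : BF n, Deg r w → ∑ i, w (p i) = 0
  · refine sum_congr rfl fun w hw => ?_
    rw [hp w (mem_filter.1 hw).2]
    simp only [Pi.add_apply, sum_add_distrib]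
    rw [hp w (mem_filter.1 hw).2, sum_apply_eq_zero hd p hp, add_zero]
  · push Not at hp
    obtain ⟨v, hv, hv1⟩ := hp
    have key : ∑ w ∈ univ.filter (fun w : BF n => Deg r w), chi (∑ i, w (p i)) = 0 := by
      have h1 : ∑ w ∈ univ.filter (fun w : BF n => Deg r w), chi (∑ i, w (p i)) =
          ∑ w ∈ univ.filter (fun w : BF n => Deg r w), chi (∑ i, (v + w) (p i)) := by
        refine sum_nbij' (fun w => v + w) (fun w => v + w) ?_ ?_ ?_ ?_ ?_
        · exact fun w hw => mem_filter.2 ⟨mem_univ _, hv.add (mem_filter.1 hw).2⟩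
        · exact fun w hw => mem_filter.2 ⟨mem_univ _, hv.add (mem_filter.1 hw).2⟩
        · exact fun w _ => pi_add_add_cancel _ _
        · exact fun w _ => pi_add_add_cancel _ _
        · intro w _
          rw [pi_add_add_cancel]
      simp only [Pi.add_apply, sum_add_distrib, chi_add, zmod2_ne_zero.1 hv1, chi_one] at h1
      rw [← mul_sum] at h1
      linarith
    simp only [Pi.add_apply, sum_add_distrib, chi_add]
    rw [← mul_sum, key, mul_zero]

theorem card_Co_compl (hk : 0 < k) {t : ℕ} (ht : t ≤ 2 ^ n) :
    (Co k f (2 ^ n - t)).card = (Co k f t).card := by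
  obtain ⟨k, rfl⟩ := Nat.exists_eq_succ_of_ne_zero hk.ne'
  have hmem : ∀ s ≤ 2 ^ n, ∀ w ∈ Co (k + 1) f s, w + 1 ∈ Co (k + 1) f (2 ^ n - s) := by
    intro s _ w hw
    obtain ⟨h1, h2⟩ := mem_Co.1 hw
    have := wt_add_one w
    exact mem_Co.2 ⟨by rw [← add_assoc]; exact h1.add (deg_const 1), by omega⟩
  refine card_nbij' (fun w => w + 1) (fun w => w + 1) (fun w hw => ?_) (hmem t ht) ?_ ?_
  · have := hmem _ (Nat.sub_le _ _) w hw
    rwa [show 2 ^ n - (2 ^ n - t) = t by omega] at this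
  · exact fun w _ => by simp only [add_assoc, pi_add_self, add_zero]
  · exact fun w _ => by simp only [add_assoc, pi_add_self, add_zero]

open scoped Classical in
theorem sum_coset_eq (g : BF n) (T : Finset ℕ) (hT : ∀ w, Deg k (g + w) → wt w ∈ T) (F : ℕ → ℤ) :
    ∑ w ∈ univ.filter (fun w : BF n => Deg k w), F (wt (g + w)) =
      ∑ t ∈ T, F t * (Co k g t).card := by
  have h1 : ∑ w ∈ univ.filter (fun w : BF n => Deg k w), F (wt (g + w)) =
      ∑ w ∈ univ.filter (fun w : BF n => Deg k (g + w)), F (wt w) := by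
    refine sum_nbij' (fun w => g + w) (fun w => g + w) ?_ ?_ ?_ ?_ ?_
    · intro w hw
      simpa [pi_add_add_cancel] using hw
    · intro w hw
      simpa using hw
    · exact fun w _ => pi_add_add_cancel _ _
    · exact fun w _ => pi_add_add_cancel _ _
    · exact fun w _ => rfl
  rw [h1, ← sum_fiberwise_of_maps_to (t := T) (g := wt) fun w hw => hT w (mem_filter.1 hw).2]
  refine sum_congr rfl fun t _ => ?_
  rw [mul_comm, ← nsmul_eq_mul, ← sum_const]
  refine sum_congr ?_ fun w hw => ?_
  · ext w
    rw [mem_filter, mem_filter, mem_Co]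
    simp
  · rw [(mem_Co.1 hw).2]

/-- The power moments of order less than `2 ^ k` agree on all cosets. -/
theorem sum_eval_W (P : ℤ[X]) (hP : P.natDegree < 2 ^ k) (g : BF n) (T T' : Finset ℕ)
    (hT : ∀ w, Deg k (g + w) → wt w ∈ T) (hT' : ∀ w : BF n, Deg k w → wt w ∈ T') :
    ∑ t ∈ T, P.eval (2 ^ n - 2 * t : ℤ) * (Co k g t).card =
      ∑ t ∈ T', P.eval (2 ^ n - 2 * t : ℤ) * (Wd k n t).card := by
  classical
  rw [← sum_coset_eq g T hT fun t => P.eval (2 ^ n - 2 * t : ℤ),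
    ← sum_coset_eq 0 T' (by simpa using hT') fun t => P.eval (2 ^ n - 2 * t : ℤ)]
  simp only [← W_zero, eval_eq_sum_range, zero_add]
  rw [sum_comm, sum_comm (s := univ.filter _)]
  refine sum_congr rfl fun i hi => ?_
  rw [← mul_sum, ← mul_sum, sum_W_pow (by rw [mem_range] at hi; omega)]

theorem card_Wd_three_six_thirtytwo : (Wd 3 6 32).card = 1828134 := by
  generalize hA : (Wd 3 6 32).card = A
  have h := moment_three 5 32 hA {0, 8, 12} (by decide) (by decide)
  rw [Finset.sum_insert (by decide), Finset.sum_pair (by decide),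
    sum_Co_two 5 0 _ 1 16 (by norm_num) (by norm_num),
    sum_Co_two 5 8 _ 4 16 (by norm_num) (by norm_num),
    sum_Co_two 5 12 _ 16 16 (by norm_num) (by norm_num), card_Wd_zero, card_Wd_three_five_eight,
    card_Wd_three_five_twelve] at h
  norm_num at h
  omega

theorem card_Co_of_wt_fourteen {s : BF 6} (hs : s ∈ Wd 4 6 14) :
    7 * (Co 3 s 14).card + (Co 3 s 18).card = 3584 := by
  obtain ⟨hs, hw⟩ := mem_Wd.1 hs
  have h := sum_eval_W (k := 3) ((X ^ 2 - C 400) * (X ^ 2 - C 144) * (X ^ 2 - C 16))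
    (by
      refine lt_of_le_of_lt (b := 6) ?_ (by norm_num)
      compute_degree) s {14, 18, 22, 26, 30, 34, 38, 42, 46, 50}
    {0, 16, 24, 28, 32, 36, 40, 48, 64} (fun w hd => ?_) fun w hd =>
      wt_mem_of_deg_three hd _ (by decide)
  · have hc := fun t => card_Co_compl (n := 6) (k := 3) (f := s) (by norm_num) (t := t)
    have hc' := fun t => card_Co_compl (n := 6) (k := 3) (f := 0) (by norm_num) (t := t)
    have h1 : (Co 3 s 50).card = _ := hc 14 (by norm_num)
    have h2 : (Co 3 s 46).card = _ := hc 18 (by norm_num)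
    have h3 : (Wd 3 6 64).card = 1 := (hc' 0 (by norm_num)).trans (card_Wd_zero 3 6)
    have h4 : (Wd 3 6 48).card = _ := (hc' 16 (by norm_num)).trans card_Wd_three_six_sixteen
    have h5 : (Wd 3 6 40).card = _ := (hc' 24 (by norm_num)).trans card_Wd_three_six_twentyfour
    have h6 : (Wd 3 6 36).card = _ := (hc' 28 (by norm_num)).trans card_Wd_three_six_twentyeight
    iterate 17 rw [sum_insert (by decide)] at h
    rw [sum_singleton, sum_singleton, h1, h2, h3, h4, h5, h6, card_Wd_zero,
      card_Wd_three_six_sixteen, card_Wd_three_six_twentyfour, card_Wd_three_six_twentyeight,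
      card_Wd_three_six_thirtytwo] at h
    simp only [eval_mul, eval_sub, eval_pow, eval_X, eval_C] at h
    norm_num at h
    omega
  · have h1 : Deg 4 w := (hs.add_iff_right).1 (hd.mono (by norm_num))
    have h2 := wt_add_mod_four hs hd
    rw [pi_add_add_cancel, hw] at h2
    have h3 := wt_eight_cases h1
    have h4 : _ ∨ _ := wt_eight_cases (f := w + 1) (h1.add (deg_const 1))
    have h5 := wt_add_one w
    simp only [mem_insert, mem_singleton]
    omega

theorem sum_card_Co_fourteen_eighteen : ∑ s ∈ Wd 4 6 14, (Co 3 s 18).card = 71675412480 := by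
  have h := sum_congr rfl fun s hs => card_Co_of_wt_fourteen (s := s) hs
  rw [sum_const, sum_add_distrib, ← mul_sum, sum_card_Co_fourteen_fourteen,
    card_Wd_four_six_fourteen] at h
  generalize ∑ s ∈ Wd 4 6 14, (Co 3 s 18).card = N at h ⊢
  norm_num at h
  omega

theorem add_der_apply (a : Pt n) (f : BF n) (z : Pt n) : (f + der a f) z = f (z + a) := by
  simp only [der, Pi.add_apply]
  rcases zmod2_cases (f z) with h | h <;> rcases zmod2_cases (f (z + a)) with h' | h' <;>
    rw [h, h'] <;> decide

theorem wt_add_der (a : Pt n) (f : BF n) : wt (f + der a f) = wt f := by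
  rw [← wt_comp f (Equiv.addRight a)]
  congr 1
  funext z
  exact add_der_apply a f z

theorem add_der_add_der (a : Pt n) (f : BF n) :
    f + der a f + der a (f + der a f) = f := by
  funext z
  rw [add_der_apply, add_der_apply, pi_add_add_cancel_right]

theorem wt_mul_eq_zero_of_ne {x y : BF 6} (hx : wt x = 8) (hy : wt y = 8) (h : Deg 3 (x + y))
    (hxy : x ≠ y) : x * y = 0 := by
  have h1 := wt_add x y
  have h2 : wt (x + y) ≠ 0 := fun h0 => hxy (pi_add_eq_zero.1 (wt_eq_zero.1 h0))
  have h3 := min_wt_sixteen h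
  exact wt_eq_zero.1 (by omega)

section Flats

variable {x : BF 6}

theorem eq_of_common {x y : BF 6} (hx : wt x = 8) (hy : wt y = 8) (h : Deg 3 (x + y)) {z : Pt 6}
    (hxz : x z = 1) (hyz : y z = 1) : x = y := by
  by_contra hne
  have := congrFun (wt_mul_eq_zero_of_ne hx hy h hne) z
  rw [Pi.mul_apply, hxz, hyz, mul_one] at this
  exact one_ne_zero this

theorem exists_apply_eq_one (hx : f ≠ 0) : ∃ z, f z = 1 := by
  by_contra! h
  exact hx (funext fun z => zmod2_ne_one.1 (h z))

theorem add_der_mem (hx : Deg 4 x) (hw : wt x = 8) (a : Pt 6) : x + der a x ∈ Co 3 x 8 := by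
  rw [mem_Co, pi_add_add_cancel, wt_add_der]
  exact ⟨hx a, hw⟩

theorem exists_unique_flat (hx : Deg 4 x) (hw : wt x = 8) (z : Pt 6) :
    ∃ y ∈ Co 3 x 8, y z = 1 ∧ ∀ y' ∈ Co 3 x 8, y' z = 1 → y' = y := by
  obtain ⟨p, hp⟩ := exists_apply_eq_one (f := x) (by rintro rfl; rw [wt_zero] at hw; omega)
  have h1 : (x + der (z + p) x) z = 1 := by
    rw [add_der_apply, pi_add_add_cancel, hp]
  have h2 := add_der_mem hx hw (z + p)
  refine ⟨_, h2, h1, fun y' hy' h' => ?_⟩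
  rw [mem_Co] at hy' h2
  refine eq_of_common hy'.2 h2.2 ?_ h' h1
  have := hy'.1.add h2.1
  rwa [show x + y' + (x + (x + der (z + p) x)) = y' + (x + der (z + p) x) by
    rw [add_add_add_comm, pi_add_self, zero_add]] at this

theorem eq_add_der (hx : Deg 4 x) (hw : wt x = 8) {y : BF 6} (hy : y ∈ Co 3 x 8) :
    ∃ a, y = x + der a x := by
  rw [mem_Co] at hy
  obtain ⟨p, hp⟩ := exists_apply_eq_one (f := x) (by rintro rfl; rw [wt_zero] at hw; omega)
  obtain ⟨z, hz⟩ := exists_apply_eq_one (f := y) (by rintro rfl; rw [wt_zero] at hy; omega)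
  refine ⟨z + p, eq_of_common hy.2 ((wt_add_der _ _).trans hw) ?_ hz ?_⟩
  · rw [← add_assoc, add_comm y x]
    exact hy.1.add (hx _)
  · rw [add_der_apply, pi_add_add_cancel, hp]

theorem sum_flats_wt_mul (hx : Deg 4 x) (hw : wt x = 8) (w : BF 6) :
    ∑ y ∈ Co 3 x 8, wt (w * y) = wt w := by
  simp only [wt_eq_sum]
  rw [sum_comm]
  refine sum_congr rfl fun z _ => ?_
  obtain ⟨y, hy, hyz, huniq⟩ := exists_unique_flat hx hw z
  rw [sum_eq_single y, Pi.mul_apply, hyz, mul_one]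
  · intro y' hy' hne
    have : y' z = 0 := zmod2_ne_one.1 fun h => hne (huniq y' hy' h)
    rw [Pi.mul_apply, this, mul_zero, if_neg (by decide)]
  · exact fun h => absurd hy h

theorem card_flats (hx : Deg 4 x) (hw : wt x = 8) : (Co 3 x 8).card = 8 := by
  have h := sum_flats_wt_mul hx hw 1
  rw [sum_congr rfl fun y hy => show wt (1 * y) = 8 by rw [one_mul, (mem_Co.1 hy).2], sum_const,
    wt_one] at h
  norm_num at h
  omega

theorem sum_flats_translate {M : Type*} [AddCommMonoid M] (hx : Deg 4 x) (hw : wt x = 8)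
    {y : BF 6} (hy : y ∈ Co 3 x 8) (F : BF 6 → M) (hF : ∀ p q, Deg 2 (p + q) → F p = F q) :
    ∑ z ∈ Co 3 x 8, F (x + y + z) = ∑ z ∈ Co 3 x 8, F z := by
  obtain ⟨a, rfl⟩ := eq_add_der hx hw hy
  have hm : ∀ z ∈ Co 3 x 8, z + der a z ∈ Co 3 x 8 := fun z hz => by
    rw [mem_Co] at hz ⊢
    refine ⟨?_, (wt_add_der _ _).trans hz.2⟩
    rw [← add_assoc]
    exact hz.1.add (((hx.add_iff_right).1 (hz.1.mono (by norm_num))) a)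
  refine sum_bij' (fun z _ => z + der a z) (fun z _ => z + der a z) hm hm
    (fun z _ => add_der_add_der a z) (fun z _ => add_der_add_der a z) fun z hz => hF _ _ ?_
  have : x + (x + der a x) + z + (z + der a z) = der a (x + z) := by
    rw [pi_add_add_cancel, der_add, add_assoc, pi_add_add_cancel]
  rw [this]
  exact (mem_Co.1 hz).1 a

end Flats

theorem sum_sum_flats {M : Type*} [CommSemiring M] (F : BF 6 → M) :
    ∑ x ∈ Wd 4 6 8, ∑ z ∈ Co 3 x 8, F z = 8 * ∑ x ∈ Wd 4 6 8, F x := by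
  have h : ∑ x ∈ Wd 4 6 8, ∑ z ∈ Co 3 x 8, F z = ∑ z ∈ Wd 4 6 8, ∑ x ∈ Co 3 z 8, F z := by
    refine sum_comm' fun x z => ?_
    rw [mem_Wd, mem_Wd, mem_Co, mem_Co]
    constructor
    · rintro ⟨⟨h1, h2⟩, h3, h4⟩
      exact ⟨⟨by rwa [add_comm], h2⟩, (h1.add_iff_right).1 (h3.mono (by norm_num)), h4⟩
    · rintro ⟨⟨h1, h2⟩, h3, h4⟩
      rw [add_comm] at h1
      exact ⟨⟨(h3.add_iff_left).1 (h1.mono (by norm_num)), h2⟩, h1, h4⟩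
  rw [h, mul_sum]
  refine sum_congr rfl fun z hz => ?_
  rw [sum_const, card_flats (mem_Wd.1 hz).1 (mem_Wd.1 hz).2, nsmul_eq_mul]
  norm_num

theorem sum_card_Co_of_wt_eight {f : BF 5} (hf : f ∈ Wd 3 5 8) :
    ∑ u ∈ Wd 3 5 8, (Co 2 (f + u) 8).card = 672 := by
  obtain ⟨hf1, hf2⟩ := mem_Wd.1 hf
  have h := three_mul_sum_card_Co hf1 (h' := 8) (by norm_num) 8 16 768 44
    fun p q hp hpq hw hle => by
    rw [hf2] at hw
    have hq' := (hp.add_iff_right (g := q)).1 (hpq.mono (by norm_num))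
    have h1 := wt_mem_of_deg_three hp {0, 4, 6, 8, 10, 12, 16} (by decide)
    have h2 := wt_mem_of_deg_three hq' {0, 4, 6, 8, 10, 12, 16} (by decide)
    simp only [Finset.mem_insert, Finset.mem_singleton] at h1 h2
    have h3 : (wt p = 0 ∧ wt q = 8) ∨ (wt p = 4 ∧ wt q = 4) := by omega
    have hq : wt (p + (p + q)) = wt q := by rw [pi_add_add_cancel]
    rcases h3 with ⟨h, h'⟩ | ⟨h, h'⟩
    · have key := fun r => sum_Co_one_eq hp hpq 1 8 r (by norm_num) (by rw [h]; norm_num)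
      have hc := fun t => card_Co_two hp 1 8 t (by norm_num) (by rw [h]; norm_num)
      rw [hq] at key
      rw [h] at key hc
      rw [h'] at key
      rw [pairSum, sum_pairs_eq hpq _ hc 8 {0, 8} (by decide) (by decide),
        Finset.sum_pair (by decide), sum_Co_Co_self_comm (by omega) hpq 8,
        show 8 - 8 = 0 from rfl, show 8 - 0 = 8 from rfl, key, hc, h, h']
      norm_num
    · have key := fun r => sum_Co_one_eq hp hpq 4 8 r (by norm_num) (by rw [h]; norm_num)
      have hc := fun t => card_Co_two hp 4 8 t (by norm_num) (by rw [h]; norm_num)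
      rw [hq] at key
      rw [h] at key hc
      rw [h'] at key
      rw [pairSum, sum_pairs_eq hpq _ hc 8 {4} (by decide) (by decide), Finset.sum_singleton,
        show 8 - 4 = 4 from rfl, key, hc, h, h']
      norm_num
  rw [hf2] at h
  generalize ∑ u ∈ Wd 3 5 8, (Co 2 (f + u) 8).card = N at h ⊢
  norm_num at h
  omega

theorem sum_card_Co_eight_sixteen : ∑ u ∈ Wd 4 6 8, (Co 3 u 16).card = 8749440 := by
  have h := sum_zc_Co 2 5 8 16 (by norm_num) {0} (by decide) fun r hr hrT => by
    rw [Finset.mem_singleton] at hrT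
    exact Tri_eq_zero _ (Wd_eq_empty fun u hu h => by have := min_wt_eight hu; omega)
  have h2 : Tri 2 5 8 (16 / 2) (16 / 2) = 620 * 672 := by
    rw [← card_Wd_three_five_eight, ← smul_eq_mul, ← sum_const]
    exact sum_congr rfl fun f hf => sum_card_Co_of_wt_eight hf
  rw [sum_singleton, if_pos (by norm_num), Tri_zero,
    sum_Co_two 5 8 _ 4 16 (by norm_num) (by norm_num), card_Wd_three_five_eight, h2,
    sum_zc_const (c := 7) fun u hu => by
      have := zc_of_min (mem_Wd.1 hu).1 (by rw [(mem_Wd.1 hu).2]; norm_num)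
      rw [(mem_Wd.1 hu).2] at this
      omega] at h
  generalize ∑ u ∈ Wd 4 6 8, (Co 3 u 16).card = N at h ⊢
  norm_num at h
  omega

theorem card_Co_add_flat {x w : BF 6} (hx : wt x = 8) (hw : w ∈ Co 3 x 16) :
    (Co 2 (x + w) 24).card + 4 * wt (w * x) = 16 := by
  obtain ⟨hd, hw⟩ := mem_Co.1 hw
  have h1 := wt_add w x
  have h2 := wt_mul_le x w
  have h3 := wt_mem_of_deg_three hd {0, 16, 24, 28, 32, 36, 40, 48, 64} (by decide)
  simp only [Finset.mem_insert, Finset.mem_singleton] at h3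
  rw [mul_comm x] at h2
  rw [add_comm w] at h1
  have h4 : (wt (x + w) = 24 ∧ wt (w * x) = 0) ∨ (wt (x + w) = 16 ∧ wt (w * x) = 4) := by omega
  rcases h4 with ⟨h, h'⟩ | ⟨h, h'⟩
  · rw [card_Co_two hd 16 32 24 (by norm_num) (by rw [h]; norm_num), h, h']
    norm_num
  · rw [card_Co_two hd 4 32 24 (by norm_num) (by rw [h]; norm_num), h, h']
    norm_num

theorem sum_flats_card_Co {x w : BF 6} (hx : Deg 4 x) (hx8 : wt x = 8)
    (hw : w ∈ Co 3 x 16) : ∑ z ∈ Co 3 x 8, (Co 2 (z + w) 24).card = 64 := by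
  have h1 : ∀ z ∈ Co 3 x 8, (Co 2 (z + w) 24).card + 4 * wt (w * z) = 16 := fun z hz =>
    card_Co_add_flat (mem_Co.1 hz).2 (by rwa [Co_congr (mem_Co.1 hz).1] at hw)
  have h2 := sum_congr rfl h1
  rw [sum_add_distrib, ← mul_sum, sum_flats_wt_mul hx hx8, (mem_Co.1 hw).2, sum_const,
    card_flats hx hx8] at h2
  generalize ∑ z ∈ Co 3 x 8, (Co 2 (z + w) 24).card = N at h2 ⊢
  norm_num at h2
  omega

theorem sum_sum_card_Co_flat :
    ∑ x ∈ Wd 4 6 8, ∑ c ∈ Wd 3 6 24, (Co 2 (c + x) 16).card = 69995520 := by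
  have h1 : ∀ x ∈ Wd 4 6 8, ∑ c ∈ Wd 3 6 24, (Co 2 (c + x) 16).card =
      ∑ w ∈ Co 3 x 16, (Co 2 (x + w) 24).card := fun x hx => by
    rw [sum_Co_Co_comm (by norm_num) (by rw [pi_add_self]; exact Deg.zero _)]
    simp only [add_comm x]
  rw [sum_congr rfl h1]
  have h2 := sum_sum_flats fun z => ∑ w ∈ Co 3 z 16, (Co 2 (z + w) 24).card
  have h3 : ∀ x ∈ Wd 4 6 8, ∑ z ∈ Co 3 x 8, ∑ w ∈ Co 3 z 16, (Co 2 (z + w) 24).card =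
      64 * (Co 3 x 16).card := fun x hx => by
    rw [sum_congr rfl fun z hz => by rw [← Co_congr (mem_Co.1 hz).1], sum_comm,
      sum_congr rfl fun w hw => sum_flats_card_Co (mem_Wd.1 hx).1 (mem_Wd.1 hx).2 hw, sum_const,
      smul_eq_mul, mul_comm]
  rw [sum_congr rfl h3, ← mul_sum, sum_card_Co_eight_sixteen] at h2
  generalize ∑ x ∈ Wd 4 6 8, ∑ w ∈ Co 3 x 16, (Co 2 (x + w) 24).card = N at h2 ⊢
  omega

theorem sum_flats_triple {M : Type*} [CommSemiring M] (F : BF 6 → M)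
    (hF : ∀ p q, Deg 2 (p + q) → F p = F q) :
    ∑ x ∈ Wd 4 6 8, ∑ y ∈ Co 3 x 8, ∑ z ∈ Co 3 x 8, F (x + y + z) =
      64 * ∑ x ∈ Wd 4 6 8, F x := by
  have h : ∀ x ∈ Wd 4 6 8, ∑ y ∈ Co 3 x 8, ∑ z ∈ Co 3 x 8, F (x + y + z) =
      8 * ∑ z ∈ Co 3 x 8, F z := fun x hx => by
    obtain ⟨h1, h2⟩ := mem_Wd.1 hx
    rw [sum_congr rfl fun y hy => sum_flats_translate h1 h2 hy F hF, sum_const, card_flats h1 h2,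
      nsmul_eq_mul]
    norm_num
  rw [sum_congr rfl h, ← mul_sum, sum_sum_flats, ← mul_assoc]
  norm_num

/-- The number of words of weight `24` over a given pair of halves. -/
noncomputable def overPair (c p q : BF 6) : ℕ :=
  ∑ r ∈ range (24 + 1), ∑ z ∈ Co 3 p r, (Co 2 (c + p + q + z) (24 - r)).card

theorem card_Co_glue_add {c p q : BF 6} (hc : Deg 3 c) :
    (Co 3 (glue 0 c + glue p q) 24).card = overPair c p q ∧
      (Co 3 (glue c 0 + glue p q) 24).card = overPair c p q := by
  have h : Deg 3 (c + p + p) := by rwa [add_assoc, pi_add_self, add_zero]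
  rw [glue_add, glue_add, zero_add, zero_add, card_Co_split, card_Co_split, overPair]
  simp only [lo_glue, hi_glue, Co_congr h, add_left_comm p c, ← add_assoc, and_self]

theorem overPair_comm {c p q : BF 6} (h : Deg 3 (p + q)) : overPair c p q = overPair c q p := by
  simp only [overPair, Co_congr h, add_right_comm c p q]

theorem overPair_eq {c p q : BF 6} (hc : Deg 3 c) (hp : Deg 4 p) (hpq : Deg 3 (p + q))
    (hw : wt p = 0 ∨ wt p = 8) :
    overPair c p q = 2 * (∑ z ∈ Co 3 p 0, (Co 2 (c + p + q + z) 24).card +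
      ∑ z ∈ Co 3 p 8, (Co 2 (c + p + q + z) 16).card) := by
  have hd : Deg 3 (c + p + q) := by rw [add_assoc]; exact hc.add hpq
  have hz : ∀ {r z}, z ∈ Co 3 p r → Deg 4 z ∧ wt z = r := fun hz =>
    ⟨(hp.add_iff_right).1 ((mem_Co.1 hz).1.mono (by norm_num : 3 ≤ 4)), (mem_Co.1 hz).2⟩
  rw [overPair, sum_range_symm (fun r => ∑ z ∈ Co 3 p r, (Co 2 (c + p + q + z) (24 - r)).card)
    (fun r hr => ?_) {0, 8} (by decide) (fun r hr hrT => ?_), sum_pair (by decide),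
    if_pos (by norm_num), sum_eq_zero (s := Co 3 p (24 / 2)) fun z hz' => ?_]
  · rfl
  · obtain ⟨h1, h2⟩ := mem_Co.1 hz'
    rcases hw with hw | hw
    · rw [wt_eq_zero.1 hw, zero_add] at h1
      have := min_wt_sixteen h1
      omega
    · exact absurd (h2.trans (by norm_num)) (wt_ne_twelve hp hw h1)
  · rw [sum_Co_Co_self_comm (by norm_num) hd, show 24 - (24 - r) = r by omega]
  · simp only [Finset.mem_insert, Finset.mem_singleton] at hrT
    refine sum_eq_zero fun z hz' => ?_
    obtain ⟨h1, h2⟩ := hz hz'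
    have := wt_eight_cases h1
    omega

theorem sum_card_Co_glue {c : BF 6} (hc : Deg 3 c) {v : BF 7} (hv : v = glue 0 c ∨ v = glue c 0) :
    ∑ u ∈ Wd 4 7 16, (Co 3 (v + u) 24).card =
      4 * ∑ q ∈ Wd 3 6 16, (Co 2 (c + q) 24).card + 2 * ∑ x ∈ Wd 4 6 8, ∑ y ∈ Co 3 x 8,
        ∑ z ∈ Co 3 x 8, (Co 2 (c + (x + y + z)) 16).card := by
  have h0 : ∑ u ∈ Wd 4 7 16, (Co 3 (v + u) 24).card =
      ∑ s ∈ range (16 + 1), ∑ p ∈ Wd 4 6 s, ∑ q ∈ Co 3 p (16 - s), overPair c p q := by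
    have h : ∀ p q, (Co 3 (v + glue p q) 24).card = overPair c p q := fun p q => by
      rcases hv with rfl | rfl
      · exact (card_Co_glue_add hc).1
      · exact (card_Co_glue_add hc).2
    rw [show Wd 4 7 16 = Co (3 + 1) 0 16 from rfl, sum_Co_split]
    simp only [h]
    rw [show lo (0 : BF (6 + 1)) = 0 from rfl, show hi (0 : BF (6 + 1)) = 0 from rfl]
    simp only [zero_add]
  rw [h0, sum_range_symm (fun s => ∑ p ∈ Wd 4 6 s, ∑ q ∈ Co 3 p (16 - s), overPair c p q)
    (fun r hr => ?_) {0} (by decide) (fun r hr hrT => ?_), sum_singleton, if_pos (by norm_num),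
    Wd_zero, sum_singleton]
  · have h1 : ∀ q ∈ Co 3 (0 : BF 6) (16 - 0), overPair c 0 q = 2 * (Co 2 (c + q) 24).card :=
      fun q hq => by
        rw [overPair_eq hc (Deg.zero _) (mem_Co.1 hq).1 (Or.inl wt_zero), Co_eq_Wd (Deg.zero _) 0,
          Wd_zero, sum_singleton, add_zero, add_zero,
          sum_eq_zero (s := Co 3 (0 : BF 6) 8) fun z hz => ?_, add_zero]
        obtain ⟨h1, h2⟩ := mem_Co.1 hz
        rw [zero_add] at h1
        have := min_wt_sixteen h1
        omega
    have h2 : ∀ p ∈ Wd 4 6 (16 / 2), ∀ q ∈ Co 3 p (16 - 16 / 2), overPair c p q =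
        2 * ∑ z ∈ Co 3 p 8, (Co 2 (c + (p + q + z)) 16).card := fun p hp q hq => by
      obtain ⟨hp1, hp2⟩ := mem_Wd.1 hp
      rw [overPair_eq hc hp1 (mem_Co.1 hq).1 (Or.inr hp2),
        sum_eq_zero (s := Co 3 p 0) fun z hz => ?_, zero_add]
      · simp only [add_assoc]
      · obtain ⟨h1, h2⟩ := mem_Co.1 hz
        rw [wt_eq_zero.1 h2, add_zero] at h1
        have := min_wt_sixteen h1
        omega
    rw [sum_congr rfl h1, sum_congr rfl fun p hp => sum_congr rfl (h2 p hp), ← mul_sum]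
    simp only [← mul_sum]
    rw [← mul_assoc]
    rfl
  · rw [sum_comm' (t' := Wd 4 6 r) (s' := fun p => Co 3 p (16 - r)) fun x y => ?_]
    · refine sum_congr rfl fun p hp => sum_congr rfl fun q hq => overPair_comm ?_
      rw [add_comm]
      exact (mem_Co.1 hq).1
    · rw [show 16 - (16 - r) = r by omega, mem_Wd, mem_Wd, mem_Co, mem_Co]
      constructor
      · rintro ⟨⟨h1, h2⟩, h3, h4⟩
        exact ⟨⟨by rwa [add_comm], h2⟩, (h1.add_iff_right).1 (h3.mono (by norm_num : 3 ≤ 4)), h4⟩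
      · rintro ⟨⟨h1, h2⟩, h3, h4⟩
        rw [add_comm] at h1
        exact ⟨⟨(h3.add_iff_left).1 (h1.mono (by norm_num : 3 ≤ 4)), h2⟩, h1, h4⟩
  · rw [Finset.mem_singleton] at hrT
    rw [Wd_eq_empty fun u hu h => by have := min_wt_eight hu; omega, sum_empty]

theorem Tri_three_seven_twentyfour : Tri 3 7 16 24 24 = 9387239178240 := by
  rw [Tri_comm_left, Tri]
  have h := sum_zc_mul (k := 3) (n := 6) (t := 24) (by norm_num)
    (fun v => ((∑ u ∈ Wd 4 7 16, (Co 3 (v + u) 24).card : ℕ) : ℤ)) fun E v => by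
      rw [← sum_Wd_act E (k := 4) (n := 7) 16 fun u => (Co 3 (act E v + u) 24).card]
      simp only [← act_add, card_Co_act]
  have h2 : ∀ c ∈ Wd 3 6 24,
      ((∑ u ∈ Wd 4 7 16, (Co 3 (glue 0 c + u) 24).card : ℕ) : ℤ) +
        (∑ u ∈ Wd 4 7 16, (Co 3 (glue c 0 + u) 24).card : ℕ) =
      ((8 * ∑ q ∈ Wd 3 6 16, (Co 2 (c + q) 24).card +
        256 * ∑ x ∈ Wd 4 6 8, (Co 2 (c + x) 16).card : ℕ) : ℤ) := fun c hc => by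
    rw [sum_card_Co_glue (mem_Wd.1 hc).1 (Or.inl rfl),
      sum_card_Co_glue (mem_Wd.1 hc).1 (Or.inr rfl),
      sum_flats_triple (fun x => (Co 2 (c + x) 16).card) fun p q hpq => congrArg card
        (Co_congr (by rwa [add_add_add_comm, pi_add_self, zero_add]) 16)]
    push_cast
    ring
  rw [sum_zc_const (c := 1) fun u hu => zc_of_wt_twentyfour hu, sum_congr rfl h2, ← Nat.cast_sum,
    sum_add_distrib, ← mul_sum, ← mul_sum, sum_comm (s := Wd 3 6 24) (t := Wd 4 6 8),
    sum_sum_card_Co_flat] at h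
  have h3 : ∑ c ∈ Wd 3 6 24, ∑ q ∈ Wd 3 6 16, (Co 2 (c + q) 24).card = 291648 * 24000 := by
    rw [← Tri_two_six.2.2, Tri_comm_left]
    rfl
  rw [h3] at h
  change _ = 9387239178240
  generalize ∑ u ∈ Wd 4 7 24, ∑ v ∈ Wd 4 7 16, (Co 3 (u + v) 24).card = N at h ⊢
  push_cast at h
  norm_num at h
  omega

theorem sum_card_Co_seven_sixteen : ∑ u ∈ Wd 4 7 16, (Co 3 u 48).card = 302880906048 := by
  have h := sum_zc_Co 2 6 16 48 (by norm_num) {0, 16} (by decide) fun r hr hrT => by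
    simp only [Finset.mem_insert, Finset.mem_singleton] at hrT
    exact Tri_eq_zero _ (Wd_eq_empty fun u hu h => by have := wt_sixteen_cases hu; omega)
  have h1 : Tri 2 6 16 0 (48 - 0) = 2604 * 4 := by
    rw [Tri_zero, sum_Co_two_six_sixteen]
    norm_num
  have h2 : Tri 2 6 16 (48 / 2) (48 / 2) = 291648 * 24000 := Tri_two_six.2.2
  have h3 : Tri 2 6 16 16 (48 - 16) = 673769376 := Tri_two_six_thirtytwo
  rw [sum_pair (by decide), if_pos (by norm_num), h1, h2, h3,
    sum_zc_const (c := 7) fun u hu => by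
      have := zc_of_min (mem_Wd.1 hu).1 (by rw [(mem_Wd.1 hu).2]; norm_num)
      rw [(mem_Wd.1 hu).2] at this
      omega] at h
  generalize ∑ u ∈ Wd 4 7 16, (Co 3 u 48).card = N at h ⊢
  norm_num at h
  omega

theorem sum_card_Co_seven_twentyfour : ∑ u ∈ Wd 4 7 24, (Co 3 u 40).card = 3558142930944 := by
  have h := sum_zc_Co 2 6 24 40 (by norm_num) {0, 16} (by decide) fun r hr hrT => by
    simp only [Finset.mem_insert, Finset.mem_singleton] at hrT
    exact Tri_eq_zero _ (Wd_eq_empty fun u hu h => by have := wt_sixteen_cases hu; omega)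
  have h1 : Tri 2 6 24 0 (40 - 0) = 291648 * 16 := by
    rw [Tri_zero, sum_Co_two_six_twentyfour]
    norm_num
  have h2 : Tri 2 6 24 (40 / 2) (40 / 2) = 0 :=
    Tri_eq_zero _ (Wd_eq_empty fun u hu h => by have := wt_sixteen_cases hu; omega)
  have h3 : Tri 2 6 24 16 (40 - 16) = 291648 * 24000 := by
    rw [Tri_comm_left]; exact Tri_two_six.2.2
  rw [sum_pair (by decide), if_pos (by norm_num), h1, h2, h3,
    sum_zc_const (c := 1) fun u hu => zc_of_wt_twentyfour hu] at h
  generalize ∑ u ∈ Wd 4 7 24, (Co 3 u 40).card = N at h ⊢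
  norm_num at h
  omega

theorem sum_zc_card_Co_seven_twentyeight :
    ∑ u ∈ Wd 4 7 28, zc u * (Co 3 u 36).card = 28897705984 := by
  have h := sum_zc_Co 2 6 28 36 (by norm_num) {0} (by decide) fun r hr hrT => by
    simp only [Finset.mem_singleton] at hrT
    by_cases hr16 : r = 16
    · subst hr16
      rw [Tri_comm_right]
      exact Tri_eq_zero _ (Wd_eq_empty fun u hu h => by have := wt_sixteen_cases hu; omega)
    · exact Tri_eq_zero _ (Wd_eq_empty fun u hu h => by have := wt_sixteen_cases hu; omega)
  have h2 : Tri 2 6 28 (36 / 2) (36 / 2) = 0 :=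
    Tri_eq_zero _ (Wd_eq_empty fun u hu h => by have := wt_sixteen_cases hu; omega)
  rw [sum_singleton, if_pos (by norm_num), h2, Tri_zero, sum_Co_two_six_twentyeight] at h
  zify
  change ∑ u ∈ Wd 4 7 28, _ = _ at h
  generalize ∑ u ∈ Wd 4 7 28, (zc u : ℤ) * (Co 3 u 36).card = N at h ⊢
  norm_num at h
  omega

theorem card_Co_glue_self {s : BF 6} (hs : s ∈ Wd 4 6 14) :
    (Co 3 (glue s s) 36).card = (Co 3 s 18).card := by
  obtain ⟨hs1, hs2⟩ := mem_Wd.1 hs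
  refine card_nbij' lo (fun p => glue p p) (fun w hw => ?_) (fun p hp => ?_) (fun w hw => ?_)
    fun p _ => lo_glue p p
  · obtain ⟨h1, h2⟩ := mem_Co.1 hw
    have h3 : lo w = hi w := (lo_eq_hi_of_glue_self hs1 hs2 h1).resolve_right (by omega)
    have h4 := wt_halves w
    refine mem_Co.2 ⟨?_, by rw [← h3] at h4; omega⟩
    have := h1.lo
    rwa [lo_add, lo_glue] at this
  · obtain ⟨h1, h2⟩ := mem_Co.1 hp
    refine mem_Co.2 ⟨?_, by rw [wt_glue]; omega⟩
    rw [glue_add]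
    exact deg_glue_self.2 h1
  · obtain ⟨h1, h2⟩ := mem_Co.1 hw
    have h3 : lo w = hi w := (lo_eq_hi_of_glue_self hs1 hs2 h1).resolve_right (by omega)
    change glue (lo w) (lo w) = w
    conv_rhs => rw [← glue_lo_hi w, ← h3]

theorem sum_pc_card_Co_seven_twentyeight :
    ∑ u ∈ Wd 4 7 28, pc u * (Co 3 u 36).card = 9102777384960 := by
  have h := sum_pc_mul (k := 3) (n := 6) (t := 14) (fun w => (Co 3 w 36).card) fun E w =>
    card_Co_act E w 36
  rw [sum_congr (s₁ := Wd (3 + 1) 6 14) rfl fun s hs => card_Co_glue_self hs,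
    show Wd (3 + 1) 6 14 = Wd 4 6 14 from rfl, sum_card_Co_fourteen_eighteen] at h
  refine h.trans ?_
  have := card_nz (6 + 1)
  rw [show (nz (6 + 1)).card = 127 by omega]

theorem sum_card_Co_seven_twentyeight : ∑ u ∈ Wd 4 7 28, (Co 3 u 36).card = 9131675090944 := by
  rw [sum_congr rfl fun u hu => show (Co 3 u 36).card =
    zc u * (Co 3 u 36).card + pc u * (Co 3 u 36).card by rw [← add_mul, zc_add_pc hu, one_mul],
    sum_add_distrib, sum_zc_card_Co_seven_twentyeight, sum_pc_card_Co_seven_twentyeight]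

theorem sum_card_Co_eight_of_sixteen :
    ∑ u ∈ Wd 5 8 16, (Co 4 u 48).card = 461609634259200 := by
  have h := sum_zc_Co 3 7 16 48 (by norm_num) {0, 16} (by decide) fun r hr hrT => by
    simp only [Finset.mem_insert, Finset.mem_singleton] at hrT
    exact Tri_eq_zero _ (Wd_eq_empty fun u hu h => by have := wt_sixteen_cases hu; omega)
  have h1 : Tri 3 7 16 0 (48 - 0) = 302880906048 := by
    rw [Tri_zero]; exact sum_card_Co_seven_sixteen
  have h2 : Tri 3 7 16 (48 / 2) (48 / 2) = 9387239178240 := Tri_three_seven_twentyfour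
  have h3 : Tri 3 7 16 16 (48 - 16) = 1791876479232 := Tri_three_seven
  rw [sum_pair (by decide), if_pos (by norm_num), h1, h2, h3,
    sum_zc_const (c := 15) fun u hu => by
      have := zc_of_min (mem_Wd.1 hu).1 (by rw [(mem_Wd.1 hu).2]; norm_num)
      rw [(mem_Wd.1 hu).2] at this
      omega] at h
  generalize ∑ u ∈ Wd 5 8 16, (Co 4 u 48).card = N at h ⊢
  norm_num at h
  omega

theorem sum_card_Co_eight_of_twentyfour :
    ∑ u ∈ Wd 5 8 24, (Co 4 u 40).card = 4401429917122560 := by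
  have h := sum_zc_Co 3 7 24 40 (by norm_num) {0, 16} (by decide) fun r hr hrT => by
    simp only [Finset.mem_insert, Finset.mem_singleton] at hrT
    exact Tri_eq_zero _ (Wd_eq_empty fun u hu h => by have := wt_sixteen_cases hu; omega)
  have h1 : Tri 3 7 24 0 (40 - 0) = 3558142930944 := by
    rw [Tri_zero]; exact sum_card_Co_seven_twentyfour
  have h2 : Tri 3 7 24 (40 / 2) (40 / 2) = 0 :=
    Tri_eq_zero _ (Wd_eq_empty fun u hu h => by have := wt_sixteen_cases hu; omega)
  have h3 : Tri 3 7 24 16 (40 - 16) = 9387239178240 := by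
    rw [Tri_comm_left]; exact Tri_three_seven_twentyfour
  rw [sum_pair (by decide), if_pos (by norm_num), h1, h2, h3,
    sum_zc_const (c := 3) fun u hu => zc_eight_of_wt_twentyfour hu] at h
  generalize ∑ u ∈ Wd 5 8 24, (Co 4 u 40).card = N at h ⊢
  norm_num at h
  omega

theorem sum_card_Co_add {c : BF 7} (hc : Deg 4 c) :
    ∑ r ∈ range (36 + 1), ∑ p ∈ Wd 4 7 r, (Co 3 (c + p) (36 - r)).card = 2 * (Co 3 c 36).card := by
  rw [sum_range_symm (fun r => ∑ p ∈ Wd 4 7 r, (Co 3 (c + p) (36 - r)).card) (fun r hr => ?_) {0}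
    (by decide) (fun r hr hrT => ?_), sum_singleton, if_pos (by norm_num), Wd_zero, sum_singleton,
    add_zero, Wd_eq_empty (t := 36 / 2) fun u hu h => by have := wt_sixteen_cases hu; omega,
    sum_empty]
  · rfl
  · have := sum_Co_comm 3 r (36 - r) c hc
    rw [this, show 36 - (36 - r) = r by omega]
  · rw [Finset.mem_singleton] at hrT
    refine sum_eq_zero fun p hp => ?_
    obtain ⟨hp1, hp2⟩ := mem_Wd.1 hp
    rw [card_eq_zero, eq_empty_iff_forall_notMem]
    intro w hw
    obtain ⟨h1, h2⟩ := mem_Co.1 hw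
    have h3 := wt_sixteen_cases hp1
    have h4 := wt_sixteen_cases (((hc.add hp1).add_iff_right).1 (h1.mono (by norm_num : 3 ≤ 4)))
    omega

theorem zc_mul_of_wt_twentyeight {u : BF 8} (hu : u ∈ Wd 5 8 28) : (zc u : ℤ) * (4 - zc u) = 3 := by
  obtain ⟨hf, hw⟩ := mem_Wd.1 hu
  obtain ⟨c, hc, hcw, h⟩ := exists_half_of_zc hf (zc_ne_zero_of_wt hf (by omega))
  have h1 := zc_add_pc (mem_Wd.2 ⟨hc, hcw.trans hw⟩)
  have h2 : zc c = 0 ∨ zc c = 1 := by omega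
  rcases h2 with h2 | h2 <;> rw [h, h2] <;> norm_num

theorem sum_card_Co_eight_of_twentyeight :
    ∑ u ∈ Wd 5 8 28, (Co 4 u 36).card = 9294658152693760 := by
  have h := sum_zc_Co_mul 3 7 28 36 (by norm_num) (fun u => 4 - zc u) (fun c => 3 - 2 * zc c)
    (fun E w => by rw [zc_act]) fun c hc => by
      constructor
      · rw [zc_of_half_zero (Or.inl (lo_glue 0 c)), lo_glue, hi_glue, zero_add]
        push_cast; ring
      · rw [zc_of_half_zero (Or.inr (hi_glue c 0)), lo_glue, hi_glue, add_zero]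
        push_cast; ring
  have h1 : ∀ u ∈ Wd 5 8 28, (zc u : ℤ) * ((4 - zc u) * (Co 4 u 36).card) =
      3 * (Co 4 u 36).card := fun u hu => by
    rw [← mul_assoc, zc_mul_of_wt_twentyeight hu]
  have h2 : ∀ c ∈ Wd 4 7 28, (3 - 2 * zc c : ℤ) *
      (∑ r ∈ range (36 + 1), ∑ p ∈ Wd 4 7 r, (Co 3 (c + p) (36 - r)).card : ℕ) =
      6 * (Co 3 c 36).card - 4 * (zc c * (Co 3 c 36).card : ℕ) := fun c hc => by
    rw [sum_card_Co_add (mem_Wd.1 hc).1]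
    push_cast
    ring
  have h3 := (sum_congr rfl h2).trans (c := (54674459721728 : ℤ)) <| by
    rw [sum_sub_distrib, ← mul_sum, ← mul_sum, ← Nat.cast_sum, ← Nat.cast_sum,
      sum_zc_card_Co_seven_twentyeight, sum_card_Co_seven_twentyeight]
    norm_num
  rw [sum_congr (s₁ := Wd (3 + 2) (7 + 1) 28) rfl h1, ← mul_sum, ← Nat.cast_sum, h3] at h
  change 3 * ((∑ u ∈ Wd 5 8 28, (Co 4 u 36).card : ℕ) : ℤ) = _ at h
  generalize ∑ u ∈ Wd 5 8 28, (Co 4 u 36).card = N at h ⊢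
  norm_num at h
  omega

theorem card_Wd_four_eight_sixtyfour : (Wd 4 8 64).card = 74984804718940 := by
  have h := sum_Wd_moment_of 3 7 64 rfl {0, 16, 24, 28} (by decide) fun s hs hsT => by
    simp only [Finset.mem_insert, Finset.mem_singleton] at hsT
    refine sum_Wd_eq_zero _ fun u hu h => ?_
    have h1 := wt_sixteen_cases hu
    have h2 := four_dvd_wt hu (by norm_num) (by norm_num)
    omega
  have h0 : ∑ u ∈ Wd 4 7 0, (Co 3 u (64 - 0)).card = 300503590 := by
    rw [sum_Wd_zero_Co]; exact card_Wd_three_seven_sixtyfour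
  have h1 : ∑ u ∈ Wd 4 7 16, (Co 3 u (64 - 16)).card = _ := sum_card_Co_seven_sixteen
  have h2 : ∑ u ∈ Wd 4 7 24, (Co 3 u (64 - 24)).card = _ := sum_card_Co_seven_twentyfour
  have h3 : ∑ u ∈ Wd 4 7 28, (Co 3 u (64 - 28)).card = _ := sum_card_Co_seven_twentyeight
  rw [sum_insert (by decide), sum_insert (by decide), sum_pair (by decide), h0, h1, h2, h3] at h
  change _ * ((Wd 4 8 64).card : ℤ) = _ at h
  generalize (Wd 4 8 64).card = N at h ⊢
  norm_num at h
  omega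

theorem card_Wd_five_nine_sixtyfour : (Wd 5 9 64).card = 89163020044002040 := by
  have h := sum_Wd_moment_of 4 8 64 rfl {0, 16, 24, 28} (by decide) fun s hs hsT => by
    simp only [Finset.mem_insert, Finset.mem_singleton] at hsT
    by_cases hs30 : s = 30
    · subst hs30
      exact sum_eq_zero fun u hu => card_eq_zero.2 (Co_eq_empty_of_wt_thirty hu)
    · refine sum_Wd_eq_zero _ fun u hu h => ?_
      have h1 := wt_sixteen_cases hu
      omega
  have h0 : ∑ u ∈ Wd 5 8 0, (Co 4 u (64 - 0)).card = 74984804718940 := by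
    rw [sum_Wd_zero_Co]; exact card_Wd_four_eight_sixtyfour
  have h1 : ∑ u ∈ Wd 5 8 16, (Co 4 u (64 - 16)).card = _ := sum_card_Co_eight_of_sixteen
  have h2 : ∑ u ∈ Wd 5 8 24, (Co 4 u (64 - 24)).card = _ := sum_card_Co_eight_of_twentyfour
  have h3 : ∑ u ∈ Wd 5 8 28, (Co 4 u (64 - 28)).card = _ := sum_card_Co_eight_of_twentyeight
  rw [sum_insert (by decide), sum_insert (by decide), sum_pair (by decide), h0, h1, h2, h3] at h
  change _ * ((Wd 5 9 64).card : ℤ) = _ at h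
  generalize (Wd 5 9 64).card = N at h ⊢
  norm_num at h
  omega

end BoolFun

/-- `R(4,9)` has exactly `89163020044002040` codewords of weight `64`. -/
theorem statement13 :
    ((RM 4 9).filter (fun f => wt f = 64)).card = 89163020044002040 := by
  refine Eq.trans (congrArg card (Finset.ext fun f => ?_)) BoolFun.card_Wd_five_nine_sixtyfour
  rw [mem_filter, BoolFun.mem_RM, BoolFun.mem_Wd]
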